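/- (Variational principle for weighted topological pressure) For every f ∈ C(X_1,ℝ): P^a(T_1, f) = sup_{μ ∈ M(X_1,T_1)} ( Σ_{i=1}^k a_i h_{τ_{i−1}μ}(T_i) + ∫ f dμ ). -/

import Mathlib

open MeasureTheory Set Filter Topology
open scoped ENNReal symmDiff

namespace WTP

variable {k : ℕ}

/-- cumulative weight `a 1 + … + a i` (zero-indexed: `a 0 + … + a i`). -/
noncomputable def cw (a : Fin k → ℝ) (i : Fin k) : ℝ := ∑ j ∈ Finset.Iic i, a j

/-- Birkhoff sum `S_n f = ∑_{l<n} f ∘ T^l`. -/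
noncomputable def birk {X : Type*} (T : X → X) (f : X → ℝ) (n : ℕ) (x : X) : ℝ :=
  ∑ l ∈ Finset.range n, f (T^[l] x)

/-- a (finite) open cover of a topological space. -/
def IsOpenCover {X : Type*} [TopologicalSpace X] (𝒰 : Set (Set X)) : Prop :=
  𝒰.Finite ∧ (∀ U ∈ 𝒰, IsOpen U) ∧ ⋃₀ 𝒰 = Set.univ

/-- pullback of a cover along a map. -/
def pullCov {X Y : Type*} (g : X → Y) (𝒰 : Set (Set Y)) : Set (Set X) :=
  (fun U => g ⁻¹' U) '' 𝒰

/-- the quantity `exp(−s·n + (1/a₁)·sup_{x∈A} S_{⌈a₁ n⌉} f(x))`, as an element of `ℝ≥0∞`. -/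
noncomputable def pterm {X : Type*} (T1 : X → X) (f : X → ℝ) (a1 s : ℝ) (n : ℕ)
    (A : Set X) : ℝ≥0∞ :=
  ENNReal.ofReal (Real.exp (-(s * n) + (1 / a1) * sSup (birk T1 f ⌈a1 * (n : ℝ)⌉₊ '' A)))

/-- the weighted Bowen ball `B_n^𝐚(x, ε)`. -/
def wBowen {X : Fin k → Type*} [∀ i, MetricSpace (X i)] {X1 : Type*}
    (T : ∀ i, X i → X i) (τ : ∀ i, X1 → X i) (a : Fin k → ℝ)
    (n : ℕ) (x : X1) (ε : ℝ) : Set X1 :=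
  {y | ∀ i : Fin k, ∀ j < ⌈cw a i * (n : ℝ)⌉₊,
      dist ((T i)^[j] (τ i x)) ((T i)^[j] (τ i y)) < ε}

section Bowen

variable [NeZero k] {X : Fin k → Type*} [∀ i, MetricSpace (X i)] {X1 : Type*}
  [MeasurableSpace X1]

/-- `Λ^{𝐚,s}_{N,ε}(Z,f)`. -/
noncomputable def lamBowenN (T1 : X1 → X1) (T : ∀ i, X i → X i) (τ : ∀ i, X1 → X i)
    (a : Fin k → ℝ) (f : X1 → ℝ) (s ε : ℝ) (N : ℕ) (Z : Set X1) : ℝ≥0∞ :=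
  ⨅ (D : Set (ℕ × Set X1)) (_ : D.Countable)
    (_ : ∀ p ∈ D, N ≤ p.1 ∧ MeasurableSet p.2 ∧ ∃ x : X1, p.2 ⊆ wBowen T τ a p.1 x ε)
    (_ : Z ⊆ ⋃ p ∈ D, p.2),
    ∑' p : D, pterm T1 f (a 0) s p.1.1 p.1.2

/-- `Λ^{𝐚,s}_{ε}(Z,f) = lim_{N→∞} Λ^{𝐚,s}_{N,ε}(Z,f)` (an increasing limit). -/
noncomputable def lamBowen (T1 : X1 → X1) (T : ∀ i, X i → X i) (τ : ∀ i, X1 → X i)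
    (a : Fin k → ℝ) (f : X1 → ℝ) (s ε : ℝ) (Z : Set X1) : ℝ≥0∞ :=
  ⨆ N : ℕ, lamBowenN T1 T τ a f s ε N Z

/-- `P^𝐚(T₁, Z, ε, f) = inf {s : Λ^{𝐚,s}_ε(Z,f) = 0}`. -/
noncomputable def PBowenEps (T1 : X1 → X1) (T : ∀ i, X i → X i) (τ : ∀ i, X1 → X i)
    (a : Fin k → ℝ) (Z : Set X1) (f : X1 → ℝ) (ε : ℝ) : EReal :=
  sInf (Real.toEReal '' {s : ℝ | lamBowen T1 T τ a f s ε Z = 0})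

/-- the 𝐚-weighted topological pressure `P^𝐚(T₁, Z, f) = lim_{ε→0} P^𝐚(T₁, Z, ε, f)`
(an increasing limit as `ε` decreases to `0`). -/
noncomputable def PBowen (T1 : X1 → X1) (T : ∀ i, X i → X i) (τ : ∀ i, X1 → X i)
    (a : Fin k → ℝ) (Z : Set X1) (f : X1 → ℝ) : EReal :=
  ⨆ ε : {e : ℝ // 0 < e}, PBowenEps T1 T τ a Z f ε.1

/-- `W^{𝐚,s}_{N,ε}(Z,f)`. -/
noncomputable def wBowenWN (T1 : X1 → X1) (T : ∀ i, X i → X i) (τ : ∀ i, X1 → X i)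
    (a : Fin k → ℝ) (f : X1 → ℝ) (s ε : ℝ) (N : ℕ) (Z : Set X1) : ℝ≥0∞ :=
  ⨅ (D : Set (ℕ × Set X1 × ℝ≥0∞)) (_ : D.Countable)
    (_ : ∀ p ∈ D, N ≤ p.1 ∧ MeasurableSet p.2.1 ∧ 0 < p.2.2 ∧ p.2.2 ≠ ⊤ ∧
        ∃ x : X1, p.2.1 ⊆ wBowen T τ a p.1 x ε)
    (_ : ∀ z ∈ Z, 1 ≤ ∑' p : D, (p.1.2.1).indicator (fun _ => p.1.2.2) z),
    ∑' p : D, p.1.2.2 * pterm T1 f (a 0) s p.1.1 p.1.2.1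

/-- `W^{𝐚,s}_{ε}(Z,f)`. -/
noncomputable def wBowenW (T1 : X1 → X1) (T : ∀ i, X i → X i) (τ : ∀ i, X1 → X i)
    (a : Fin k → ℝ) (f : X1 → ℝ) (s ε : ℝ) (Z : Set X1) : ℝ≥0∞ :=
  ⨆ N : ℕ, wBowenWN T1 T τ a f s ε N Z

/-- `P_W^𝐚(T₁, Z, ε, f)`. -/
noncomputable def PWBowenEps (T1 : X1 → X1) (T : ∀ i, X i → X i) (τ : ∀ i, X1 → X i)
    (a : Fin k → ℝ) (Z : Set X1) (f : X1 → ℝ) (ε : ℝ) : EReal :=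
  sInf (Real.toEReal '' {s : ℝ | wBowenW T1 T τ a f s ε Z = 0})

/-- the average 𝐚-weighted topological pressure `P_W^𝐚(T₁, Z, f)`. -/
noncomputable def PWBowen (T1 : X1 → X1) (T : ∀ i, X i → X i) (τ : ∀ i, X1 → X i)
    (a : Fin k → ℝ) (Z : Set X1) (f : X1 → ℝ) : EReal :=
  ⨆ ε : {e : ℝ // 0 < e}, PWBowenEps T1 T τ a Z f ε.1

end Bowen

section Local

variable [NeZero k] {X1 : Type*} [MeasurableSpace X1]

/-- the cover `⋁_{i=1}^k (τ_{i-1}^{-1} 𝒰_i)_0^{⌈(a_1+…+a_i) n⌉ - 1}` on the first space, where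
`𝒱 i` is the pulled back cover `τ_{i-1}^{-1} 𝒰_i`. -/
def jointFiber (T1 : X1 → X1) (a : Fin k → ℝ) (𝒱 : Fin k → Set (Set X1)) (n : ℕ) :
    Set (Set X1) :=
  {A | ∃ V : Fin k → ℕ → Set X1,
      (∀ i, ∀ l < ⌈cw a i * (n : ℝ)⌉₊, V i l ∈ 𝒱 i) ∧
      A = ⋂ i : Fin k, ⋂ l ∈ Finset.range ⌈cw a i * (n : ℝ)⌉₊, (T1^[l]) ⁻¹' V i l}

/-- `Λ^{𝐚,s}_{N,{𝒰_i}}(Z,f)`. -/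
noncomputable def lamLocN (T1 : X1 → X1) (a : Fin k → ℝ) (𝒱 : Fin k → Set (Set X1))
    (f : X1 → ℝ) (s : ℝ) (N : ℕ) (Z : Set X1) : ℝ≥0∞ :=
  ⨅ (D : Set (ℕ × Set X1)) (_ : D.Countable)
    (_ : ∀ p ∈ D, N ≤ p.1 ∧ MeasurableSet p.2 ∧ ∃ A ∈ jointFiber T1 a 𝒱 p.1, p.2 ⊆ A)
    (_ : Z ⊆ ⋃ p ∈ D, p.2),
    ∑' p : D, pterm T1 f (a 0) s p.1.1 p.1.2

/-- `Λ^{𝐚,s}_{{𝒰_i}}(Z,f)`. -/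
noncomputable def lamLoc (T1 : X1 → X1) (a : Fin k → ℝ) (𝒱 : Fin k → Set (Set X1))
    (f : X1 → ℝ) (s : ℝ) (Z : Set X1) : ℝ≥0∞ :=
  ⨆ N : ℕ, lamLocN T1 a 𝒱 f s N Z

/-- the local 𝐚-weighted topological pressure `P^𝐚(T₁, Z, {𝒰_i}, f)`, expressed through the
pulled-back covers `𝒱 i = τ_{i-1}^{-1} 𝒰_i`. -/
noncomputable def PLoc (T1 : X1 → X1) (a : Fin k → ℝ) (𝒱 : Fin k → Set (Set X1))
    (Z : Set X1) (f : X1 → ℝ) : EReal :=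
  sInf (Real.toEReal '' {s : ℝ | lamLoc T1 a 𝒱 f s Z = 0})

/-- `W^{𝐚,s}_{N,{𝒰_i}}(Z,f)`. -/
noncomputable def wLocN (T1 : X1 → X1) (a : Fin k → ℝ) (𝒱 : Fin k → Set (Set X1))
    (f : X1 → ℝ) (s : ℝ) (N : ℕ) (Z : Set X1) : ℝ≥0∞ :=
  ⨅ (D : Set (ℕ × Set X1 × ℝ≥0∞)) (_ : D.Countable)
    (_ : ∀ p ∈ D, N ≤ p.1 ∧ MeasurableSet p.2.1 ∧ 0 < p.2.2 ∧ p.2.2 ≠ ⊤ ∧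
        ∃ A ∈ jointFiber T1 a 𝒱 p.1, p.2.1 ⊆ A)
    (_ : ∀ z ∈ Z, 1 ≤ ∑' p : D, (p.1.2.1).indicator (fun _ => p.1.2.2) z),
    ∑' p : D, p.1.2.2 * pterm T1 f (a 0) s p.1.1 p.1.2.1

/-- `W^{𝐚,s}_{{𝒰_i}}(Z,f)`. -/
noncomputable def wLoc (T1 : X1 → X1) (a : Fin k → ℝ) (𝒱 : Fin k → Set (Set X1))
    (f : X1 → ℝ) (s : ℝ) (Z : Set X1) : ℝ≥0∞ :=
  ⨆ N : ℕ, wLocN T1 a 𝒱 f s N Z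

/-- the local average 𝐚-weighted topological pressure `P_W^𝐚(T₁, Z, {𝒰_i}, f)`. -/
noncomputable def PWLoc (T1 : X1 → X1) (a : Fin k → ℝ) (𝒱 : Fin k → Set (Set X1))
    (Z : Set X1) (f : X1 → ℝ) : EReal :=
  sInf (Real.toEReal '' {s : ℝ | wLoc T1 a 𝒱 f s Z = 0})

end Local

/-- iterated join `(𝒰)_0^{n-1} = ⋁_{l=0}^{n-1} T^{-l} 𝒰` of a cover. -/
def covJoinT {X : Type*} (T : X → X) (𝒰 : Set (Set X)) (n : ℕ) : Set (Set X) :=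
  {A | ∃ u : ℕ → Set X, (∀ l < n, u l ∈ 𝒰) ∧
      A = ⋂ l ∈ Finset.range n, (T^[l]) ⁻¹' u l}

/-- the join `⋁_{j=i}^{k} 𝒱 j` of covers of a single space (in applications
`𝒱 j = τ_{j-1}^{-1} 𝒰_j`). -/
def joinFrom {X1 : Type*} (𝒱 : Fin k → Set (Set X1)) (i : Fin k) : Set (Set X1) :=
  {A | ∃ V : Fin k → Set X1, (∀ j, i ≤ j → V j ∈ 𝒱 j) ∧ A = ⋂ j ∈ Finset.Ici i, V j}

/-- a finite measurable partition (indexed). -/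
def IsPart {X : Type*} [MeasurableSpace X] {ι : Type*} (β : ι → Set X) : Prop :=
  (∀ i, MeasurableSet (β i)) ∧ (∀ i j, i ≠ j → Disjoint (β i) (β j)) ∧ ⋃ i, β i = Set.univ

/-- the static entropy `H_μ(β) = -∑ μ(B) log μ(B)` of a finite (indexed) partition. -/
noncomputable def entH {X : Type*} [MeasurableSpace X] {ι : Type*} [Fintype ι]
    (μ : Measure X) (β : ι → Set X) : ℝ :=
  ∑ i, Real.negMulLog (μ (β i)).toReal

/-- the dynamical join `⋁_{l=0}^{n-1} T^{-l} β` of a partition. -/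
def dynJoin {X : Type*} (T : X → X) {ι : Type*} (β : ι → Set X) (n : ℕ) :
    (Fin n → ι) → Set X :=
  fun c => ⋂ l : Fin n, (T^[(l : ℕ)]) ⁻¹' β (c l)

/-- the measure-theoretic entropy `h_μ(T, β) = lim_n (1/n) H_μ(⋁_{l<n} T^{-l}β)` of `T`
relative to a finite partition. -/
noncomputable def hPart {X : Type*} [MeasurableSpace X] {ι : Type*} [Fintype ι]
    (μ : Measure X) (T : X → X) (β : ι → Set X) : EReal :=
  Filter.liminf (fun n : ℕ => ((entH μ (dynJoin T β n) / n : ℝ) : EReal)) Filter.atTop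

/-- the Kolmogorov–Sinai entropy `h_μ(T)`. -/
noncomputable def hKS {X : Type*} [MeasurableSpace X] (μ : Measure X) (T : X → X) : EReal :=
  ⨆ p : (Σ m : ℕ, {β : Fin m → Set X // IsPart β}), hPart μ T p.2.1

/-- `H_μ(𝒰) = inf {H_μ(β) : β a finite measurable partition refining 𝒰}`. -/
noncomputable def covH {X : Type*} [MeasurableSpace X] (μ : Measure X)
    (𝒰 : Set (Set X)) : ℝ :=
  sInf {h : ℝ | ∃ (m : ℕ) (β : Fin m → Set X), IsPart β ∧
      (∀ i, ∃ U ∈ 𝒰, β i ⊆ U) ∧ h = entH μ β}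

/-- the local measure-theoretic entropy `h_μ(T, 𝒰) = lim_n (1/n) H_μ((𝒰)_0^{n-1})` of `T`
relative to an open cover. -/
noncomputable def hCov {X : Type*} [MeasurableSpace X] (μ : Measure X) (T : X → X)
    (𝒰 : Set (Set X)) : EReal :=
  Filter.liminf (fun n : ℕ => ((covH μ (covJoinT T 𝒰 n) / n : ℝ) : EReal)) Filter.atTop

/-- `h⁺_μ(T,𝒰) = inf {h_μ(T,β) : β a finite measurable partition refining 𝒰}`. -/
noncomputable def hCovPlus {X : Type*} [MeasurableSpace X] (μ : Measure X) (T : X → X)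
    (𝒰 : Set (Set X)) : EReal :=
  ⨅ p : (Σ m : ℕ, {β : Fin m → Set X // IsPart β ∧ ∀ i, ∃ U ∈ 𝒰, β i ⊆ U}),
    hPart μ T p.2.1

/-- the join `⋁_{j=i}^{k} γ j` of partitions of a single space (in applications
`γ j = τ_{j-1}^{-1} α_j`). -/
def partJoinFrom {X1 : Type*} {ι : Fin k → Type*} (γ : ∀ j, ι j → Set X1) (i : Fin k) :
    (∀ j : {j : Fin k // i ≤ j}, ι j) → Set X1 :=
  fun c => ⋂ j : {j : Fin k // i ≤ j}, γ j (c j)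

/-- the partition `⋁_{i=1}^k (γ_i)_0^{⌈(a_1+…+a_i)N⌉-1}` on the first space, where
`γ i = τ_{i-1}^{-1} α_i`. -/
def bigPartJoin {X1 : Type*} (T1 : X1 → X1) (a : Fin k → ℝ) {ι : Fin k → Type*}
    (γ : ∀ i, ι i → Set X1) (N : ℕ) :
    (∀ i : Fin k, Fin ⌈cw a i * (N : ℝ)⌉₊ → ι i) → Set X1 :=
  fun c => ⋂ i : Fin k, ⋂ l : Fin ⌈cw a i * (N : ℝ)⌉₊, (T1^[(l : ℕ)]) ⁻¹' γ i (c i l)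

/-- conditional entropy `H_μ(γ|β) = H_μ(γ ∨ β) - H_μ(β)`. -/
noncomputable def condEnt {X : Type*} [MeasurableSpace X] {ι κ : Type*} [Fintype ι] [Fintype κ]
    (μ : Measure X) (γ : ι → Set X) (β : κ → Set X) : ℝ :=
  entH μ (fun p : ι × κ => γ p.1 ∩ β p.2) - entH μ β

/-- the oscillation `w_f(⋁_{i=1}^k τ_{i-1}^{-1} 𝒰_i)` of `f` on the joined cover, where
`𝒱 i = τ_{i-1}^{-1} 𝒰_i`. -/
noncomputable def wfJoin {X1 : Type*} (f : X1 → ℝ) (𝒱 : Fin k → Set (Set X1)) : ℝ :=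
  sSup {d : ℝ | ∃ V : Fin k → Set X1, (∀ i, V i ∈ 𝒱 i) ∧
      ∃ x ∈ ⋂ i, V i, ∃ y ∈ ⋂ i, V i, d = |f x - f y|}

/-- the topological support of a measure. -/
def msupp {X : Type*} [TopologicalSpace X] [MeasurableSpace X] (μ : Measure X) : Set X :=
  {x | ∀ U : Set X, IsOpen U → x ∈ U → 0 < μ U}

set_option linter.unusedSectionVars false

section Entropy

variable {Ω : Type*} [MeasurableSpace Ω] {ι κ : Type*}

/-- The Shannon entropy of a finite-valued random variable. -/
noncomputable def ent [Fintype ι] (μ : Measure Ω) (Y : Ω → ι) : ℝ :=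
  ∑ y, Real.negMulLog (μ.real (Y ⁻¹' {y}))

/-- The joint entropy of the random variables `Y e`, `e ∈ S`. -/
noncomputable def jent {E : Type*} [DecidableEq E] [Fintype κ] (μ : Measure Ω) (Y : E → Ω → κ)
    (S : Finset E) : ℝ :=
  ent μ (fun ω (e : S) => Y e ω)

lemma neg_mul_log_le {p a : ℝ} (hp : 0 ≤ p) (ha : 0 ≤ a) (hpa : a = 0 → p = 0) :
    Real.negMulLog p ≤ -(p * Real.log a) + a - p := by
  rcases hp.eq_or_lt with rfl | hp
  · simpa using ha
  have ha' : 0 < a := lt_of_le_of_ne ha fun h => hp.ne' (hpa h.symm)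
  have h := Real.log_le_sub_one_of_pos (div_pos ha' hp)
  rw [Real.log_div ha'.ne' hp.ne'] at h
  have h2 := mul_le_mul_of_nonneg_left h hp.le
  have h3 : p * (a / p - 1) = a - p := by field_simp
  rw [h3] at h2
  unfold Real.negMulLog
  linarith

lemma negMulLog_sum_le {α : Type*} (s : Finset α) (p : α → ℝ) (hp : ∀ x ∈ s, 0 ≤ p x) :
    Real.negMulLog (∑ x ∈ s, p x) ≤ ∑ x ∈ s, Real.negMulLog (p x) := by
  have h : Real.negMulLog (∑ x ∈ s, p x) = ∑ x ∈ s, -(p x * Real.log (∑ x ∈ s, p x)) := by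
    rw [Finset.sum_neg_distrib, ← Finset.sum_mul]; simp [Real.negMulLog]
  rw [h]
  refine Finset.sum_le_sum fun x hx => ?_
  rcases (hp x hx).eq_or_lt with h0 | h0
  · simp [← h0]
  have : Real.log (p x) ≤ Real.log (∑ x ∈ s, p x) :=
    Real.log_le_log h0 (Finset.single_le_sum hp hx)
  have := mul_le_mul_of_nonneg_left this h0.le
  unfold Real.negMulLog
  linarith

variable [Fintype ι] [Fintype κ] [MeasurableSpace ι] [DiscreteMeasurableSpace ι]
  [MeasurableSpace κ] [DiscreteMeasurableSpace κ]

lemma ent_nonneg (μ : Measure Ω) [IsProbabilityMeasure μ] (Y : Ω → ι) : 0 ≤ ent μ Y :=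
  Finset.sum_nonneg fun _ _ => Real.negMulLog_nonneg measureReal_nonneg measureReal_le_one

lemma sum_measureReal_preimage_filter (μ : Measure Ω) [IsFiniteMeasure μ] {Y : Ω → ι}
    (hY : Measurable Y) (s : Finset ι) :
    ∑ y ∈ s, μ.real (Y ⁻¹' {y}) = μ.real (Y ⁻¹' s) := by
  rw [← measureReal_biUnion_finset]
  · congr 1; ext; simp
  · intro a _ b _ hab
    exact Disjoint.preimage _ (by simpa using hab)
  · exact fun b _ => hY (MeasurableSet.of_discrete)

lemma sum_measureReal_preimage (μ : Measure Ω) [IsProbabilityMeasure μ] {Y : Ω → ι}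
    (hY : Measurable Y) : ∑ y, μ.real (Y ⁻¹' {y}) = 1 := by
  rw [sum_measureReal_preimage_filter μ hY]; simp

lemma ent_comp_le [DecidableEq ι] (μ : Measure Ω) [IsFiniteMeasure μ] {Y : Ω → κ}
    (hY : Measurable Y) (φ : κ → ι) : ent μ (φ ∘ Y) ≤ ent μ Y := by
  unfold ent
  rw [← Finset.sum_fiberwise (s := Finset.univ) (g := φ)]
  refine Finset.sum_le_sum fun z _ => ?_
  have : μ.real ((φ ∘ Y) ⁻¹' {z}) = ∑ y ∈ Finset.univ.filter (fun y => φ y = z),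
      μ.real (Y ⁻¹' {y}) := by
    rw [sum_measureReal_preimage_filter μ hY]
    congr 1; ext; simp
  rw [this]
  exact negMulLog_sum_le _ _ fun _ _ => measureReal_nonneg

lemma ent_prod_le (μ : Measure Ω) [IsProbabilityMeasure μ] {Y : Ω → ι} {Z : Ω → κ}
    (hY : Measurable Y) (hZ : Measurable Z) :
    ent μ (fun ω => (Y ω, Z ω)) ≤ ent μ Y + ent μ Z := by
  classical
  set p : ι × κ → ℝ := fun q => μ.real ((fun ω => (Y ω, Z ω)) ⁻¹' {q}) with hp
  set a : ι → ℝ := fun y => μ.real (Y ⁻¹' {y}) with ha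
  set b : κ → ℝ := fun z => μ.real (Z ⁻¹' {z}) with hb
  have hYZ : Measurable fun ω => (Y ω, Z ω) := hY.prodMk hZ
  have hsum1 : ∀ y, ∑ z, p (y, z) = a y := by
    intro y
    have h1 := sum_measureReal_preimage_filter μ hYZ ({y} ×ˢ Finset.univ)
    rw [Finset.sum_product] at h1
    simp only [Finset.sum_singleton] at h1
    rw [hp, h1, ha]
    congr 1; ext; simp [eq_comm]
  have hsum2 : ∀ z, ∑ y, p (y, z) = b z := by
    intro z
    have h1 := sum_measureReal_preimage_filter μ hYZ (Finset.univ ×ˢ {z})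
    rw [Finset.sum_product] at h1
    simp only [Finset.sum_singleton] at h1
    rw [hp, h1, hb]
    congr 1; ext; simp [eq_comm]
  have hpn : ∀ q, 0 ≤ p q := fun _ => measureReal_nonneg
  have key : ∀ q : ι × κ, Real.negMulLog (p q) ≤
      -(p q * Real.log (a q.1)) - p q * Real.log (b q.2) + a q.1 * b q.2 - p q := by
    rintro ⟨y, z⟩
    have h1 : p (y, z) ≤ a y := by
      rw [← hsum1]
      exact Finset.single_le_sum (f := fun z => p (y, z)) (fun _ _ => hpn _) (Finset.mem_univ z)
    have h2 : p (y, z) ≤ b z := by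
      rw [← hsum2]
      exact Finset.single_le_sum (f := fun y => p (y, z)) (fun _ _ => hpn _) (Finset.mem_univ y)
    have ha0 : 0 ≤ a y := measureReal_nonneg
    have hb0 : 0 ≤ b z := measureReal_nonneg
    rcases (hpn (y, z)).eq_or_lt with h0 | h0
    · rw [← h0]; simp; positivity
    have := neg_mul_log_le (hpn (y, z)) (mul_nonneg ha0 hb0) (fun h => by
      rcases mul_eq_zero.1 h with h | h
      · exact le_antisymm (h ▸ h1) (hpn _)
      · exact le_antisymm (h ▸ h2) (hpn _))
    rw [Real.log_mul (h0.trans_le h1).ne' (h0.trans_le h2).ne'] at this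
    simp only
    linarith
  have tot : ∑ q, p q = 1 := sum_measureReal_preimage μ hYZ
  have tota : ∑ y, a y = 1 := sum_measureReal_preimage μ hY
  have totb : ∑ y, b y = 1 := sum_measureReal_preimage μ hZ
  have e1 : ∑ q : ι × κ, p q * Real.log (a q.1) = ∑ y, a y * Real.log (a y) := by
    rw [Fintype.sum_prod_type]
    simp only [← Finset.sum_mul, hsum1]
  have e2 : ∑ q : ι × κ, p q * Real.log (b q.2) = ∑ y, b y * Real.log (b y) := by
    rw [Fintype.sum_prod_type_right]
    simp only [← Finset.sum_mul, hsum2]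
  have e3 : ∑ q : ι × κ, a q.1 * b q.2 = 1 := by
    rw [Fintype.sum_prod_type]
    simp only [← Finset.mul_sum, totb, tota, mul_one]
  calc ent μ (fun ω => (Y ω, Z ω)) = ∑ q, Real.negMulLog (p q) := rfl
    _ ≤ ∑ q : ι × κ, (-(p q * Real.log (a q.1)) - p q * Real.log (b q.2)
          + a q.1 * b q.2 - p q) := Finset.sum_le_sum fun q _ => key q
    _ = ent μ Y + ent μ Z := by
        rw [Finset.sum_sub_distrib, Finset.sum_add_distrib, Finset.sum_sub_distrib,
          Finset.sum_neg_distrib, e1, e2, e3, tot]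
        simp only [ent, Real.negMulLog, neg_mul, Finset.sum_neg_distrib, ha, hb]
        ring

lemma ent_le_log_card (μ : Measure Ω) [IsProbabilityMeasure μ] {Y : Ω → ι}
    (hY : Measurable Y) : ent μ Y ≤ Real.log (Fintype.card ι) := by
  have hne : Nonempty ι := by
    have : Nonempty Ω := nonempty_of_isProbabilityMeasure μ
    exact ⟨Y this.some⟩
  have hN : (0 : ℝ) < Fintype.card ι := by exact_mod_cast Fintype.card_pos
  have key : ∀ y ∈ Finset.univ, Real.negMulLog (μ.real (Y ⁻¹' {y})) ≤
      μ.real (Y ⁻¹' {y}) * Real.log (Fintype.card ι) + (Fintype.card ι : ℝ)⁻¹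
        - μ.real (Y ⁻¹' {y}) := by
    intro y _
    have := neg_mul_log_le (p := μ.real (Y ⁻¹' {y})) measureReal_nonneg (inv_pos.2 hN).le
      (fun h => absurd h (inv_pos.2 hN).ne')
    rw [Real.log_inv] at this
    linarith
  refine (Finset.sum_le_sum key).trans (le_of_eq ?_)
  rw [Finset.sum_sub_distrib, Finset.sum_add_distrib, ← Finset.sum_mul,
    sum_measureReal_preimage μ hY]
  simp [hN.ne']

lemma sum_mul_ent_le {α : Type*} (s : Finset α) (w : α → ℝ) (hw : ∀ x ∈ s, 0 ≤ w x)
    (hw1 : ∑ x ∈ s, w x = 1) (ν : α → Measure Ω) (μ : Measure Ω) {Y : Ω → ι}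
    (hμ : ∀ y, μ.real (Y ⁻¹' {y}) = ∑ x ∈ s, w x * (ν x).real (Y ⁻¹' {y})) :
    ∑ x ∈ s, w x * ent (ν x) Y ≤ ent μ Y := by
  unfold ent
  simp only [Finset.mul_sum]
  rw [Finset.sum_comm]
  refine Finset.sum_le_sum fun y _ => ?_
  rw [hμ]
  have := Real.concaveOn_negMulLog.le_map_sum (t := s) (w := w)
    (p := fun x => (ν x).real (Y ⁻¹' {y})) hw hw1 (fun x _ => measureReal_nonneg)
  simpa using this

lemma ent_map {Ω' : Type*} [MeasurableSpace Ω'] (μ : Measure Ω) {g : Ω → Ω'} (hg : Measurable g)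
    {Y : Ω' → ι} (hY : ∀ y, MeasurableSet (Y ⁻¹' {y})) : ent (μ.map g) Y = ent μ (Y ∘ g) := by
  unfold ent
  refine Finset.sum_congr rfl fun y _ => ?_
  rw [map_measureReal_apply hg (hY y), preimage_comp]

section Joint

variable {E : Type*} [DecidableEq E] {Y : E → Ω → κ}

lemma measurable_joint (hY : ∀ e, Measurable (Y e)) (S : Finset E) :
    Measurable fun ω (e : S) => Y e ω :=
  measurable_pi_lambda _ fun e => hY e

lemma jent_mono (μ : Measure Ω) [IsFiniteMeasure μ] (hY : ∀ e, Measurable (Y e))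
    {S S' : Finset E} (h : S ⊆ S') : jent μ Y S ≤ jent μ Y S' := by
  classical
  exact ent_comp_le μ (measurable_joint hY S') (fun c (e : S) => c ⟨e.1, h e.2⟩)

lemma jent_union_le (μ : Measure Ω) [IsProbabilityMeasure μ] (hY : ∀ e, Measurable (Y e))
    (S S' : Finset E) : jent μ Y (S ∪ S') ≤ jent μ Y S + jent μ Y S' := by
  classical
  refine le_trans ?_ (ent_prod_le μ (measurable_joint hY S) (measurable_joint hY S'))
  have := ent_comp_le μ ((measurable_joint hY S).prodMk (measurable_joint hY S'))
    (fun c (e : ↥(S ∪ S')) => if h : e.1 ∈ S then c.1 ⟨e.1, h⟩ else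
      c.2 ⟨e.1, (Finset.mem_union.1 e.2).resolve_left h⟩)
  refine le_of_eq_of_le ?_ this
  unfold jent
  congr 1
  ext ω e
  simp only [Function.comp]
  split_ifs <;> rfl

lemma jent_empty (μ : Measure Ω) [IsProbabilityMeasure μ] : jent μ Y ∅ = 0 := by
  unfold jent ent
  refine Finset.sum_eq_zero fun y _ => ?_
  have : (fun ω (e : (∅ : Finset E)) => Y e ω) ⁻¹' {y} = univ := by
    ext ω
    simp only [mem_preimage, mem_singleton_iff, mem_univ, iff_true]
    ext ⟨e, he⟩
    exact absurd he (Finset.notMem_empty _)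
  rw [this]; simp

lemma jent_biUnion_le {α : Type*} (μ : Measure Ω) [IsProbabilityMeasure μ]
    (hY : ∀ e, Measurable (Y e)) (s : Finset α) (S : α → Finset E) :
    jent μ Y (s.biUnion S) ≤ ∑ x ∈ s, jent μ Y (S x) := by
  classical
  induction s using Finset.induction_on with
  | empty => simp [jent_empty]
  | insert x s hx ih =>
    rw [Finset.biUnion_insert, Finset.sum_insert hx]
    exact (jent_union_le μ hY _ _).trans (by gcongr)

lemma jent_le_card (μ : Measure Ω) [IsProbabilityMeasure μ] (hY : ∀ e, Measurable (Y e))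
    (S : Finset E) : jent μ Y S ≤ S.card * Real.log (Fintype.card κ) := by
  refine (ent_le_log_card μ (measurable_joint hY S)).trans (le_of_eq ?_)
  simp

lemma jent_nonneg (μ : Measure Ω) [IsProbabilityMeasure μ] (S : Finset E) :
    0 ≤ jent μ Y S := Finset.sum_nonneg fun _ _ =>
  Real.negMulLog_nonneg measureReal_nonneg measureReal_le_one

end Joint

end Entropy

section Minimax

lemma exists_mixed_strategy {I J : Type*} [Fintype I] [Fintype J] [Nonempty I] [Nonempty J]
    (M : I → J → ℝ) (v : ℝ)
    (h : ∀ l : I → ℝ, (∀ i, 0 ≤ l i) → ∑ i, l i = 1 → ∃ j, ∑ i, l i * M i j ≤ v) :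
    ∃ p : J → ℝ, (∀ j, 0 ≤ p j) ∧ ∑ j, p j = 1 ∧ ∀ i, ∑ j, p j * M i j ≤ v := by
  classical
  let F : (J → ℝ) → (I → ℝ) → ℝ := fun p l => ∑ i, ∑ j, l i * (p j * M i j)
  have hlin1 : ∀ l, IsLinearMap ℝ fun p => F p l := fun l =>
    { map_add := fun p p' => by
        simp only [F, ← Finset.sum_add_distrib, Pi.add_apply]
        exact Finset.sum_congr rfl fun i _ => Finset.sum_congr rfl fun j _ => by ring
      map_smul := fun c p => by
        simp only [F, Finset.mul_sum, Pi.smul_apply, smul_eq_mul]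
        exact Finset.sum_congr rfl fun i _ => Finset.sum_congr rfl fun j _ => by ring }
  have hlin2 : ∀ p, IsLinearMap ℝ fun l => F p l := fun p =>
    { map_add := fun l l' => by
        simp only [F, ← Finset.sum_add_distrib, Pi.add_apply]
        exact Finset.sum_congr rfl fun i _ => Finset.sum_congr rfl fun j _ => by ring
      map_smul := fun c p => by
        simp only [F, Finset.mul_sum, Pi.smul_apply, smul_eq_mul]
        exact Finset.sum_congr rfl fun i _ => Finset.sum_congr rfl fun j _ => by ring }
  have hc1 : ∀ l, Continuous fun p => F p l := fun l => by
    simp only [F]; fun_prop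
  have hc2 : ∀ p, Continuous fun l => F p l := fun p => by
    simp only [F]; fun_prop
  have ne1 : (stdSimplex ℝ J).Nonempty := ⟨_, single_mem_stdSimplex ℝ (Classical.arbitrary J)⟩
  have ne2 : (stdSimplex ℝ I).Nonempty := ⟨_, single_mem_stdSimplex ℝ (Classical.arbitrary I)⟩
  obtain ⟨p, hp, l, hl, hs⟩ := Sion.exists_isSaddlePointOn' (f := F)
    (ne_X := ne1) (cX := convex_stdSimplex ℝ J) (kX := isCompact_stdSimplex ℝ J)
    (hfy := fun l _ => (hc1 l).continuousOn.lowerSemicontinuousOn)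
    (hfy' := fun l _ => ((hlin1 l).mk' _ |>.convexOn (convex_stdSimplex ℝ J)).quasiconvexOn)
    (cY := convex_stdSimplex ℝ I)
    (hfx := fun p _ => (hc2 p).continuousOn.upperSemicontinuousOn)
    (hfx' := fun p _ => ((hlin2 p).mk' _ |>.concaveOn (convex_stdSimplex ℝ I)).quasiconcaveOn)
    (ne_Y := ne2) (kY := isCompact_stdSimplex ℝ I)
  obtain ⟨j, hj⟩ := h l hl.1 hl.2
  refine ⟨p, hp.1, hp.2, fun i => ?_⟩
  have := hs _ (single_mem_stdSimplex ℝ j) _ (single_mem_stdSimplex ℝ i)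
  have e1 : F p (Pi.single i 1) = ∑ j, p j * M i j := by
    simp only [F]
    rw [Finset.sum_eq_single i]
    · simp
    · intro i' _ hi'; simp [hi']
    · simp
  have e2 : F (Pi.single j 1) l = ∑ i, l i * M i j := by
    simp only [F]
    refine Finset.sum_congr rfl fun i _ => ?_
    rw [Finset.sum_eq_single j]
    · simp
    · intro i' _ hi'; simp [hi']
    · simp
  rw [e1, e2] at this
  exact this.trans hj

end Minimax

lemma exists_separated_subset {α : Type*} (E : Finset α) (R : α → α → Prop)
    (hr : ∀ x, R x x) (hs : ∀ x y, R x y → R y x) :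
    ∃ Y ⊆ E, (∀ x ∈ Y, ∀ y ∈ Y, R x y → x = y) ∧ ∀ e ∈ E, ∃ y ∈ Y, R y e := by
  classical
  induction E using Finset.induction_on with
  | empty => exact ⟨∅, by simp⟩
  | insert e E he ih =>
    obtain ⟨Y, hYE, hsep, hcov⟩ := ih
    by_cases h : ∃ y ∈ Y, R y e
    · refine ⟨Y, hYE.trans (Finset.subset_insert _ _), hsep, fun x hx => ?_⟩
      rcases Finset.mem_insert.1 hx with rfl | hx
      · exact h
      · exact hcov x hx
    · push Not at h
      refine ⟨insert e Y, Finset.insert_subset_insert _ hYE, ?_, ?_⟩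
      · intro x hx y hy hxy
        rcases Finset.mem_insert.1 hx with hx | hx <;> rcases Finset.mem_insert.1 hy with hy | hy
        · exact hx.trans hy.symm
        · exact absurd (hs _ _ (hx ▸ hxy)) (h y hy)
        · exact absurd (hy ▸ hxy) (h x hx)
        · exact hsep x hx y hy hxy
      · intro x hx
        rcases Finset.mem_insert.1 hx with rfl | hx
        · exact ⟨x, Finset.mem_insert_self _ _, hr x⟩
        · obtain ⟨y, hy, hyx⟩ := hcov x hx
          exact ⟨y, Finset.mem_insert_of_mem hy, hyx⟩

section BowenBall

variable {X : Fin k → Type*} [∀ i, MetricSpace (X i)] {X1 : Type*}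
  {T : ∀ i, X i → X i} {τ : ∀ i, X1 → X i} {a : Fin k → ℝ} {n : ℕ} {x y z : X1} {ε δ : ℝ}

lemma cw_nonneg (ha : ∀ i, 0 ≤ a i) (i : Fin k) : 0 ≤ cw a i :=
  Finset.sum_nonneg fun j _ => ha j

lemma mem_wBowen_self (hε : 0 < ε) : x ∈ wBowen T τ a n x ε := fun i j _ => by simpa using hε

lemma mem_wBowen_symm (h : y ∈ wBowen T τ a n x ε) : x ∈ wBowen T τ a n y ε :=
  fun i j hj => by rw [dist_comm]; exact h i j hj

lemma mem_wBowen_trans (h : y ∈ wBowen T τ a n x ε) (h' : z ∈ wBowen T τ a n y δ) :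
    z ∈ wBowen T τ a n x (ε + δ) :=
  fun i j hj => (dist_triangle _ _ _).trans_lt (add_lt_add (h i j hj) (h' i j hj))

lemma wBowen_mono_radius (h : ε ≤ δ) : wBowen T τ a n x ε ⊆ wBowen T τ a n x δ :=
  fun _ hy i j hj => (hy i j hj).trans_le h

lemma wBowen_anti (ha : ∀ i, 0 ≤ a i) {m : ℕ} (h : m ≤ n) :
    wBowen T τ a n x ε ⊆ wBowen T τ a m x ε := by
  intro y hy i j hj
  refine hy i j (hj.trans_le (Nat.ceil_le_ceil ?_))
  have := cw_nonneg ha i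
  gcongr

lemma isOpen_wBowen [TopologicalSpace X1] (hT : ∀ i, Continuous (T i))
    (hτ : ∀ i, Continuous (τ i)) : IsOpen (wBowen T τ a n x ε) := by
  have : wBowen T τ a n x ε = ⋂ i, ⋂ j ∈ Finset.range ⌈cw a i * (n : ℝ)⌉₊,
      {y | dist ((T i)^[j] (τ i x)) ((T i)^[j] (τ i y)) < ε} := by
    ext y; simp [wBowen]
  rw [this]
  refine isOpen_iInter_of_finite fun i => isOpen_biInter_finset fun j _ => ?_
  have := ((hT i).iterate j).comp (hτ i)
  exact isOpen_lt (continuous_const.dist this) continuous_const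

end BowenBall

section Potential

variable {X1 : Type*} {T1 : X1 → X1} {f : X1 → ℝ}

lemma exists_abs_le_of_continuous [TopologicalSpace X1] [CompactSpace X1] (hf : Continuous f) :
    ∃ B, 0 ≤ B ∧ ∀ x, |f x| ≤ B := by
  obtain ⟨C, hC⟩ := isCompact_univ.exists_bound_of_continuousOn hf.continuousOn
  exact ⟨max C 0, le_max_right _ _, fun x => (hC x (mem_univ x)).trans (le_max_left _ _)⟩

lemma abs_birk_le {B : ℝ} (hB : ∀ x, |f x| ≤ B) (n : ℕ) (x : X1) : |birk T1 f n x| ≤ n * B := by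
  refine (Finset.abs_sum_le_sum_abs _ _).trans ((Finset.sum_le_sum fun l _ => hB _).trans ?_)
  simp

lemma bddAbove_birk {B : ℝ} (hB : ∀ x, |f x| ≤ B) (n : ℕ) (A : Set X1) :
    BddAbove (birk T1 f n '' A) :=
  ⟨n * B, by rintro _ ⟨x, _, rfl⟩; exact (le_abs_self _).trans (abs_birk_le hB n x)⟩

lemma birk_le_birk_add {n : ℕ} {x y : X1} {δ : ℝ}
    (h : ∀ j < n, f (T1^[j] x) ≤ f (T1^[j] y) + δ) : birk T1 f n x ≤ birk T1 f n y + n * δ := by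
  unfold birk
  calc _ ≤ ∑ j ∈ Finset.range n, (f (T1^[j] y) + δ) :=
        Finset.sum_le_sum fun j hj => h j (Finset.mem_range.1 hj)
    _ = _ := by simp [Finset.sum_add_distrib]

end Potential

section Cover

variable [NeZero k] {X : Fin k → Type*} [∀ i, MetricSpace (X i)] {X1 : Type*}
  [MeasurableSpace X1] {T1 : X1 → X1} {T : ∀ i, X i → X i} {τ : ∀ i, X1 → X i}
  {a : Fin k → ℝ} {f : X1 → ℝ}

lemma lamBowenN_le_sum {α : Type*} (s ε : ℝ) (N : ℕ) (Z : Set X1) (Q : Finset α)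
    (n : α → ℕ) (A : α → Set X1)
    (h : ∀ q ∈ Q, N ≤ n q ∧ MeasurableSet (A q) ∧ ∃ x, A q ⊆ wBowen T τ a (n q) x ε)
    (hZ : ∀ z ∈ Z, ∃ q ∈ Q, z ∈ A q) :
    lamBowenN T1 T τ a f s ε N Z ≤ ∑ q ∈ Q, pterm T1 f (a 0) s (n q) (A q) := by
  classical
  let D : Finset (ℕ × Set X1) := Q.image fun q => (n q, A q)
  obtain ⟨Q', hQ', hinj, himg⟩ := Finset.exists_subset_injOn_image_eq_of_surjOn
    (f := fun q => (n q, A q)) (Q : Set α) D (by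
      rw [Finset.coe_image]; exact surjOn_image _ _)
  have h1 : (D : Set (ℕ × Set X1)).Countable := D.countable_toSet
  have h2 : ∀ p ∈ (D : Set (ℕ × Set X1)), N ≤ p.1 ∧ MeasurableSet p.2 ∧
      ∃ x, p.2 ⊆ wBowen T τ a p.1 x ε := by
    intro p hp
    obtain ⟨q, hq, rfl⟩ := Finset.mem_image.1 (Finset.mem_coe.1 hp)
    exact h q hq
  have h3 : Z ⊆ ⋃ p ∈ (D : Set (ℕ × Set X1)), p.2 := by
    intro z hz
    obtain ⟨q, hq, hzq⟩ := hZ z hz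
    exact mem_biUnion (Finset.mem_coe.2 (Finset.mem_image_of_mem _ hq)) hzq
  calc lamBowenN T1 T τ a f s ε N Z
      ≤ ∑' p : (D : Set (ℕ × Set X1)), pterm T1 f (a 0) s p.1.1 p.1.2 :=
        iInf_le_of_le _ (iInf_le_of_le h1 (iInf_le_of_le h2 (iInf_le _ h3)))
    _ = ∑ p ∈ D, pterm T1 f (a 0) s p.1 p.2 :=
        Finset.tsum_subtype D fun p => pterm T1 f (a 0) s p.1 p.2
    _ ≤ ∑ q ∈ Q, pterm T1 f (a 0) s (n q) (A q) := by
        rw [show D = Q'.image fun q => (n q, A q) from himg.symm,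
          Finset.sum_image hinj]
        exact Finset.sum_le_sum_of_subset (Finset.coe_subset.1 hQ')

end Cover

section Frostman

/-- The weight `exp (-s n + (1 / a₁) S_{⌈a₁ n⌉} f x)` of an orbit segment. -/
noncomputable def orbW {X1 : Type*} (T1 : X1 → X1) (f : X1 → ℝ) (a1 s : ℝ) (n : ℕ) (x : X1) : ℝ :=
  Real.exp (-(s * n) + (1 / a1) * birk T1 f ⌈a1 * (n : ℝ)⌉₊ x)

lemma pterm_le_orbW {X1 : Type*} {T1 : X1 → X1} {f : X1 → ℝ} {a1 s δ : ℝ} (ha1 : 0 < a1)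
    (hδ : 0 ≤ δ) (n : ℕ) {A : Set X1} {x : X1} (hA : A.Nonempty)
    (h : ∀ y ∈ A, birk T1 f ⌈a1 * (n : ℝ)⌉₊ y
      ≤ birk T1 f ⌈a1 * (n : ℝ)⌉₊ x + ⌈a1 * (n : ℝ)⌉₊ * δ) :
    pterm T1 f a1 s n A
      ≤ ENNReal.ofReal (orbW T1 f a1 (s - 2 * δ) n x * Real.exp (-(δ * n) + δ / a1)) := by
  unfold pterm orbW
  rw [← Real.exp_add]
  refine ENNReal.ofReal_le_ofReal (Real.exp_le_exp.2 ?_)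
  have h1 : sSup (birk T1 f ⌈a1 * (n : ℝ)⌉₊ '' A)
      ≤ birk T1 f ⌈a1 * (n : ℝ)⌉₊ x + (a1 * n + 1) * δ := by
    refine csSup_le (hA.image _) ?_
    rintro _ ⟨y, hy, rfl⟩
    refine (h y hy).trans ?_
    have := (Nat.ceil_lt_add_one (show (0 : ℝ) ≤ a1 * n by positivity)).le
    gcongr
  have h2 := mul_le_mul_of_nonneg_left h1 (one_div_nonneg.2 ha1.le)
  have h3 : (1 / a1) * (birk T1 f ⌈a1 * (n : ℝ)⌉₊ x + (a1 * n + 1) * δ)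
      = (1 / a1) * birk T1 f ⌈a1 * (n : ℝ)⌉₊ x + n * δ + δ / a1 := by
    field_simp; ring
  rw [h3] at h2
  linarith

lemma sum_geometric_weights_le_one {δ : ℝ} (hδ : 0 < δ) (S : Finset ℕ) :
    ∑ n ∈ S, (1 - Real.exp (-δ)) * Real.exp (-(δ * n)) ≤ 1 := by
  have h1 : Real.exp (-δ) < 1 := by simpa using hδ
  have h0 := Real.exp_pos (-δ)
  have hs := hasSum_geometric_of_lt_one h0.le h1
  have e : ∀ n : ℕ, Real.exp (-(δ * n)) = Real.exp (-δ) ^ n := fun n => by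
    rw [← Real.exp_nat_mul]; ring_nf
  simp only [e]
  rw [← Finset.mul_sum]
  calc _ ≤ (1 - Real.exp (-δ)) * (1 - Real.exp (-δ))⁻¹ := by
        refine mul_le_mul_of_nonneg_left ?_ (by linarith)
        rw [← hs.tsum_eq]
        exact hs.summable.sum_le_tsum _ fun n _ => by positivity
    _ = 1 := mul_inv_cancel₀ (by linarith)

variable [NeZero k] {X : Fin k → Type*} [∀ i, MetricSpace (X i)] {X1 : Type*}
  [TopologicalSpace X1] [CompactSpace X1] [MeasurableSpace X1] [BorelSpace X1] [Nonempty X1]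
  {T1 : X1 → X1} {T : ∀ i, X i → X i} {τ : ∀ i, X1 → X i}
  {a : Fin k → ℝ} {f : X1 → ℝ}

open Classical in
lemma exists_frostman (hT : ∀ i, Continuous (T i)) (hτ : ∀ i, Continuous (τ i))
    (ha1 : 0 < a 0) (ha : ∀ i, 0 ≤ a i) {s δ ε : ℝ} (hδ : 0 < δ) (hε : 0 < ε)
    (hosc : ∀ (n : ℕ) x y, y ∈ wBowen T τ a n x (4 * ε) → birk T1 f ⌈a 0 * (n : ℝ)⌉₊ y
      ≤ birk T1 f ⌈a 0 * (n : ℝ)⌉₊ x + ⌈a 0 * (n : ℝ)⌉₊ * δ)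
    {N : ℕ} (hN : lamBowenN T1 T τ a f s (3 * ε) N univ ≠ 0) :
    ∃ C : ℝ, 0 < C ∧ ∀ L, N ≤ L → ∃ (F : Finset X1) (p : X1 → ℝ), (∀ x, 0 ≤ p x) ∧
      ∑ x ∈ F, p x = 1 ∧ ∀ n ∈ Finset.Icc N L, ∀ x ∈ F,
        ∑ y ∈ F with y ∈ wBowen T τ a n x ε, p y ≤ C * orbW T1 f (a 0) (s - 2 * δ) n x := by
  set w := orbW T1 f (a 0) (s - 2 * δ) with hw
  have hwpos : ∀ n x, 0 < w n x := fun n x => Real.exp_pos _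
  have h1 : 0 < 1 - Real.exp (-δ) := by simpa using hδ
  obtain ⟨c, hc0, hc⟩ : ∃ c : ℝ, 0 < c ∧
      ENNReal.ofReal c < lamBowenN T1 T τ a f s (3 * ε) N univ := by
    obtain ⟨c, hc0, hc⟩ := ENNReal.lt_iff_exists_real_btwn.1 (pos_iff_ne_zero.2 hN)
    exact ⟨c, by simpa using hc.1, hc.2⟩
  set t : ℕ → ℝ := fun n => (1 - Real.exp (-δ)) * Real.exp (-(δ * n)) with ht
  have htpos : ∀ n, 0 < t n := fun n => mul_pos h1 (Real.exp_pos _)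
  set C := Real.exp (δ / a 0) / (1 - Real.exp (-δ)) / c with hC
  have hCpos : 0 < C := by positivity
  refine ⟨C, hCpos, fun L hL => ?_⟩
  obtain ⟨F, -, hF⟩ := (isCompact_univ (X := X1)).elim_nhds_subcover
    (fun x => wBowen T τ a L x ε) fun x _ => (isOpen_wBowen hT hτ).mem_nhds (mem_wBowen_self hε)
  have hFcov : ∀ z, ∃ q ∈ F, z ∈ wBowen T τ a L q ε := fun z => by
    simpa using hF (mem_univ z)
  obtain ⟨x0, hx0, -⟩ := hFcov (Classical.arbitrary X1)
  set M : ℕ × X1 → X1 → ℝ := fun q y => if y ∈ wBowen T τ a q.1 q.2 ε then (w q.1 q.2)⁻¹ else 0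
    with hM
  have hMnn : ∀ q y, 0 ≤ M q y := fun q y => by
    simp only [hM]; split_ifs
    · exact (inv_pos.2 (hwpos _ _)).le
    · exact le_rfl
  set IF := Finset.Icc N L ×ˢ F with hIF
  have : Nonempty F := ⟨⟨x0, hx0⟩⟩
  have : Nonempty IF := ⟨⟨(N, x0), by simp [hIF, hx0, hL]⟩⟩
  have hkey : ∀ l : IF → ℝ, (∀ i, 0 ≤ l i) → ∑ i, l i = 1 → ∃ j : F, ∑ i, l i * M i.1 j.1 ≤ C := by
    intro l hl0 hl1
    by_contra! hcon
    set lam : ℕ → X1 → ℝ := fun n x => if h : (n, x) ∈ IF then l ⟨(n, x), h⟩ else 0 with hlam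
    have hlam0 : ∀ n x, 0 ≤ lam n x := fun n x => by
      simp only [hlam]; split_ifs
      exacts [hl0 _, le_rfl]
    have hlam1 : ∑ n ∈ Finset.Icc N L, ∑ x ∈ F, lam n x = 1 := by
      rw [← Finset.sum_product', ← hl1, ← Finset.sum_coe_sort]
      exact Finset.sum_congr rfl fun y _ => by simp [hlam]
    have hcon' : ∀ y ∈ F, C < ∑ n ∈ Finset.Icc N L, ∑ x ∈ F, lam n x * M (n, x) y := by
      intro y hy
      refine (hcon ⟨y, hy⟩).trans_le (le_of_eq ?_)
      rw [← Finset.sum_product', ← Finset.sum_coe_sort (Finset.Icc N L ×ˢ F)]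
      exact Finset.sum_congr rfl fun y _ => by simp [hlam]
    have hsel : ∀ y ∈ F, ∃ n ∈ Finset.Icc N L, C * t n ≤ ∑ x ∈ F, lam n x * M (n, x) y := by
      intro y hy
      by_contra! hlt
      have := Finset.sum_le_sum fun n hn => (hlt n hn).le
      rw [← Finset.mul_sum] at this
      have h2 := mul_le_mul_of_nonneg_left
        (sum_geometric_weights_le_one hδ (Finset.Icc N L)) hCpos.le
      linarith [hcon' y hy]
    choose! nn hnn hnn' using hsel
    have hsep : ∀ n : ℕ, ∃ Y ⊆ F.filter (fun y => nn y = n),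
        (∀ x ∈ Y, ∀ y ∈ Y, (∃ z, x ∈ wBowen T τ a n z ε ∧ y ∈ wBowen T τ a n z ε) → x = y) ∧
        ∀ e ∈ F.filter (fun y => nn y = n),
          ∃ y ∈ Y, ∃ z, y ∈ wBowen T τ a n z ε ∧ e ∈ wBowen T τ a n z ε := fun n =>
      exists_separated_subset _ _ (fun x => ⟨x, mem_wBowen_self hε, mem_wBowen_self hε⟩)
        fun x y ⟨z, hx, hy⟩ => ⟨z, hy, hx⟩
    choose Y hYF hYsep hYcov using hsep
    have hpt : ∀ n ∈ Finset.Icc N L, ∀ y ∈ Y n,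
        pterm T1 f (a 0) s n (wBowen T τ a n y (3 * ε))
          ≤ ENNReal.ofReal (c * ∑ x ∈ F, if y ∈ wBowen T τ a n x ε then lam n x else 0) := by
      intro n hn y hy
      obtain ⟨hyF, hyn⟩ := Finset.mem_filter.1 (hYF n hy)
      have hbase := hnn' y hyF
      rw [hyn] at hbase
      set P := pterm T1 f (a 0) s n (wBowen T τ a n y (3 * ε)) with hP
      have hPtop : P ≠ ⊤ := ENNReal.ofReal_ne_top
      rw [← ENNReal.ofReal_toReal hPtop]
      refine ENNReal.ofReal_le_ofReal ?_
      have hbd : ∀ x, y ∈ wBowen T τ a n x ε →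
          P.toReal ≤ w n x * Real.exp (-(δ * n) + δ / a 0) := by
        intro x hx
        refine ENNReal.toReal_le_of_le_ofReal (mul_pos (hwpos _ _) (Real.exp_pos _)).le ?_
        refine pterm_le_orbW ha1 hδ.le n ⟨y, mem_wBowen_self (by positivity)⟩ fun z hz => ?_
        refine hosc n x z ?_
        have := mem_wBowen_trans hx hz
        rwa [show ε + 3 * ε = 4 * ε by ring] at this
      have hP0 : 0 ≤ P.toReal := ENNReal.toReal_nonneg
      have h2 : P.toReal * (C * t n)
          ≤ Real.exp (-(δ * n) + δ / a 0) *
            ∑ x ∈ F, if y ∈ wBowen T τ a n x ε then lam n x else 0 := by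
        refine (mul_le_mul_of_nonneg_left hbase hP0).trans ?_
        rw [Finset.mul_sum, Finset.mul_sum]
        refine Finset.sum_le_sum fun x _ => ?_
        simp only [hM]
        split_ifs with hx
        · calc P.toReal * (lam n x * (w n x)⁻¹)
              ≤ (w n x * Real.exp (-(δ * n) + δ / a 0)) * (lam n x * (w n x)⁻¹) :=
                mul_le_mul_of_nonneg_right (hbd x hx)
                  (mul_nonneg (hlam0 _ _) (inv_pos.2 (hwpos _ _)).le)
            _ = _ := by have := (hwpos n x).ne'; field_simp
        · simp
      have h3 : C * t n = Real.exp (-(δ * n) + δ / a 0) / c := by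
        simp only [hC, ht, Real.exp_add]
        field_simp
      rw [h3] at h2
      have h4 := Real.exp_pos (-(δ * n) + δ / a 0)
      rw [mul_div_assoc', div_le_iff₀ hc0] at h2
      refine le_of_mul_le_mul_right ?_ h4
      linarith
    have hle := lamBowenN_le_sum (T1 := T1) (T := T) (τ := τ) (a := a) (f := f) s (3 * ε) N univ
      ((Finset.Icc N L).sigma Y) (fun q => q.1) (fun q => wBowen T τ a q.1 q.2 (3 * ε))
      (fun q hq => ⟨(Finset.mem_Icc.1 (Finset.mem_sigma.1 hq).1).1,
        (isOpen_wBowen hT hτ).measurableSet, q.2, subset_rfl⟩) (fun z _ => ?_)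
    · refine absurd (hle.trans ?_) (not_le.2 hc)
      rw [Finset.sum_sigma]
      calc _ ≤ ∑ n ∈ Finset.Icc N L, ∑ y ∈ Y n, ENNReal.ofReal
            (c * ∑ x ∈ F, if y ∈ wBowen T τ a n x ε then lam n x else 0) :=
            Finset.sum_le_sum fun n hn => Finset.sum_le_sum fun y hy => hpt n hn y hy
        _ = ENNReal.ofReal (∑ n ∈ Finset.Icc N L, ∑ y ∈ Y n,
              (c * ∑ x ∈ F, if y ∈ wBowen T τ a n x ε then lam n x else 0)) := by
            have hnn0 : ∀ (n : ℕ) (y : X1),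
                0 ≤ c * ∑ x ∈ F, if y ∈ wBowen T τ a n x ε then lam n x else 0 :=
              fun n y => mul_nonneg hc0.le (Finset.sum_nonneg fun x _ => by
                split_ifs
                exacts [hlam0 _ _, le_rfl])
            rw [ENNReal.ofReal_sum_of_nonneg fun n _ => Finset.sum_nonneg fun y _ => hnn0 n y]
            refine Finset.sum_congr rfl fun n _ => ?_
            rw [ENNReal.ofReal_sum_of_nonneg fun y _ => hnn0 n y]
        _ ≤ ENNReal.ofReal c := by
            refine ENNReal.ofReal_le_ofReal ?_
            conv_rhs => rw [← mul_one c, ← hlam1, Finset.mul_sum]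
            refine Finset.sum_le_sum fun n _ => ?_
            rw [← Finset.mul_sum]
            refine mul_le_mul_of_nonneg_left ?_ hc0.le
            rw [Finset.sum_comm]
            refine Finset.sum_le_sum fun x _ => ?_
            rw [← Finset.sum_filter, Finset.sum_const, nsmul_eq_mul]
            have hcard : ((Y n).filter fun y => y ∈ wBowen T τ a n x ε).card ≤ 1 :=
              Finset.card_le_one.2 fun y hy y' hy' =>
                hYsep n y (Finset.mem_filter.1 hy).1 y' (Finset.mem_filter.1 hy').1
                  ⟨x, (Finset.mem_filter.1 hy).2, (Finset.mem_filter.1 hy').2⟩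
            calc _ ≤ (1 : ℝ) * lam n x :=
                  mul_le_mul_of_nonneg_right (by exact_mod_cast hcard) (hlam0 _ _)
              _ = _ := one_mul _
    · obtain ⟨q, hq, hzq⟩ := hFcov z
      obtain ⟨y, hy, x, hyx, hqx⟩ := hYcov (nn q) q (Finset.mem_filter.2 ⟨hq, rfl⟩)
      have hn := hnn q hq
      refine ⟨⟨nn q, y⟩, Finset.mem_sigma.2 ⟨hn, hy⟩, ?_⟩
      have := mem_wBowen_trans (mem_wBowen_symm hyx)
        (mem_wBowen_trans hqx (wBowen_anti ha (Finset.mem_Icc.1 hn).2 hzq))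
      rwa [show ε + (ε + ε) = 3 * ε by ring] at this
  obtain ⟨p, hp0, hp1, hp⟩ := exists_mixed_strategy (I := IF) (J := F)
    (fun q y => M q.1 y.1) C hkey
  refine ⟨F, fun x => if hx : x ∈ F then p ⟨x, hx⟩ else 0, fun x => ?_, ?_, fun n hn x hx => ?_⟩
  · dsimp only; split_ifs
    exacts [hp0 _, le_rfl]
  · rw [← hp1, ← Finset.sum_coe_sort]
    exact Finset.sum_congr rfl fun y _ => by simp
  · have := hp ⟨(n, x), Finset.mem_product.2 ⟨hn, hx⟩⟩
    rw [Finset.sum_filter, ← Finset.sum_coe_sort]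
    rw [← div_le_iff₀ (hwpos n x), Finset.sum_div]
    refine le_trans (le_of_eq (Finset.sum_congr rfl fun y _ => ?_)) this
    simp only [hM, Finset.coe_mem, dif_pos, Subtype.coe_eta]
    split_ifs <;> simp [div_eq_mul_inv]

end Frostman

section LogAverage

lemma abs_sum_div_succ_sub_le {b : ℕ → ℝ} {B : ℝ} (hb : ∀ m, |b m| ≤ B) {u v : ℕ} (huv : u ≤ v) :
    |∑ m ∈ Finset.range u, b m / ((m : ℝ) + 1) - ∑ m ∈ Finset.range v, b m / ((m : ℝ) + 1)|
      ≤ (v - u : ℝ) / (u + 1) * B := by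
  rw [abs_sub_comm, ← Finset.sum_Ico_eq_sub _ huv]
  have hB : 0 ≤ B := (abs_nonneg _).trans (hb 0)
  calc _ ≤ ∑ m ∈ Finset.Ico u v, B / ((u : ℝ) + 1) := by
        refine (Finset.abs_sum_le_sum_abs _ _).trans (Finset.sum_le_sum fun m hm => ?_)
        rw [abs_div, abs_of_pos (show (0 : ℝ) < m + 1 by positivity)]
        have : (u : ℝ) ≤ m := by exact_mod_cast (Finset.mem_Ico.1 hm).1
        gcongr
        exact hb m
    _ = _ := by
        rw [Finset.sum_const, Nat.card_Ico, nsmul_eq_mul, Nat.cast_sub huv]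
        ring

lemma abs_weighted_sum_sub_le {c : ℝ} (hc : 0 ≤ c) {b : ℕ → ℝ} {B : ℝ} (hb : ∀ m, |b m| ≤ B)
    (L : ℕ) :
    |∑ n ∈ Finset.range L, (∑ m ∈ Finset.range ⌈c * ((n : ℝ) + 1)⌉₊, b m) / ((n + 1) * (n + 2))
      + (∑ m ∈ Finset.range ⌈c * (L : ℝ)⌉₊, b m) / (L + 1)
      - c * ∑ m ∈ Finset.range ⌈c * (L : ℝ)⌉₊, b m / ((m : ℝ) + 1)|
      ≤ B * (1 + c) ^ 2 * ∑ m ∈ Finset.range ⌈c * (L : ℝ)⌉₊, 1 / ((m : ℝ) + 1) ^ 2 := by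
  have hB : 0 ≤ B := (abs_nonneg _).trans (hb 0)
  induction L with
  | zero => simp
  | succ L ih =>
    push_cast
    set u := ⌈c * (L : ℝ)⌉₊ with hu
    set v := ⌈c * ((L : ℝ) + 1)⌉₊ with hv
    have huv : u ≤ v := Nat.ceil_le_ceil (by gcongr; linarith)
    have hsplit : ∀ g : ℕ → ℝ, ∑ m ∈ Finset.range v, g m
        = ∑ m ∈ Finset.range u, g m + ∑ m ∈ Finset.Ico u v, g m := fun g =>
      (Finset.sum_range_add_sum_Ico g huv).symm
    rw [Finset.sum_range_succ, ← hv, hsplit (fun m => b m / ((m : ℝ) + 1)), hsplit (fun m =>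
      1 / ((m : ℝ) + 1) ^ 2)]
    have hblock : |(∑ m ∈ Finset.Ico u v, b m) / ((L : ℝ) + 1)
        - c * ∑ m ∈ Finset.Ico u v, b m / ((m : ℝ) + 1)|
        ≤ B * (1 + c) ^ 2 * ∑ m ∈ Finset.Ico u v, 1 / ((m : ℝ) + 1) ^ 2 := by
      rw [Finset.sum_div, Finset.mul_sum, ← Finset.sum_sub_distrib, Finset.mul_sum]
      refine (Finset.abs_sum_le_sum_abs _ _).trans (Finset.sum_le_sum fun m hm => ?_)
      obtain ⟨h1, h2⟩ := Finset.mem_Ico.1 hm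
      have h1' : c * L ≤ m := Nat.ceil_le.1 h1
      have h2' : (m : ℝ) < c * (L + 1) := Nat.lt_ceil.1 h2
      have hL : (0 : ℝ) < L + 1 := by positivity
      have hm0 : (0 : ℝ) < m + 1 := by positivity
      have e : b m / ((L : ℝ) + 1) - c * (b m / ((m : ℝ) + 1))
          = b m * ((m + 1 - c * (L + 1)) / ((L + 1) * (m + 1))) := by field_simp
      rw [e, abs_mul]
      have h3 : |((m : ℝ) + 1 - c * (L + 1)) / ((L + 1) * (m + 1))| ≤
        (1 + c) ^ 2 * (1 / ((m : ℝ) + 1) ^ 2) := by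
        rw [abs_div, abs_of_pos (show (0 : ℝ) < (L + 1) * (m + 1) by positivity),
          mul_one_div, div_le_div_iff₀ (by positivity) (by positivity)]
        have h4 : |(m : ℝ) + 1 - c * (L + 1)| ≤ 1 + c := by
          rw [abs_le]; constructor <;> nlinarith
        have h5 : (m : ℝ) + 1 ≤ (1 + c) * (L + 1) := by nlinarith [(Nat.cast_nonneg L : (0:ℝ) ≤ L)]
        calc _ ≤ (1 + c) * ((m : ℝ) + 1) ^ 2 := by gcongr
          _ = ((1 + c) * (m + 1)) * (m + 1) := by ring
          _ ≤ ((1 + c) * (m + 1)) * ((1 + c) * (L + 1)) := by gcongr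
          _ = _ := by ring
      calc _ ≤ B * ((1 + c) ^ 2 * (1 / ((m : ℝ) + 1) ^ 2)) :=
            mul_le_mul (hb m) h3 (abs_nonneg _) hB
        _ = _ := by ring
    have hL : ((L : ℝ) + 1) ≠ 0 := by positivity
    have hL2 : ((L : ℝ) + 2) ≠ 0 := by positivity
    have key : (∑ m ∈ Finset.range v, b m) / (((L : ℝ) + 1) * (L + 2))
        + (∑ m ∈ Finset.range v, b m) / ((L : ℝ) + 1 + 1)
        = (∑ m ∈ Finset.range u, b m) / ((L : ℝ) + 1)
          + (∑ m ∈ Finset.Ico u v, b m) / ((L : ℝ) + 1) := by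
      rw [hsplit b, show (L : ℝ) + 1 + 1 = L + 2 by ring]
      field_simp
      ring
    have := abs_add_le _ _ |>.trans (add_le_add ih hblock)
    rw [mul_add (B * (1 + c) ^ 2)]
    refine le_trans (le_of_eq ?_) this
    congr 1
    rw [mul_add c]
    linarith

lemma exists_log_average_bound {c : ℝ} (hc : 0 ≤ c) : ∃ K : ℝ, 0 ≤ K ∧ ∀ (b : ℕ → ℝ) (B : ℝ),
    (∀ m, |b m| ≤ B) → ∀ L : ℕ,
    |∑ n ∈ Finset.range L, (∑ m ∈ Finset.range ⌈c * ((n : ℝ) + 1)⌉₊, b m) / ((n + 1) * (n + 2))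
      - c * ∑ m ∈ Finset.range L, b m / ((m : ℝ) + 1)| ≤ K * B := by
  have hsum : Summable fun m : ℕ => 1 / ((m : ℝ) + 1) ^ 2 := by
    have := (summable_nat_add_iff 1).2 (Real.summable_one_div_nat_pow.2 one_lt_two)
    simpa using this
  set S := ∑' m : ℕ, 1 / ((m : ℝ) + 1) ^ 2 with hS
  have hS0 : 0 ≤ S := tsum_nonneg fun m => by positivity
  refine ⟨(1 + c) ^ 2 * S + (1 + c) + (c * (1 + c) + 1), by positivity, fun b B hb L => ?_⟩
  have hB : 0 ≤ B := (abs_nonneg _).trans (hb 0)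
  have h1 := abs_weighted_sum_sub_le hc hb L
  have h2 : B * (1 + c) ^ 2 * ∑ m ∈ Finset.range ⌈c * (L : ℝ)⌉₊, 1 / ((m : ℝ) + 1) ^ 2
      ≤ B * (1 + c) ^ 2 * S :=
    mul_le_mul_of_nonneg_left (hsum.sum_le_tsum _ fun m _ => by positivity) (by positivity)
  set u := ⌈c * (L : ℝ)⌉₊ with hu
  have hcL : 0 ≤ c * (L : ℝ) := by positivity
  have hu1 : (u : ℝ) ≤ c * L + 1 := (Nat.ceil_lt_add_one hcL).le
  have hu2 : c * L ≤ u := Nat.le_ceil _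
  have h3 : |(∑ m ∈ Finset.range u, b m) / ((L : ℝ) + 1)| ≤ (1 + c) * B := by
    rw [abs_div, abs_of_pos (show (0 : ℝ) < L + 1 by positivity), div_le_iff₀ (by positivity)]
    calc _ ≤ ∑ m ∈ Finset.range u, B :=
          (Finset.abs_sum_le_sum_abs _ _).trans (Finset.sum_le_sum fun m _ => hb m)
      _ = u * B := by simp
      _ ≤ ((1 + c) * (L + 1)) * B := by
          gcongr; nlinarith [(Nat.cast_nonneg L : (0:ℝ) ≤ L)]
      _ = _ := by ring
  have h4 : |c * (∑ m ∈ Finset.range u, b m / ((m : ℝ) + 1) - ∑ m ∈ Finset.range L,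
    b m / ((m : ℝ) + 1))|
      ≤ (c * (1 + c) + 1) * B := by
    rw [abs_mul, abs_of_nonneg hc]
    rcases le_total u L with h | h
    · refine (mul_le_mul_of_nonneg_left (abs_sum_div_succ_sub_le hb h) hc).trans ?_
      rw [← mul_assoc]
      refine mul_le_mul_of_nonneg_right ?_ hB
      rw [mul_div_assoc', div_le_iff₀ (by positivity)]
      have : (u : ℝ) ≤ L := by exact_mod_cast h
      nlinarith [(Nat.cast_nonneg u : (0:ℝ) ≤ u), mul_nonneg hc (Nat.cast_nonneg u : (0:ℝ) ≤ u),
        mul_nonneg (mul_nonneg hc hc) (Nat.cast_nonneg u : (0:ℝ) ≤ u)]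
    · rw [abs_sub_comm]
      refine (mul_le_mul_of_nonneg_left (abs_sum_div_succ_sub_le hb h) hc).trans ?_
      rw [← mul_assoc]
      refine mul_le_mul_of_nonneg_right ?_ hB
      have : ((u : ℝ) - L) / (L + 1) ≤ 1 + c := by
        rw [div_le_iff₀ (by positivity)]
        nlinarith [(Nat.cast_nonneg L : (0:ℝ) ≤ L)]
      nlinarith [mul_le_mul_of_nonneg_left this hc]
  set W := ∑ n ∈ Finset.range L, (∑ m ∈ Finset.range ⌈c * ((n : ℝ) + 1)⌉₊,
    b m) / (((n : ℝ) + 1) * (n + 2))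
  rw [abs_le] at *
  constructor <;> nlinarith

end LogAverage

section BlockEntropy

variable {Ω κ : Type*} [MeasurableSpace Ω] [Fintype κ] [MeasurableSpace κ]
  [DiscreteMeasurableSpace κ]

lemma jent_Ico_le (μ : Measure Ω) [IsProbabilityMeasure μ] {Y : ℕ → Ω → κ}
    (hY : ∀ e, Measurable (Y e)) (u w : ℕ) {q : ℕ} (hq : 0 < q) :
    q * jent μ Y (Finset.Ico u w) ≤ ∑ m ∈ Finset.Ico u w, jent μ Y (Finset.Ico m (m + q))
      + q ^ 2 * Real.log (Fintype.card κ) := by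
  have key : ∀ r ∈ Finset.range q, jent μ Y (Finset.Ico u w)
      ≤ ∑ m ∈ (Finset.Ico u w).filter (fun m => m % q = r), jent μ Y (Finset.Ico m (m + q))
        + q * Real.log (Fintype.card κ) := by
    intro r hr
    have hsub : Finset.Ico u w ⊆ ((Finset.Ico u w).filter (fun m => m % q = r)).biUnion
        (fun m => Finset.Ico m (m + q)) ∪ Finset.Ico u (u + q) := by
      intro x hx
      obtain ⟨h1, h2⟩ := Finset.mem_Ico.1 hx
      rw [Finset.mem_union, Finset.mem_biUnion]
      by_cases hxu : x < u + q
      · exact Or.inr (Finset.mem_Ico.2 ⟨h1, hxu⟩)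
      · left
        have hrq := Finset.mem_range.1 hr
        refine ⟨x - (x + (q - r)) % q, ?_, ?_⟩
        · have h3 := Nat.mod_lt (x + (q - r)) hq
          refine Finset.mem_filter.2 ⟨Finset.mem_Ico.2 ⟨by omega, by omega⟩, ?_⟩
          have h4 := Nat.div_add_mod (x + (q - r)) q
          generalize (x + (q - r)) / q = d at h4
          have hd : 1 ≤ d := by
            by_contra hd
            have : d = 0 := by omega
            rw [this, mul_zero] at h4
            omega
          obtain ⟨e, rfl⟩ : ∃ e, d = e + 1 := ⟨d - 1, by omega⟩
          rw [show x - (x + (q - r)) % q = r + q * e by rw [mul_add] at h4; omega]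
          rw [Nat.add_mul_mod_self_left, Nat.mod_eq_of_lt hrq]
        · have h3 := Nat.mod_lt (x + (q - r)) hq
          exact Finset.mem_Ico.2 ⟨by omega, by omega⟩
    refine (jent_mono μ hY hsub).trans ((jent_union_le μ hY _ _).trans (add_le_add
      (jent_biUnion_le μ hY _ _) ((jent_le_card μ hY _).trans (le_of_eq ?_))))
    simp
  have := Finset.sum_le_sum key
  rw [Finset.sum_add_distrib, Finset.sum_const, Finset.sum_const, Finset.card_range, nsmul_eq_mul,
    nsmul_eq_mul, Finset.sum_fiberwise_of_maps_to (g := fun m => m % q)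
      (fun m _ => Finset.mem_range.2 (Nat.mod_lt m hq))] at this
  linarith

lemma jent_image_le {D E : Type*} [DecidableEq D] [DecidableEq E] (μ : Measure Ω)
    [IsFiniteMeasure μ] {Y : E → Ω → κ} (hY : ∀ e, Measurable (Y e)) (g : D → E) (S : Finset D) :
    jent μ Y (S.image g) ≤ jent μ (fun d => Y (g d)) S := by
  classical
  have hex : ∀ e : ↥(S.image g), ∃ d : S, g d.1 = e.1 := fun e => by
    obtain ⟨d, hd, h⟩ := Finset.mem_image.1 e.2
    exact ⟨⟨d, hd⟩, h⟩
  choose h hh using hex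
  have := ent_comp_le μ (measurable_joint (fun d => hY (g d)) S)
    (fun c (e : ↥(S.image g)) => c (h e))
  refine le_of_eq_of_le ?_ this
  unfold jent
  congr 1
  funext ω e
  simp [hh]

/-- The itinerary of length `q` of a point with respect to a coding `c`. -/
def blockCode (T : Ω → Ω) (c : Ω → κ) (q : ℕ) (x : Ω) (l : Fin q) : κ := c (T^[l] x)

lemma measurable_blockCode {T : Ω → Ω} (hT : Measurable T) {c : Ω → κ} (hc : Measurable c)
    (q : ℕ) : Measurable (blockCode T c q) :=
  measurable_pi_lambda _ fun l => hc.comp (hT.iterate l)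

lemma jent_orbit_Ico_le (μ : Measure Ω) [IsFiniteMeasure μ] {T : Ω → Ω} (hT : Measurable T)
    {c : Ω → κ} (hc : Measurable c) (m q : ℕ) :
    jent μ (fun l => c ∘ T^[l]) (Finset.Ico m (m + q))
      ≤ ent (μ.map T^[m]) (blockCode T c q) := by
  classical
  rw [ent_map μ (hT.iterate m) fun y => measurable_blockCode hT hc q (.of_discrete)]
  have := ent_comp_le μ ((measurable_blockCode hT hc q).comp (hT.iterate m))
    (fun d (e : ↥(Finset.Ico m (m + q))) => d ⟨e.1 - m, by
      have := Finset.mem_Ico.1 e.2; omega⟩)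
  refine le_of_eq_of_le ?_ this
  unfold jent
  congr 1
  funext ω e
  have := Finset.mem_Ico.1 e.2
  simp only [Function.comp, blockCode]
  rw [← Function.iterate_add_apply]
  congr 2
  omega

/-- The times at which level `i` contributes to the weighted itinerary of length `n`. -/
noncomputable def levelTimes (a : Fin k → ℝ) (n : ℕ) (i : Fin k) : Finset ℕ :=
  Finset.Ico ⌈(cw a i - a i) * (n : ℝ)⌉₊ ⌈cw a i * (n : ℝ)⌉₊

/-- The index set of the weighted itinerary of length `n`. -/
noncomputable def levelIdx (a : Fin k → ℝ) (n : ℕ) : Finset (Fin k × ℕ) :=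
  Finset.univ.biUnion fun i => (levelTimes a n i).image fun m => (i, m)

lemma mem_levelIdx {a : Fin k → ℝ} {n : ℕ} {e : Fin k × ℕ} :
    e ∈ levelIdx a n ↔ e.2 ∈ levelTimes a n e.1 := by
  obtain ⟨i, m⟩ := e
  simp [levelIdx]

lemma jent_levelIdx_le (μ : Measure Ω) [IsProbabilityMeasure μ] {T : Ω → Ω} (hT : Measurable T)
    {c : Fin k → Ω → κ} (hc : ∀ i, Measurable (c i)) (a : Fin k → ℝ) (n : ℕ) {q : ℕ} (hq : 0 < q) :
    jent μ (fun e : Fin k × ℕ => c e.1 ∘ T^[e.2]) (levelIdx a n)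
      ≤ ∑ i, (1 / (q : ℝ)) * (∑ m ∈ levelTimes a n i, ent (μ.map T^[m]) (blockCode T (c i) q)
        + q ^ 2 * Real.log (Fintype.card κ)) := by
  have hY : ∀ e : Fin k × ℕ, Measurable (c e.1 ∘ T^[e.2]) :=
    fun e => (hc e.1).comp (hT.iterate e.2)
  refine (jent_biUnion_le μ hY _ _).trans (Finset.sum_le_sum fun i _ => ?_)
  refine (jent_image_le μ hY _ _).trans ?_
  have h1 := jent_Ico_le μ (fun m => hY (i, m)) ⌈(cw a i - a i) * (n : ℝ)⌉₊ ⌈cw a i * (n : ℝ)⌉₊ hq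
  have h2 := Finset.sum_le_sum fun m (_ : m ∈ levelTimes a n i) =>
    jent_orbit_Ico_le μ hT (hc i) m q
  have hq' : (0 : ℝ) < q := by exact_mod_cast hq
  rw [one_div, ← div_eq_inv_mul, le_div_iff₀ hq', mul_comm]
  unfold levelTimes at *
  exact h1.trans (by gcongr)

end BlockEntropy

section Mixture

variable {Ω α : Type*} [MeasurableSpace Ω] {s : Finset α} {w : α → ℝ} {ν : α → Measure Ω}

/-- A finite mixture of measures. -/
noncomputable def mixM (s : Finset α) (w : α → ℝ) (ν : α → Measure Ω) : Measure Ω :=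
  ∑ x ∈ s, ENNReal.ofReal (w x) • ν x

lemma mixM_apply (s : Finset α) (w : α → ℝ) (ν : α → Measure Ω) (A : Set Ω) :
    mixM s w ν A = ∑ x ∈ s, ENNReal.ofReal (w x) * ν x A := by
  simp [mixM, Measure.finsetSum_apply]

lemma isProbabilityMeasure_mixM (hw : ∀ x ∈ s, 0 ≤ w x) (hw1 : ∑ x ∈ s, w x = 1)
    (hν : ∀ x, IsProbabilityMeasure (ν x)) : IsProbabilityMeasure (mixM s w ν) :=
  ⟨by rw [mixM_apply]; simp [← ENNReal.ofReal_sum_of_nonneg hw, hw1]⟩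

lemma mixM_real (hw : ∀ x ∈ s, 0 ≤ w x) (hν : ∀ x, IsProbabilityMeasure (ν x)) (A : Set Ω) :
    (mixM s w ν).real A = ∑ x ∈ s, w x * (ν x).real A := by
  rw [measureReal_def, mixM_apply, ENNReal.toReal_sum]
  · exact Finset.sum_congr rfl fun x hx => by
      rw [ENNReal.toReal_mul, ENNReal.toReal_ofReal (hw x hx), measureReal_def]
  · exact fun x _ => ENNReal.mul_ne_top ENNReal.ofReal_ne_top (measure_ne_top _ _)

lemma integral_mixM (hw : ∀ x ∈ s, 0 ≤ w x) {g : Ω → ℝ} (hg : ∀ x, Integrable g (ν x)) :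
    ∫ ω, g ω ∂(mixM s w ν) = ∑ x ∈ s, w x * ∫ ω, g ω ∂(ν x) := by
  unfold mixM
  rw [integral_finsetSum_measure fun x _ => (hg x).smul_measure ENNReal.ofReal_ne_top]
  exact Finset.sum_congr rfl fun x hx => by
    rw [integral_smul_measure, ENNReal.toReal_ofReal (hw x hx), smul_eq_mul]

end Mixture

section LogAverageMeasure

/-- The harmonic sums, as real numbers. -/
noncomputable def harm (L : ℕ) : ℝ := ∑ m ∈ Finset.range L, 1 / ((m : ℝ) + 1)

lemma harm_pos {L : ℕ} (hL : 0 < L) : 0 < harm L :=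
  Finset.sum_pos (fun m _ => by positivity) ⟨0, Finset.mem_range.2 hL⟩

lemma tendsto_harm : Tendsto harm atTop atTop := by
  have := Real.tendsto_sum_range_one_div_nat_succ_atTop
  exact this

variable {Ω : Type*} [MeasurableSpace Ω] {T : Ω → Ω} {ν : Measure Ω}

/-- The logarithmic average of the measures `ν ∘ T⁻ᵐ`, `m < L`. -/
noncomputable def logAvg (T : Ω → Ω) (ν : Measure Ω) (L : ℕ) : Measure Ω :=
  mixM (Finset.range L) (fun m => 1 / ((m : ℝ) + 1) / harm L) fun m => ν.map T^[m]

lemma logAvg_weight_nonneg {L : ℕ} : ∀ m ∈ Finset.range L, 0 ≤ 1 / ((m : ℝ) + 1) / harm L :=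
  fun m hm => by
    have := harm_pos (Nat.zero_lt_of_lt (Finset.mem_range.1 hm))
    positivity

lemma logAvg_weight_sum {L : ℕ} (hL : 0 < L) :
    ∑ m ∈ Finset.range L, 1 / ((m : ℝ) + 1) / harm L = 1 := by
  rw [← Finset.sum_div]
  exact div_self (harm_pos hL).ne'

variable [IsProbabilityMeasure ν]

lemma isProbabilityMeasure_map_iterate (hT : Measurable T) (m : ℕ) :
    IsProbabilityMeasure (ν.map T^[m]) :=
  Measure.isProbabilityMeasure_map (hT.iterate m).aemeasurable

lemma isProbabilityMeasure_logAvg (hT : Measurable T) {L : ℕ} (hL : 0 < L) :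
    IsProbabilityMeasure (logAvg T ν L) :=
  isProbabilityMeasure_mixM logAvg_weight_nonneg (logAvg_weight_sum hL)
    (isProbabilityMeasure_map_iterate hT)

lemma integrable_of_abs_le {μ : Measure Ω} [IsFiniteMeasure μ] {g : Ω → ℝ} (hg : Measurable g)
    {B : ℝ} (hB : ∀ x, |g x| ≤ B) : Integrable g μ :=
  Integrable.of_bound hg.aestronglyMeasurable B (.of_forall hB)

lemma harm_mul_integral_logAvg (hT : Measurable T) {g : Ω → ℝ} (hg : Measurable g) {B : ℝ}
    (hB : ∀ x, |g x| ≤ B) {L : ℕ} (hL : 0 < L) :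
    harm L * ∫ x, g x ∂(logAvg T ν L)
      = ∑ m ∈ Finset.range L, (∫ x, g (T^[m] x) ∂ν) / ((m : ℝ) + 1) := by
  have := isProbabilityMeasure_map_iterate (ν := ν) hT
  unfold logAvg
  rw [integral_mixM logAvg_weight_nonneg fun m => integrable_of_abs_le hg hB, Finset.mul_sum]
  refine Finset.sum_congr rfl fun m _ => ?_
  rw [integral_map (hT.iterate m).aemeasurable hg.aestronglyMeasurable]
  have := (harm_pos hL).ne'
  field_simp

lemma sum_ent_le_harm_mul (hT : Measurable T) {ι : Type*} [Fintype ι] [MeasurableSpace ι]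
    [DiscreteMeasurableSpace ι] (Y : Ω → ι) {L : ℕ}
    (hL : 0 < L) : ∑ m ∈ Finset.range L, ent (ν.map T^[m]) Y / ((m : ℝ) + 1)
      ≤ harm L * ent (logAvg T ν L) Y := by
  have := sum_mul_ent_le (Finset.range L) (fun m => 1 / ((m : ℝ) + 1) / harm L)
    logAvg_weight_nonneg (logAvg_weight_sum hL) (fun m => ν.map T^[m]) (logAvg T ν L) (Y := Y)
    fun y => mixM_real logAvg_weight_nonneg (isProbabilityMeasure_map_iterate hT) _
  have h := (harm_pos hL).ne'
  refine le_trans (le_of_eq ?_) (mul_le_mul_of_nonneg_left this (harm_pos hL).le)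
  rw [Finset.mul_sum]
  refine Finset.sum_congr rfl fun m _ => ?_
  field_simp

lemma abs_log_average_shift_le {b : ℕ → ℝ} {B : ℝ} (hb : ∀ m, |b m| ≤ B) (L : ℕ) :
    |∑ m ∈ Finset.range L, (b (m + 1) - b m) / ((m : ℝ) + 1)| ≤ 2 * B := by
  have hB : 0 ≤ B := (abs_nonneg _).trans (hb 0)
  have key : |∑ m ∈ Finset.range L, (b (m + 1) - b m) / ((m : ℝ) + 1) - b L / ((L : ℝ) + 1)|
      ≤ B * (2 - 1 / ((L : ℝ) + 1)) := by
    induction L with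
    | zero => simpa [show (2 : ℝ) - 1 = 1 by norm_num] using hb 0
    | succ L ih =>
      rw [Finset.sum_range_succ]
      push_cast
      have e : ∑ m ∈ Finset.range L, (b (m + 1) - b m) / ((m : ℝ) + 1)
          + (b (L + 1) - b L) / ((L : ℝ) + 1) - b (L + 1) / ((L : ℝ) + 1 + 1)
          = (∑ m ∈ Finset.range L, (b (m + 1) - b m) / ((m : ℝ) + 1) - b L / ((L : ℝ) + 1))
            + b (L + 1) * (1 / ((L : ℝ) + 1) - 1 / ((L : ℝ) + 1 + 1)) := by ring
      have h1 : |b (L + 1) * (1 / ((L : ℝ) + 1) - 1 / ((L : ℝ) + 1 + 1))|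
          ≤ B * (1 / ((L : ℝ) + 1) - 1 / ((L : ℝ) + 1 + 1)) := by
        have : 0 ≤ 1 / ((L : ℝ) + 1) - 1 / ((L : ℝ) + 1 + 1) :=
          sub_nonneg.2 (one_div_le_one_div_of_le (by positivity) (by linarith))
        rw [abs_mul, abs_of_nonneg this]
        exact mul_le_mul_of_nonneg_right (hb _) this
      rw [e]
      refine (abs_add_le _ _).trans ((add_le_add ih h1).trans (le_of_eq (by ring)))
  have h2 : |b L / ((L : ℝ) + 1)| ≤ B * (1 / ((L : ℝ) + 1)) := by
    rw [abs_div, abs_of_pos (show (0 : ℝ) < L + 1 by positivity), mul_one_div]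
    gcongr
    exact hb L
  have := (abs_add_le _ _).trans (add_le_add key h2)
  rw [sub_add_cancel] at this
  exact this.trans (le_of_eq (by ring))

end LogAverageMeasure

section AveragedInequality

lemma sum_wt_le_one (L : ℕ) : ∑ n ∈ Finset.range L, 1 / (((n : ℝ) + 1) * (n + 2)) ≤ 1 := by
  have : ∑ n ∈ Finset.range L, 1 / (((n : ℝ) + 1) * (n + 2)) = 1 - 1 / ((L : ℝ) + 1) := by
    induction L with
    | zero => simp
    | succ L ih =>
      rw [Finset.sum_range_succ, ih]
      push_cast
      field_simp
      ring
  rw [this]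
  have : (0 : ℝ) ≤ 1 / ((L : ℝ) + 1) := by positivity
  linarith

lemma abs_sum_wt_sub_harm_le (L : ℕ) :
    |∑ n ∈ Finset.range L, ((n : ℝ) + 1) / (((n : ℝ) + 1) * (n + 2)) - harm L| ≤ 1 := by
  have : ∑ n ∈ Finset.range L, ((n : ℝ) + 1) / (((n : ℝ) + 1) * (n + 2)) - harm L
      = 1 / ((L : ℝ) + 1) - 1 := by
    unfold harm
    induction L with
    | zero => simp
    | succ L ih =>
      rw [Finset.sum_range_succ, Finset.sum_range_succ]
      have e : ((L : ℝ) + 1) / (((L : ℝ) + 1) * (L + 2)) = 1 / ((L : ℝ) + 1 + 1) := by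
        rw [show (L : ℝ) + 1 + 1 = L + 2 by ring]
        field_simp
      rw [e]
      push_cast
      linarith
  rw [this]
  have h1 : (0 : ℝ) < 1 / ((L : ℝ) + 1) := by positivity
  have h2 : 1 / ((L : ℝ) + 1) ≤ 1 := by
    rw [div_le_one (by positivity)]
    linarith [(Nat.cast_nonneg L : (0 : ℝ) ≤ L)]
  rw [abs_le]
  constructor <;> linarith

lemma self_le_cw {a : Fin k → ℝ} (ha : ∀ i, 0 ≤ a i) (i : Fin k) : a i ≤ cw a i :=
  Finset.single_le_sum (f := a) (fun j _ => ha j) (Finset.mem_Iic.2 le_rfl)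

lemma sum_levelTimes {a : Fin k → ℝ} (ha : ∀ i, 0 ≤ a i) (n : ℕ) (i : Fin k) (b : ℕ → ℝ) :
    ∑ m ∈ levelTimes a n i, b m = ∑ m ∈ Finset.range ⌈cw a i * (n : ℝ)⌉₊, b m
      - ∑ m ∈ Finset.range ⌈(cw a i - a i) * (n : ℝ)⌉₊, b m := by
  rw [levelTimes, Finset.sum_Ico_eq_sub]
  refine Nat.ceil_le_ceil ?_
  have := ha i
  gcongr
  linarith

variable {Ω κ : Type*} [MeasurableSpace Ω] [Fintype κ] [MeasurableSpace κ]
  [DiscreteMeasurableSpace κ]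

lemma abs_ent_blockCode_le {T : Ω → Ω} (hT : Measurable T) {c : Ω → κ} (hc : Measurable c)
    (q : ℕ) (μ : Measure Ω) [IsProbabilityMeasure μ] :
    |ent μ (blockCode T c q)| ≤ q * Real.log (Fintype.card κ) := by
  classical
  rw [abs_of_nonneg (ent_nonneg _ _)]
  refine (ent_le_log_card μ (measurable_blockCode hT hc q)).trans (le_of_eq ?_)
  simp

lemma exists_averaged_bound [NeZero k] {T : Ω → Ω} (hT : Measurable T) {a : Fin k → ℝ}
    (ha : ∀ i, 0 ≤ a i)
    (ha1 : 0 < a 0) {c : Fin k → Ω → κ} (hc : ∀ i, Measurable (c i)) {q : ℕ} (hq : 0 < q)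
    {g : Ω → ℝ} (hg : Measurable g) {B : ℝ} (hB : ∀ x, |g x| ≤ B) :
    ∃ K : ℝ, ∀ (ν : Measure Ω) [IsProbabilityMeasure ν] (s C : ℝ) (L : ℕ), 0 < L →
      (∀ n ∈ Finset.range L, s * ((n : ℝ) + 1) - C
        ≤ jent ν (fun e : Fin k × ℕ => c e.1 ∘ T^[e.2]) (levelIdx a (n + 1))
          + (1 / a 0) * ∑ m ∈ Finset.range ⌈a 0 * ((n : ℝ) + 1)⌉₊, ∫ x, g (T^[m] x) ∂ν) →
      s * harm L - |s| - |C| ≤ harm L * (∑ i, a i / q * ent (logAvg T ν L) (blockCode T (c i) q)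
        + ∫ x, g x ∂(logAvg T ν L)) + K := by
  choose K1 hK1 hK1' using fun i => exists_log_average_bound (cw_nonneg ha i)
  choose K2 hK2 hK2' using fun i =>
    exists_log_average_bound (sub_nonneg.2 (self_le_cw ha i))
  obtain ⟨K3, hK3, hK3'⟩ := exists_log_average_bound ha1.le
  set lg := Real.log (Fintype.card κ) with hlg
  have hlg0 : 0 ≤ lg := Real.log_natCast_nonneg _
  have hq' : (0 : ℝ) < q := by exact_mod_cast hq
  refine ⟨∑ i, 1 / (q : ℝ) * ((K1 i + K2 i) * (q * lg) + q ^ 2 * lg) + 1 / a 0 * (K3 * B),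
    fun ν _ s C L hL h => ?_⟩
  have hprob := isProbabilityMeasure_map_iterate (ν := ν) hT
  set b : Fin k → ℕ → ℝ := fun i m => ent (ν.map T^[m]) (blockCode T (c i) q) with hb
  have hbB : ∀ i m, |b i m| ≤ q * lg := fun i m => abs_ent_blockCode_le hT (hc i) q _
  set bf : ℕ → ℝ := fun m => ∫ x, g (T^[m] x) ∂ν with hbf
  have hbfB : ∀ m, |bf m| ≤ B := fun m => by
    have := norm_integral_le_of_norm_le_const (μ := ν) (f := fun x => g (T^[m] x)) (C := B)
      (.of_forall fun x => hB _)
    simpa using this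
  set wt : ℕ → ℝ := fun n => 1 / (((n : ℝ) + 1) * (n + 2)) with hwt
  have hwt0 : ∀ n, 0 ≤ wt n := fun n => by positivity
  have hwt1 : ∑ n ∈ Finset.range L, wt n ≤ 1 := sum_wt_le_one L
  have hn : ∀ n ∈ Finset.range L, wt n * (s * ((n : ℝ) + 1) - C)
      ≤ wt n * (∑ i, 1 / (q : ℝ) * (∑ m ∈ Finset.range ⌈cw a i * ((n : ℝ) + 1)⌉₊, b i m
          - ∑ m ∈ Finset.range ⌈(cw a i - a i) * ((n : ℝ) + 1)⌉₊, b i m + q ^ 2 * lg)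
        + 1 / a 0 * ∑ m ∈ Finset.range ⌈a 0 * ((n : ℝ) + 1)⌉₊, bf m) := by
    intro n hn
    refine mul_le_mul_of_nonneg_left ((h n hn).trans ?_) (hwt0 n)
    have := jent_levelIdx_le ν hT hc a (n + 1) hq
    simp only [sum_levelTimes ha] at this
    push_cast at this
    linarith
  have hsum := Finset.sum_le_sum hn
  have hleft : s * harm L - |s| - |C| ≤ ∑ n ∈ Finset.range L, wt n * (s * ((n : ℝ) + 1) - C) := by
    have e : ∑ n ∈ Finset.range L, wt n * (s * ((n : ℝ) + 1) - C)
        = s * harm L + s * (∑ n ∈ Finset.range L,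
          ((n : ℝ) + 1) / (((n : ℝ) + 1) * (n + 2)) - harm L)
          - C * ∑ n ∈ Finset.range L, wt n := by
      rw [mul_sub s, Finset.mul_sum, Finset.mul_sum]
      rw [add_sub_cancel, ← Finset.sum_sub_distrib]
      refine Finset.sum_congr rfl fun n _ => ?_
      simp only [hwt]; ring
    rw [e]
    have h1 : |s * (∑ n ∈ Finset.range L, ((n : ℝ) + 1) / (((n : ℝ) + 1) * (n + 2)) - harm L)|
        ≤ |s| := by
      rw [abs_mul]
      exact mul_le_of_le_one_right (abs_nonneg _) (abs_sum_wt_sub_harm_le L)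
    have h2 : |C * ∑ n ∈ Finset.range L, wt n| ≤ |C| := by
      rw [abs_mul, abs_of_nonneg (Finset.sum_nonneg fun n _ => hwt0 n)]
      exact mul_le_of_le_one_right (abs_nonneg _) hwt1
    linarith [neg_abs_le (s * (∑ n ∈ Finset.range L,
      ((n : ℝ) + 1) / (((n : ℝ) + 1) * (n + 2)) - harm L)),
        le_abs_self (C * ∑ n ∈ Finset.range L, wt n)]
  have hright : ∑ n ∈ Finset.range L, wt n * (∑ i, 1 / (q : ℝ) *
        (∑ m ∈ Finset.range ⌈cw a i * ((n : ℝ) + 1)⌉₊, b i m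
          - ∑ m ∈ Finset.range ⌈(cw a i - a i) * ((n : ℝ) + 1)⌉₊, b i m + q ^ 2 * lg)
        + 1 / a 0 * ∑ m ∈ Finset.range ⌈a 0 * ((n : ℝ) + 1)⌉₊, bf m)
      = ∑ i, 1 / (q : ℝ) *
        (∑ n ∈ Finset.range L, (∑ m ∈ Finset.range ⌈cw a i * ((n : ℝ) + 1)⌉₊, b i m)
            / (((n : ℝ) + 1) * (n + 2))
          - ∑ n ∈ Finset.range L, (∑ m ∈ Finset.range ⌈(cw a i - a i) * ((n : ℝ) + 1)⌉₊, b i m)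
            / (((n : ℝ) + 1) * (n + 2))
          + q ^ 2 * lg * ∑ n ∈ Finset.range L, wt n)
        + 1 / a 0 * ∑ n ∈ Finset.range L, (∑ m ∈ Finset.range ⌈a 0 * ((n : ℝ) + 1)⌉₊, bf m)
            / (((n : ℝ) + 1) * (n + 2)) := by
    have hswap : ∀ (S1 S2 : Fin k → ℕ → ℝ) (e : ℝ),
        ∑ n ∈ Finset.range L, wt n * ∑ i, 1 / (q : ℝ) * (S1 i n - S2 i n + e)
          = ∑ i, 1 / (q : ℝ) * (∑ n ∈ Finset.range L, S1 i n / (((n : ℝ) + 1) * (n + 2))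
            - ∑ n ∈ Finset.range L, S2 i n / (((n : ℝ) + 1) * (n + 2))
            + e * ∑ n ∈ Finset.range L, wt n) := by
      intro S1 S2 e
      simp only [Finset.mul_sum (Finset.univ)]
      rw [Finset.sum_comm]
      refine Finset.sum_congr rfl fun i _ => ?_
      rw [← Finset.sum_sub_distrib, Finset.mul_sum _ _ e, ← Finset.sum_add_distrib, Finset.mul_sum]
      refine Finset.sum_congr rfl fun n _ => ?_
      simp only [hwt]; ring
    rw [← hswap, Finset.mul_sum, ← Finset.sum_add_distrib]
    refine Finset.sum_congr rfl fun n _ => ?_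
    simp only [hwt]; ring
  rw [hright] at hsum
  refine hleft.trans (hsum.trans ?_)
  have hi : ∀ i ∈ Finset.univ, 1 / (q : ℝ) *
        (∑ n ∈ Finset.range L, (∑ m ∈ Finset.range ⌈cw a i * ((n : ℝ) + 1)⌉₊, b i m)
            / (((n : ℝ) + 1) * (n + 2))
          - ∑ n ∈ Finset.range L, (∑ m ∈ Finset.range ⌈(cw a i - a i) * ((n : ℝ) + 1)⌉₊, b i m)
            / (((n : ℝ) + 1) * (n + 2))
          + q ^ 2 * lg * ∑ n ∈ Finset.range L, wt n)
      ≤ harm L * (a i / q * ent (logAvg T ν L) (blockCode T (c i) q))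
        + 1 / (q : ℝ) * ((K1 i + K2 i) * (q * lg) + q ^ 2 * lg) := by
    intro i _
    have h1 := (abs_le.1 (hK1' i (b i) _ (hbB i) L)).2
    have h2 := (abs_le.1 (hK2' i (b i) _ (hbB i) L)).1
    have h3 := mul_le_mul_of_nonneg_left
      (sum_ent_le_harm_mul (ν := ν) hT (blockCode T (c i) q) hL) (ha i)
    have h4 : q ^ 2 * lg * ∑ n ∈ Finset.range L, wt n ≤ q ^ 2 * lg :=
      mul_le_of_le_one_right (by positivity) hwt1
    have h5 : harm L * (a i / q * ent (logAvg T ν L) (blockCode T (c i) q))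
        = 1 / (q : ℝ) * (a i * (harm L * ent (logAvg T ν L) (blockCode T (c i) q))) := by ring
    rw [h5, ← mul_add]
    refine mul_le_mul_of_nonneg_left ?_ (by positivity)
    linarith
  have hi' := Finset.sum_le_sum hi
  have h6 := (abs_le.1 (hK3' bf _ hbfB L)).2
  have h7 := harm_mul_integral_logAvg (ν := ν) hT hg hB hL
  have h8 : 1 / a 0 * ∑ n ∈ Finset.range L, (∑ m ∈ Finset.range ⌈a 0 * ((n : ℝ) + 1)⌉₊, bf m)
      / (((n : ℝ) + 1) * (n + 2)) ≤ harm L * ∫ x, g x ∂(logAvg T ν L) + 1 / a 0 * (K3 * B) := by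
    rw [h7]
    calc _ ≤ 1 / a 0 * (a 0 * ∑ m ∈ Finset.range L, bf m / ((m : ℝ) + 1) + K3 * B) := by
          refine mul_le_mul_of_nonneg_left (by linarith) (by positivity)
      _ = _ := by rw [mul_add, ← mul_assoc, one_div_mul_cancel ha1.ne', one_mul]
  have h9 : ∑ i, harm L * (a i / q * ent (logAvg T ν L) (blockCode T (c i) q))
      = harm L * ∑ i, a i / q * ent (logAvg T ν L) (blockCode T (c i) q) :=
    (Finset.mul_sum _ _ _).symm
  rw [Finset.sum_add_distrib, h9] at hi'
  rw [mul_add (harm L), add_add_add_comm]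
  exact add_le_add hi' h8

end AveragedInequality

section AtomicEntropy

lemma sum_mul_neg_log_le_ent_mixM {Ω ι : Type*} [MeasurableSpace Ω] [Fintype ι] [DecidableEq ι]
    [MeasurableSpace ι] [DiscreteMeasurableSpace ι] {Z : Ω → ι} (hZ : Measurable Z) {F : Finset Ω}
    {p W : Ω → ℝ} (hp : ∀ x, 0 ≤ p x)
    (hW : ∀ x ∈ F, ∑ y ∈ F with Z y = Z x, p y ≤ W x) :
    ∑ x ∈ F, p x * -Real.log (W x) ≤ ent (mixM F p Measure.dirac) Z := by
  have hreal : ∀ z, (mixM F p Measure.dirac).real (Z ⁻¹' {z}) = ∑ y ∈ F with Z y = z, p y := by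
    intro z
    rw [mixM_real (fun x _ => hp x) fun x => inferInstance, Finset.sum_filter]
    refine Finset.sum_congr rfl fun y _ => ?_
    rw [measureReal_def, Measure.dirac_apply' _ (hZ (.of_discrete))]
    by_cases h : Z y = z <;> simp [h]
  unfold ent
  rw [← Finset.sum_fiberwise (s := F) (g := Z)]
  refine Finset.sum_le_sum fun z _ => ?_
  rw [hreal, Real.negMulLog, neg_mul, ← mul_neg, Finset.sum_mul]
  refine Finset.sum_le_sum fun x hx => ?_
  obtain ⟨hxF, rfl⟩ := Finset.mem_filter.1 hx
  rcases (hp x).eq_or_lt with h0 | h0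
  · rw [← h0]; simp
  · refine mul_le_mul_of_nonneg_left (neg_le_neg (Real.log_le_log ?_ (hW x hxF))) h0.le
    exact h0.trans_le (Finset.single_le_sum (f := p) (fun y _ => hp y) hx)

end AtomicEntropy

section Itineraries

variable {X : Fin k → Type*} [∀ i, MetricSpace (X i)] {Ω κ : Type*} {T1 : Ω → Ω}
  {T : ∀ i, X i → X i} {τ : ∀ i, Ω → X i} {a : Fin k → ℝ}

lemma semiconj_iterate (hτe : ∀ i x, τ i (T1 x) = T i (τ i x)) (i : Fin k) (m : ℕ) (x : Ω) :
    τ i (T1^[m] x) = (T i)^[m] (τ i x) :=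
  (Function.Semiconj.iterate_right (f := τ i) (hτe i) m).eq x

lemma exists_level (n : ℕ) (i : Fin k) {m : ℕ} (hm : m < ⌈cw a i * (n : ℝ)⌉₊) :
    ∃ j ≤ i, m ∈ levelTimes a n j := by
  obtain ⟨j, hj, hmin⟩ := exists_minimal_of_wellFoundedLT
    (fun j : Fin k => m < ⌈cw a j * (n : ℝ)⌉₊) ⟨i, hm⟩
  have hji : j ≤ i := by
    by_contra h
    exact h (hmin hm (not_le.1 h).le)
  refine ⟨j, hji, Finset.mem_Ico.2 ⟨?_, hj⟩⟩
  rcases Nat.eq_zero_or_pos j.1 with h0 | h0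
  · have : cw a j - a j = 0 := by
      have : Finset.Iic j = {j} := by
        ext l; simp only [Finset.mem_Iic, Finset.mem_singleton, Fin.le_def, Fin.ext_iff]; omega
      simp [cw, this]
    simp [this]
  · set j' : Fin k := ⟨j.1 - 1, by omega⟩ with hj'
    have : cw a j - a j = cw a j' := by
      have : Finset.Iic j = insert j (Finset.Iic j') := by
        ext l; simp only [Finset.mem_Iic, Finset.mem_insert, Fin.le_def, Fin.ext_iff, hj']; omega
      rw [cw, this, Finset.sum_insert (by simp [Fin.le_def, hj']; omega)]
      simp [cw]
    rw [this]
    by_contra h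
    have := hmin (not_le.1 h) (by simp [Fin.le_def, hj'])
    simp [Fin.le_def, hj'] at this
    omega

lemma mem_wBowen_of_same_code (hτe : ∀ i x, τ i (T1 x) = T i (τ i x)) {c : Fin k → Ω → κ} {ε : ℝ}
    (hc : ∀ j i, j ≤ i → ∀ x y, c j x = c j y → dist (τ i x) (τ i y) < ε) {n : ℕ} {x y : Ω}
    (h : ∀ e ∈ levelIdx a n, c e.1 (T1^[e.2] x) = c e.1 (T1^[e.2] y)) :
    y ∈ wBowen T τ a n x ε := by
  intro i m hm
  obtain ⟨j, hji, hmj⟩ := exists_level n i hm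
  rw [← semiconj_iterate hτe, ← semiconj_iterate hτe]
  exact hc j i hji _ _ (h (j, m) (mem_levelIdx.2 hmj))

open Classical in
lemma le_jent_of_frostman [NeZero k] [MeasurableSpace Ω] [Fintype κ] [MeasurableSpace κ]
    [DiscreteMeasurableSpace κ] (hT1 : Measurable T1)
    (hτe : ∀ i x, τ i (T1 x) = T i (τ i x)) {c : Fin k → Ω → κ} (hcm : ∀ i, Measurable (c i))
    {ε : ℝ} (hc : ∀ j i, j ≤ i → ∀ x y, c j x = c j y → dist (τ i x) (τ i y) < ε) {n : ℕ}
    {F : Finset Ω} {p : Ω → ℝ} (hp : ∀ x, 0 ≤ p x) (hp1 : ∑ x ∈ F, p x = 1) {f : Ω → ℝ}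
    (hf : Measurable f) {C s : ℝ} (hC : 0 < C)
    (hF : ∀ x ∈ F, ∑ y ∈ F with y ∈ wBowen T τ a n x ε, p y ≤ C * orbW T1 f (a 0) s n x) :
    s * n - Real.log C ≤ jent (mixM F p Measure.dirac) (fun e : Fin k × ℕ => c e.1 ∘ T1^[e.2])
        (levelIdx a n)
      + (1 / a 0) * ∑ m ∈ Finset.range ⌈a 0 * (n : ℝ)⌉₊,
        ∫ x, f (T1^[m] x) ∂(mixM F p Measure.dirac) := by
  have hZ := measurable_joint (fun e : Fin k × ℕ => (hcm e.1).comp (hT1.iterate e.2)) (levelIdx a n)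
  have h1 := sum_mul_neg_log_le_ent_mixM hZ (F := F) (W := fun x => C * orbW T1 f (a 0) s n x) hp
    fun x hx => by
      refine le_trans ?_ (hF x hx)
      refine Finset.sum_le_sum_of_subset_of_nonneg (fun y hy => ?_) fun y _ _ => hp y
      obtain ⟨hyF, hy⟩ := Finset.mem_filter.1 hy
      refine Finset.mem_filter.2 ⟨hyF, mem_wBowen_of_same_code hτe hc fun e he => ?_⟩
      exact (congrFun hy ⟨e, he⟩).symm
  have h2 : ∀ m, ∫ x, f (T1^[m] x) ∂(mixM F p Measure.dirac) = ∑ x ∈ F, p x * f (T1^[m] x) := by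
    intro m
    have hm : Measurable fun x => f (T1^[m] x) := hf.comp (hT1.iterate m)
    rw [integral_mixM (fun x _ => hp x) fun x => integrable_dirac' hm.stronglyMeasurable (by simp)]
    simp [integral_dirac' _ _ hm.stronglyMeasurable]
  have h3 : ∑ x ∈ F, p x * -Real.log (C * orbW T1 f (a 0) s n x)
      = s * n - Real.log C - (1 / a 0) * ∑ m ∈ Finset.range ⌈a 0 * (n : ℝ)⌉₊,
        ∫ x, f (T1^[m] x) ∂(mixM F p Measure.dirac) := by
    have h4 : ∀ x, p x * -Real.log (C * orbW T1 f (a 0) s n x)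
        = p x * (s * n - Real.log C) - (1 / a 0) * (p x * birk T1 f ⌈a 0 * (n : ℝ)⌉₊ x) := by
      intro x
      rw [orbW, Real.log_mul hC.ne' (Real.exp_pos _).ne', Real.log_exp]
      ring
    simp only [h4, h2]
    rw [Finset.sum_sub_distrib, ← Finset.sum_mul, hp1, one_mul, ← Finset.mul_sum, Finset.sum_comm]
    simp only [birk, Finset.mul_sum]
  rw [h3] at h1
  unfold jent
  simp only [Function.comp_def] at h1 ⊢
  linarith

end Itineraries

section EntropyRate

variable {Ω κ : Type*} [MeasurableSpace Ω] [Fintype κ] [MeasurableSpace κ]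
  [DiscreteMeasurableSpace κ] {μ : Measure Ω} [IsProbabilityMeasure μ] {T : Ω → Ω} {c : Ω → κ}

lemma map_iterate_eq (hT : Measurable T) (hμ : μ.map T = μ) (m : ℕ) : μ.map T^[m] = μ := by
  induction m with
  | zero => simp
  | succ m ih => rw [Function.iterate_succ, ← Measure.map_map (hT.iterate m) hT, hμ, ih]

lemma subadditive_ent_blockCode (hT : Measurable T) (hμ : μ.map T = μ) (hc : Measurable c) :
    Subadditive fun q => ent μ (blockCode T c q) := by
  classical
  intro m n
  have h1 : ent μ (blockCode T c n ∘ T^[m]) = ent μ (blockCode T c n) := by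
    rw [← ent_map μ (hT.iterate m) fun y => measurable_blockCode hT hc n (.of_discrete),
      map_iterate_eq hT hμ]
  beta_reduce
  rw [← h1]
  have hm := measurable_blockCode hT hc m
  have hn := (measurable_blockCode hT hc n).comp (hT.iterate m)
  refine le_trans ?_ (ent_prod_le μ hm hn)
  have := ent_comp_le μ (hm.prodMk hn) (fun d => Fin.append d.1 d.2)
  refine le_of_eq_of_le ?_ this
  congr 1
  funext x l
  refine Fin.addCases (fun l => ?_) (fun l => ?_) l
  · simp [blockCode]
  · simp [blockCode, ← Function.iterate_add_apply, add_comm]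

/-- The entropy rate of the process `c ∘ T^[m]`. -/
noncomputable def entRate (μ : Measure Ω) (T : Ω → Ω) (c : Ω → κ) : ℝ :=
  limUnder atTop fun q : ℕ => ent μ (blockCode T c q) / q

lemma tendsto_entRate (hT : Measurable T) (hμ : μ.map T = μ) (hc : Measurable c) :
    Tendsto (fun q : ℕ => ent μ (blockCode T c q) / q) atTop (𝓝 (entRate μ T c)) :=
  tendsto_nhds_limUnder ⟨_, (subadditive_ent_blockCode hT hμ hc).tendsto_lim
    ⟨0, by rintro _ ⟨q, rfl⟩; exact div_nonneg (ent_nonneg _ _) (by positivity)⟩⟩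

lemma entRate_nonneg (hT : Measurable T) (hμ : μ.map T = μ) (hc : Measurable c) :
    0 ≤ entRate μ T c :=
  ge_of_tendsto' (tendsto_entRate hT hμ hc) fun q => div_nonneg (ent_nonneg _ _) (by positivity)

lemma hPart_eq_entRate (hT : Measurable T) (hμ : μ.map T = μ) (hc : Measurable c) :
    hPart μ T (fun j => c ⁻¹' {j}) = entRate μ T c := by
  have h : ∀ n, entH μ (dynJoin T (fun j => c ⁻¹' {j}) n) = ent μ (blockCode T c n) := by
    intro n
    unfold entH ent
    refine Finset.sum_congr rfl fun d _ => ?_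
    congr 2
    congr 1
    ext x
    simp [dynJoin, blockCode, funext_iff]
  unfold hPart
  simp only [h]
  exact ((continuous_coe_real_ereal.tendsto _).comp (tendsto_entRate hT hμ hc)).liminf_eq

lemma entRate_le_hKS (hT : Measurable T) (hμ : μ.map T = μ) (hc : Measurable c) :
    (entRate μ T c : EReal) ≤ hKS μ T := by
  classical
  let e := Fintype.equivFin κ
  have he : Measurable (e ∘ c) := (measurable_of_countable e).comp hc
  have hpart : IsPart fun j => (e ∘ c) ⁻¹' {j} := by
    refine ⟨fun j => he (.of_discrete), fun i j hij => Disjoint.preimage _ (by simpa using hij), ?_⟩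
    ext x; simp
  have h1 : ∀ n, ent μ (blockCode T (e ∘ c) n) = ent μ (blockCode T c n) := by
    intro n
    refine le_antisymm (ent_comp_le μ (measurable_blockCode hT hc n) (fun d l => e (d l))) ?_
    have := ent_comp_le μ (measurable_blockCode hT he n) (fun d l => e.symm (d l))
    refine le_of_eq_of_le ?_ this
    congr 1
    funext x l
    simp [blockCode]
  have h2 : entRate μ T c = entRate μ T (e ∘ c) := by simp only [entRate, h1]
  rw [h2, ← hPart_eq_entRate hT hμ he]
  exact le_iSup (fun p : (Σ m : ℕ, {β : Fin m → Set Ω // IsPart β}) => hPart μ T p.2.1)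
    ⟨_, _, hpart⟩

/-- The entropy rate of a code does not change under passing to a factor. -/
lemma entRate_map {Ω' : Type*} [MeasurableSpace Ω'] {T' : Ω' → Ω'} {g : Ω → Ω'}
    (hg : Measurable g) (hT' : Measurable T') (hgT : ∀ x, g (T x) = T' (g x)) {c' : Ω' → κ}
    (hc' : Measurable c') : entRate (μ.map g) T' c' = entRate μ T (c' ∘ g) := by
  have h : ∀ n, ent (μ.map g) (blockCode T' c' n) = ent μ (blockCode T (c' ∘ g) n) := by
    intro n
    rw [ent_map μ hg fun y => measurable_blockCode hT' hc' n (.of_discrete)]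
    congr 1
    funext x l
    simp only [blockCode, Function.comp]
    rw [(Function.Semiconj.iterate_right (f := g) hgT l).eq x]
  simp only [entRate, h]

end EntropyRate

section NullFrontier

variable {Ω : Type*} [TopologicalSpace Ω] [MeasurableSpace Ω] {μ : Measure Ω}

lemma null_frontier_iInter {ι : Type*} [Finite ι] {A : ι → Set Ω}
    (h : ∀ i, μ (frontier (A i)) = 0) :
    μ (frontier (⋂ i, A i)) = 0 := by
  refine measure_mono_null ?_ (measure_iUnion_null h)
  intro x hx
  by_contra hx'
  simp only [mem_iUnion, not_exists] at hx'
  have hx1 : x ∈ closure (⋂ i, A i) := hx.1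
  have : x ∈ interior (⋂ i, A i) := by
    rw [interior_iInter_of_finite, mem_iInter]
    intro i
    by_contra hi
    exact hx' i ⟨closure_mono (iInter_subset _ i) hx1, hi⟩
  exact hx.2 this

lemma null_frontier_preimage [BorelSpace Ω] {Ω' : Type*} [TopologicalSpace Ω'] [MeasurableSpace Ω']
    [BorelSpace Ω'] {g : Ω → Ω'}
    (hg : Continuous g) {A : Set Ω'}
    (h : μ.map g (frontier A) = 0) : μ (frontier (g ⁻¹' A)) = 0 := by
  rw [Measure.map_apply hg.measurable isClosed_frontier.measurableSet] at h
  exact measure_mono_null (hg.frontier_preimage_subset A) h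

lemma tendsto_ent_of_null_frontier {Ω ι : Type*} [TopologicalSpace Ω] [MeasurableSpace Ω]
    [OpensMeasurableSpace Ω] [HasOuterApproxClosed Ω] [Fintype ι] {α : Type*} {l : Filter α}
    {μ : ProbabilityMeasure Ω} {μs : α → ProbabilityMeasure Ω} (h : Tendsto μs l (𝓝 μ))
    {Y : Ω → ι} (hY : ∀ y, (μ : Measure Ω) (frontier (Y ⁻¹' {y})) = 0) :
    Tendsto (fun i => ent (μs i : Measure Ω) Y) l (𝓝 (ent (μ : Measure Ω) Y)) := by
  unfold ent
  refine tendsto_finsetSum _ fun y _ => (Real.continuous_negMulLog.tendsto _).comp ?_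
  exact (ENNReal.tendsto_toReal (measure_ne_top _ _)).comp
    (ProbabilityMeasure.tendsto_measure_of_null_frontier_of_tendsto' h (hY y))

end NullFrontier

section NullCodes

lemma exists_null_frontier_code {X : Fin k → Type*} [∀ i, MetricSpace (X i)]
    [∀ i, CompactSpace (X i)] [∀ i, MeasurableSpace (X i)] [∀ i, BorelSpace (X i)] {Ω : Type*}
    [TopologicalSpace Ω] [MeasurableSpace Ω] [BorelSpace Ω] {τ : ∀ i, Ω → X i}
    (hτc : ∀ i, Continuous (τ i))
    (hchain : ∀ i j, i ≤ j → ∃ p : X i → X j, Continuous p ∧ p ∘ τ i = τ j)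
    (μ : Measure Ω) [IsProbabilityMeasure μ] {ε : ℝ} (hε : 0 < ε) :
    ∃ (m : ℕ) (c : ∀ i, X i → (Fin m → Bool)), (∀ i, Measurable (c i)) ∧
      (∀ i z, μ.map (τ i) (frontier (c i ⁻¹' {z})) = 0) ∧
      ∀ j i, j ≤ i → ∀ x y, c j (τ j x) = c j (τ j y) → dist (τ i x) (τ i y) < ε := by
  classical
  have hprob : ∀ i, IsProbabilityMeasure (μ.map (τ i)) := fun i =>
    Measure.isProbabilityMeasure_map (hτc i).aemeasurable
  choose p hpc hpτ using hchain
  have hfin : ∀ i, ∃ t : Finset (X i), univ ⊆ ⋃ y ∈ t, Metric.ball y (ε / 4) := by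
    intro i
    obtain ⟨t, ht, h⟩ := finite_cover_balls_of_compact (isCompact_univ (X := X i))
      (e := ε / 4) (by positivity)
    exact ⟨h.1.toFinset, by simpa using h.2⟩
  choose t ht using hfin
  have hr : ∀ i (y : X i), ∃ r ∈ Ioo (ε / 4) (ε / 2),
    μ.map (τ i) (frontier (Metric.ball y r)) = 0 := by
    intro i y
    obtain ⟨r, hr, h⟩ := exists_null_frontier_thickening (μ.map (τ i)) {y}
      (show ε / 4 < ε / 2 by linarith)
    exact ⟨r, hr, by rwa [Metric.thickening_singleton] at h⟩
  choose r hr hr0 using hr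
  let e := Fintype.equivFin (Σ i, t i)
  let B : ∀ (i : Fin k), (Σ i, t i) → Set (X i) := fun i q =>
    if h : i ≤ q.1 then p i q.1 h ⁻¹' Metric.ball q.2.1 (r q.1 q.2.1) else ∅
  have hBo : ∀ i q, IsOpen (B i q) := by
    intro i q
    simp only [B]
    split_ifs with h
    · exact Metric.isOpen_ball.preimage (hpc i q.1 h)
    · exact isOpen_empty
  have hB0 : ∀ i q, μ.map (τ i) (frontier (B i q)) = 0 := by
    intro i q
    simp only [B]
    split_ifs with h
    · refine null_frontier_preimage (hpc i q.1 h) ?_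
      rw [Measure.map_map (hpc i q.1 h).measurable (hτc i).measurable, hpτ]
      exact hr0 _ _
    · simp
  refine ⟨Fintype.card (Σ i, t i), fun i x l => decide (x ∈ B i (e.symm l)), ?_, ?_, ?_⟩
  · intro i
    refine measurable_pi_lambda _ fun l => ?_
    exact measurable_to_bool (by simpa [preimage] using (hBo i (e.symm l)).measurableSet)
  · intro i z
    have : (fun x l => decide (x ∈ B i (e.symm l))) ⁻¹' {z}
        = ⋂ l, {x | decide (x ∈ B i (e.symm l)) = z l} := by
      ext x; simp [funext_iff]
    rw [this]
    refine null_frontier_iInter fun l => ?_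
    cases z l
    · have : {x | decide (x ∈ B i (e.symm l)) = false} = (B i (e.symm l))ᶜ := by ext; simp
      rw [this, frontier_compl]; exact hB0 _ _
    · simpa using hB0 i (e.symm l)
  · intro j i hji x y h
    obtain ⟨z, hz, hzx⟩ := mem_iUnion₂.1 (ht i (mem_univ (τ i x)))
    have h1 := congrFun h (e ⟨i, z, hz⟩)
    have hB : ∀ w, τ j w ∈ B j ⟨i, z, hz⟩ ↔ dist (τ i w) z < r i z := by
      intro w
      have := congrFun (hpτ j i hji) w
      simp only [Function.comp] at this
      simp [B, hji, this]
    simp only [Equiv.symm_apply_apply, decide_eq_decide, hB] at h1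
    have hx : dist (τ i x) z < r i z := lt_trans hzx (hr i z).1
    have hy := h1.1 hx
    have := dist_triangle_right (τ i x) (τ i y) z
    linarith [(hr i z).2]

end NullCodes

section InvariantLimit

variable {Ω : Type*} [MetricSpace Ω] [MeasurableSpace Ω] [BorelSpace Ω] {T : Ω → Ω}

lemma map_eq_of_tendsto_logAvg (hT : Continuous T) {ν : ℕ → Measure Ω}
    [∀ L, IsProbabilityMeasure (ν L)] {μs : ℕ → ProbabilityMeasure Ω}
    (hμs : ∀ L, (μs L : Measure Ω) = logAvg T (ν L) (L + 1)) {l : Filter ℕ} [l.NeBot]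
    (hl : l ≤ atTop) {μ : ProbabilityMeasure Ω} (h : Tendsto μs l (𝓝 μ)) :
    (μ : Measure Ω).map T = μ := by
  have := Measure.isProbabilityMeasure_map (μ := (μ : Measure Ω)) hT.aemeasurable
  refine ext_of_forall_integral_eq_of_IsFiniteMeasure fun g => ?_
  rw [integral_map hT.aemeasurable g.continuous.aestronglyMeasurable]
  have h1 := ProbabilityMeasure.tendsto_iff_forall_integral_tendsto.1 h g
  have h2 := ProbabilityMeasure.tendsto_iff_forall_integral_tendsto.1 h
    (g.compContinuous ⟨T, hT⟩)
  have h3 := h2.sub h1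
  have hB : ∀ x, |g x| ≤ ‖g‖ := fun x => g.norm_coe_le_norm x
  have h4 : Tendsto (fun L : ℕ => 2 * ‖g‖ / harm (L + 1)) l (𝓝 0) :=
    ((tendsto_const_nhds).div_atTop (tendsto_harm.comp (tendsto_add_atTop_nat 1))).mono_left hl
  have h5 := squeeze_zero_norm (a := fun L : ℕ => 2 * ‖g‖ / harm (L + 1)) (t₀ := l)
    (f := fun L => ∫ x, g (T x) ∂(μs L : Measure Ω) - ∫ x, g x ∂(μs L : Measure Ω)) (fun L => by
      have hL := harm_pos L.succ_pos
      have e1 := harm_mul_integral_logAvg (ν := ν L) hT.measurable g.continuous.measurable hB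
        L.succ_pos
      have e2 := harm_mul_integral_logAvg (ν := ν L) hT.measurable
        (g.continuous.comp hT).measurable (fun x => hB (T x)) L.succ_pos
      have e3 := abs_log_average_shift_le (b := fun m => ∫ x, g (T^[m] x) ∂(ν L)) (B := ‖g‖)
        (fun m => by
          have := norm_integral_le_of_norm_le_const (μ := ν L) (f := fun x => g (T^[m] x))
            (C := ‖g‖) (.of_forall fun x => hB _)
          simpa using this) (L + 1)
      rw [le_div_iff₀ hL, Real.norm_eq_abs, ← abs_of_pos hL, ← abs_mul, hμs, mul_comm,
        mul_sub, e1]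
      simp only [Function.comp] at e2
      rw [e2, ← Finset.sum_sub_distrib]
      simp only [← Function.iterate_succ_apply' T, ← sub_div]
      exact e3) h4
  exact sub_eq_zero.1 (tendsto_nhds_unique h3 h5)

end InvariantLimit

section UpperBound

variable [NeZero k] {X : Fin k → Type*} [∀ i, MetricSpace (X i)]

lemma lamBowenN_anti_radius {X1 : Type*} [MeasurableSpace X1] {T1 : X1 → X1} {T : ∀ i, X i → X i}
    {τ : ∀ i, X1 → X i} {a : Fin k → ℝ} {f : X1 → ℝ} {s ε ε' : ℝ} (h : ε ≤ ε') (N : ℕ)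
    (Z : Set X1) : lamBowenN T1 T τ a f s ε' N Z ≤ lamBowenN T1 T τ a f s ε N Z := by
  unfold lamBowenN
  refine le_iInf fun D => le_iInf fun hD => le_iInf fun hp => le_iInf fun hZ => ?_
  refine iInf_le_of_le D (iInf_le_of_le hD (iInf_le_of_le (fun p hpD => ?_) (iInf_le _ hZ)))
  obtain ⟨h1, h2, x, hx⟩ := hp p hpD
  exact ⟨h1, h2, x, hx.trans (wBowen_mono_radius h)⟩

variable [∀ i, CompactSpace (X i)] [∀ i, MeasurableSpace (X i)] [∀ i, BorelSpace (X i)]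
  {T : ∀ i, X i → X i} {τ : ∀ i, X 0 → X i} {a : Fin k → ℝ} {f : X 0 → ℝ}

lemma cw_zero (a : Fin k → ℝ) : cw a 0 = a 0 := by
  have : Finset.Iic (0 : Fin k) = {0} := by ext; simp
  simp [cw, this]

lemma exists_measure_of_lamBowenN_ne_zero [Nonempty (X 0)] (hT : ∀ i, Continuous (T i))
    (hτ0 : τ 0 = id) (hτc : ∀ i, Continuous (τ i)) (hτe : ∀ i x, τ i (T 0 x) = T i (τ i x))
    (hchain : ∀ i j, i ≤ j → ∃ p : X i → X j, Continuous p ∧ p ∘ τ i = τ j)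
    (ha1 : 0 < a 0) (ha : ∀ i, 0 ≤ a i) (hf : Continuous f) {s δ ε₀ : ℝ} (hδ : 0 < δ)
    (hε₀ : 0 < ε₀) {N : ℕ} (hN : lamBowenN (T 0) T τ a f s ε₀ N univ ≠ 0) :
    ∃ μ : Measure (X 0), IsProbabilityMeasure μ ∧ μ.map (T 0) = μ ∧
      ∃ h : Fin k → ℝ, (∀ i, (h i : EReal) ≤ hKS (μ.map (τ i)) (T i)) ∧
        s - 2 * δ ≤ ∑ i, a i * h i + ∫ x, f x ∂μ := by
  classical
  obtain ⟨η, hη, hfη⟩ := Metric.uniformContinuous_iff.1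
    (CompactSpace.uniformContinuous_of_continuous hf) δ hδ
  obtain ⟨B, hB0, hB⟩ := exists_abs_le_of_continuous hf
  set ε := min (η / 4) (ε₀ / 3) with hεdef
  have hε : 0 < ε := by positivity
  have hN' : lamBowenN (T 0) T τ a f s (3 * ε) N univ ≠ 0 := fun h0 => hN <| le_antisymm
    (h0 ▸ lamBowenN_anti_radius (by linarith [min_le_right (η / 4) (ε₀ / 3)]) N univ) bot_le
  have hosc : ∀ (n : ℕ) x y, y ∈ wBowen T τ a n x (4 * ε) →
      birk (T 0) f ⌈a 0 * (n : ℝ)⌉₊ y ≤ birk (T 0) f ⌈a 0 * (n : ℝ)⌉₊ x + ⌈a 0 * (n : ℝ)⌉₊ * δ := by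
    intro n x y hy
    refine birk_le_birk_add fun j hj => ?_
    have h1 := hy 0 j (by rwa [cw_zero])
    rw [hτ0, id, id] at h1
    have h2 := hfη (h1.trans_le (show 4 * ε ≤ η by linarith [min_le_left (η / 4) (ε₀ / 3)]))
    rw [Real.dist_eq] at h2
    linarith [neg_abs_le (f ((T 0)^[j] x) - f ((T 0)^[j] y))]
  obtain ⟨C, hC, hfro⟩ := exists_frostman hT hτc ha1 ha hδ hε hosc hN'
  choose F p hp hp1 hFp using fun L : ℕ => hfro (max N (L + 1)) (le_max_left _ _)
  set ν : ℕ → Measure (X 0) := fun L => mixM (F L) (p L) Measure.dirac with hν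
  have hνp : ∀ L, IsProbabilityMeasure (ν L) := fun L =>
    isProbabilityMeasure_mixM (fun x _ => hp L x) (hp1 L) fun x => inferInstance
  have hTm := (hT 0).measurable
  let μs : ℕ → ProbabilityMeasure (X 0) := fun L =>
    ⟨logAvg (T 0) (ν L) (L + 1), isProbabilityMeasure_logAvg hTm L.succ_pos⟩
  let U : Ultrafilter ℕ := Ultrafilter.of atTop
  have hU : (U : Filter ℕ) ≤ atTop := Ultrafilter.of_le _
  set μ : ProbabilityMeasure (X 0) := (U.map μs).lim with hμ
  have hlim : Tendsto μs U (𝓝 μ) := (U.map μs).le_nhds_lim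
  have hinv := map_eq_of_tendsto_logAvg (hT 0) (ν := ν) (fun L => rfl) hU hlim
  obtain ⟨m, c', hc'm, hc'0, hc'⟩ := exists_null_frontier_code hτc hchain (μ : Measure (X 0)) hε
  set c : Fin k → X 0 → (Fin m → Bool) := fun i => c' i ∘ τ i with hc
  have hcm : ∀ i, Measurable (c i) := fun i => (hc'm i).comp (hτc i).measurable
  set s' := s - 2 * δ with hs'
  set C' := max (Real.log C) (|s'| * N + (1 / a 0) * ((a 0 * N + 1) * B)) with hC'
  have hbasic : ∀ L, ∀ n ∈ Finset.range (L + 1), s' * ((n : ℝ) + 1) - C'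
      ≤ jent (ν L) (fun e : Fin k × ℕ => c e.1 ∘ (T 0)^[e.2]) (levelIdx a (n + 1))
        + (1 / a 0) * ∑ m ∈ Finset.range ⌈a 0 * ((n : ℝ) + 1)⌉₊,
          ∫ x, f ((T 0)^[m] x) ∂(ν L) := by
    intro L n hn
    rcases le_or_gt N (n + 1) with hNn | hNn
    · have h1 := le_jent_of_frostman hTm hτe hcm (ε := ε) hc' (n := n + 1) (hp L) (hp1 L)
        hf.measurable hC (hFp L (n + 1) (Finset.mem_Icc.2 ⟨hNn, by
          have := Finset.mem_range.1 hn; omega⟩))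
      push_cast at h1
      refine le_trans ?_ h1
      linarith [le_max_left (Real.log C) (|s'| * N + (1 / a 0) * ((a 0 * N + 1) * B))]
    · have hnN : (n : ℝ) + 1 ≤ N := by exact_mod_cast hNn.le
      have h1 := jent_nonneg (ν L) (Y := fun e : Fin k × ℕ => c e.1 ∘ (T 0)^[e.2])
        (levelIdx a (n + 1))
      have h2 : -((a 0 * N + 1) * B) ≤ ∑ m ∈ Finset.range ⌈a 0 * ((n : ℝ) + 1)⌉₊,
          ∫ x, f ((T 0)^[m] x) ∂(ν L) := by
        have h3 : ∀ m ∈ Finset.range ⌈a 0 * ((n : ℝ) + 1)⌉₊,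
            -B ≤ ∫ x, f ((T 0)^[m] x) ∂(ν L) := fun m _ => by
          have := norm_integral_le_of_norm_le_const (μ := ν L) (f := fun x => f ((T 0)^[m] x))
            (C := B) (.of_forall fun x => hB _)
          rw [Real.norm_eq_abs] at this
          simpa using (abs_le.1 this).1
        have h4 := Finset.card_nsmul_le_sum _ _ _ h3
        refine le_trans ?_ h4
        have h5 : (⌈a 0 * ((n : ℝ) + 1)⌉₊ : ℝ) ≤ a 0 * N + 1 := by
          refine (Nat.ceil_lt_add_one (by positivity)).le.trans ?_
          gcongr
        simp only [Finset.card_range, nsmul_eq_mul]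
        nlinarith
      have h3 : s' * ((n : ℝ) + 1) ≤ |s'| * N := by
        calc s' * ((n : ℝ) + 1) ≤ |s'| * ((n : ℝ) + 1) := by gcongr; exact le_abs_self _
          _ ≤ _ := by gcongr
      have h4 := mul_le_mul_of_nonneg_left h2 (show 0 ≤ 1 / a 0 by positivity)
      linarith [le_max_right (Real.log C) (|s'| * N + (1 / a 0) * ((a 0 * N + 1) * B))]
  have hfin : ∀ q : ℕ, 0 < q → s' ≤ ∑ i,
    a i * (ent (μ : Measure (X 0)) (blockCode (T 0) (c i) q) / q)
      + ∫ x, f x ∂(μ : Measure (X 0)) := by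
    intro q hq
    obtain ⟨K, hK⟩ := exists_averaged_bound hTm ha ha1 hcm hq hf.measurable hB
    have h1 : ∀ L, s' - (|s'| + |C'| + K) / harm (L + 1)
        ≤ ∑ i, a i / q * ent (μs L : Measure (X 0)) (blockCode (T 0) (c i) q)
          + ∫ x, f x ∂(μs L : Measure (X 0)) := by
      intro L
      have h2 := hK (ν L) s' C' (L + 1) L.succ_pos (hbasic L)
      have h3 := harm_pos L.succ_pos
      rw [sub_le_iff_le_add, ← sub_le_iff_le_add', le_div_iff₀ h3]
      change _ ≤ harm (L + 1) * (∑ i, a i / q * ent (μs L : Measure (X 0)) (blockCode (T 0) (c i) q)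
        + ∫ x, f x ∂(μs L : Measure (X 0))) + K at h2
      change _ * harm (L + 1) ≤ _
      linarith
    have h2 : Tendsto (fun L : ℕ => s' - (|s'| + |C'| + K) / harm (L + 1)) U (𝓝 (s' - 0)) :=
      tendsto_const_nhds.sub
        (((tendsto_const_nhds).div_atTop (tendsto_harm.comp
          (tendsto_add_atTop_nat 1))).mono_left hU)
    have h3 := ProbabilityMeasure.tendsto_iff_forall_integral_tendsto.1 hlim
      (BoundedContinuousFunction.mkOfCompact ⟨f, hf⟩)
    have h4 : ∀ i, Tendsto (fun L => ent (μs L : Measure (X 0)) (blockCode (T 0) (c i) q)) U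
        (𝓝 (ent (μ : Measure (X 0)) (blockCode (T 0) (c i) q))) := by
      intro i
      refine tendsto_ent_of_null_frontier hlim fun z => ?_
      have : blockCode (T 0) (c i) q ⁻¹' {z}
          = ⋂ l : Fin q, (T 0)^[(l : ℕ)] ⁻¹' (τ i ⁻¹' (c' i ⁻¹' {z l})) := by
        ext x; simp [blockCode, funext_iff, hc]
      rw [this]
      refine null_frontier_iInter fun l => null_frontier_preimage ((hT 0).iterate l) ?_
      rw [map_iterate_eq hTm hinv]
      exact null_frontier_preimage (hτc i) (hc'0 i _)
    have h5 := le_of_tendsto_of_tendsto' h2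
      ((tendsto_finsetSum Finset.univ fun i _ => (h4 i).const_mul (a i / q)).add h3) h1
    rw [sub_zero] at h5
    refine h5.trans (le_of_eq ?_)
    congr 1
    exact Finset.sum_congr rfl fun i _ => by ring
  refine ⟨μ, inferInstance, hinv, fun i => entRate (μ : Measure (X 0)) (T 0) (c i), fun i => ?_, ?_⟩
  · have := Measure.isProbabilityMeasure_map (μ := (μ : Measure (X 0))) (hτc i).aemeasurable
    change ((entRate (μ : Measure (X 0)) (T 0) (c' i ∘ τ i) : ℝ) : EReal) ≤ _
    rw [← entRate_map (hτc i).measurable (hT i).measurable (hτe i) (hc'm i)]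
    refine entRate_le_hKS (hT i).measurable ?_ (hc'm i)
    have e : T i ∘ τ i = τ i ∘ T 0 := funext fun x => (hτe i x).symm
    rw [Measure.map_map (hT i).measurable (hτc i).measurable, e,
      ← Measure.map_map (hτc i).measurable hTm, hinv]
  · have h1 : Tendsto (fun q : ℕ => ∑ i,
        a i * (ent (μ : Measure (X 0)) (blockCode (T 0) (c i) q) / q)
        + ∫ x, f x ∂(μ : Measure (X 0))) atTop
        (𝓝 (∑ i, a i * entRate (μ : Measure (X 0)) (T 0) (c i) + ∫ x, f x ∂(μ : Measure (X 0)))) :=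
      (tendsto_finsetSum _ fun i _ =>
        (tendsto_entRate hTm hinv (hcm i)).const_mul (a i)).add_const _
    exact ge_of_tendsto h1 ((eventually_gt_atTop 0).mono hfin)

end UpperBound

section PointwiseErgodic

variable {Ω : Type*} {T : Ω → Ω} {f g : Ω → ℝ} {B : ℝ}

/-- The maximal function `max_{j ≤ n} S_j g`, defined recursively. -/
noncomputable def maxBirk (T : Ω → Ω) (g : Ω → ℝ) : ℕ → Ω → ℝ
  | 0, _ => 0
  | n + 1, x => max 0 (g x + maxBirk T g n (T x))

lemma maxBirk_nonneg (n : ℕ) (x : Ω) : 0 ≤ maxBirk T g n x := by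
  cases n
  · simp [maxBirk]
  · simp [maxBirk]

lemma maxBirk_le_succ (n : ℕ) (x : Ω) : maxBirk T g n x ≤ maxBirk T g (n + 1) x := by
  induction n generalizing x with
  | zero => exact maxBirk_nonneg 1 x
  | succ n ih => exact max_le_max le_rfl (add_le_add le_rfl (ih (T x)))

lemma birk_succ' (n : ℕ) (x : Ω) : birk T g (n + 1) x = g x + birk T g n (T x) := by
  simp [birk, Finset.sum_range_succ', add_comm]

lemma birk_le_maxBirk (n : ℕ) (x : Ω) : birk T g n x ≤ maxBirk T g n x := by
  induction n generalizing x with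
  | zero => simp [birk, maxBirk]
  | succ n ih =>
    rw [birk_succ']
    exact (add_le_add le_rfl (ih (T x))).trans (le_max_right _ _)

lemma maxBirk_le (hB : ∀ x, |g x| ≤ B) (n : ℕ) (x : Ω) : maxBirk T g n x ≤ n * B := by
  have hB0 : 0 ≤ B := (abs_nonneg _).trans (hB x)
  induction n generalizing x with
  | zero => simp [maxBirk]
  | succ n ih =>
    refine max_le (by positivity) ?_
    have := ih (T x)
    have := (abs_le.1 (hB x)).2
    push_cast
    linarith

lemma abs_birk_div_le (hB : ∀ x, |g x| ≤ B) (n : ℕ) (x : Ω) : |birk T g n x / n| ≤ B := by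
  have hB0 : 0 ≤ B := (abs_nonneg _).trans (hB x)
  rw [abs_div, Nat.abs_cast]
  refine div_le_of_le_mul₀ (by positivity) hB0 ?_
  calc |birk T g n x| ≤ ∑ l ∈ Finset.range n, |g (T^[l] x)| := Finset.abs_sum_le_sum_abs _ _
    _ ≤ ∑ l ∈ Finset.range n, B := Finset.sum_le_sum fun l _ => hB _
    _ = B * n := by simp [mul_comm]

/-- The upper Birkhoff average. -/
noncomputable def upperAvg (T : Ω → Ω) (f : Ω → ℝ) (x : Ω) : ℝ :=
  limsup (fun n : ℕ => birk T f n x / n) atTop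

lemma isBoundedUnder_birk (hB : ∀ x, |f x| ≤ B) (x : Ω) :
    IsBoundedUnder (· ≤ ·) atTop fun n : ℕ => birk T f n x / n :=
  isBoundedUnder_of ⟨B, fun n => (abs_le.1 (abs_birk_div_le hB n x)).2⟩

lemma isCoboundedUnder_birk (hB : ∀ x, |f x| ≤ B) (x : Ω) :
    IsCoboundedUnder (· ≤ ·) atTop fun n : ℕ => birk T f n x / n :=
  (isBoundedUnder_of ⟨-B, fun n => (abs_le.1 (abs_birk_div_le hB n x)).1⟩ :
    IsBoundedUnder (· ≥ ·) atTop _).isCoboundedUnder_le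

lemma eventually_birk_lt (hB : ∀ x, |f x| ≤ B) {x : Ω} {b : ℝ} (hb : upperAvg T f x < b) :
    ∀ᶠ n : ℕ in atTop, birk T f n x / n < b :=
  eventually_lt_of_limsup_lt hb (isBoundedUnder_birk hB x)

lemma abs_upperAvg_le (hB : ∀ x, |f x| ≤ B) (x : Ω) : |upperAvg T f x| ≤ B := by
  refine abs_le.2 ⟨?_, ?_⟩
  · refine le_limsup_of_frequently_le (Frequently.of_forall fun n => ?_) (isBoundedUnder_birk hB x)
    exact (abs_le.1 (abs_birk_div_le hB n x)).1
  · refine limsup_le_of_le (isCoboundedUnder_birk hB x) (Eventually.of_forall fun n => ?_)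
    exact (abs_le.1 (abs_birk_div_le hB n x)).2

lemma limsup_le_limsup_of_sub_tendsto {u v : ℕ → ℝ} (hu : IsCoboundedUnder (· ≤ ·) atTop u)
    (hv : IsBoundedUnder (· ≤ ·) atTop v) (h : Tendsto (fun n => u n - v n) atTop (𝓝 0)) :
    limsup u atTop ≤ limsup v atTop := by
  refine le_of_forall_pos_le_add fun ε hε => ?_
  have h1 : ∀ᶠ n in atTop, v n < limsup v atTop + ε / 2 :=
    eventually_lt_of_limsup_lt (by linarith) hv
  have h2 : ∀ᶠ n in atTop, u n - v n < ε / 2 := h.eventually (gt_mem_nhds (by linarith))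
  refine limsup_le_of_le hu ?_
  filter_upwards [h1, h2] with n h1 h2
  linarith

lemma upperAvg_comp (hB : ∀ x, |f x| ≤ B) (x : Ω) : upperAvg T f (T x) = upperAvg T f x := by
  have h : Tendsto (fun n : ℕ => birk T f n (T x) / n - birk T f n x / n) atTop (𝓝 0) := by
    refine squeeze_zero_norm (a := fun n : ℕ => 2 * B / n) (fun n => ?_)
      (tendsto_const_div_atTop_nhds_zero_nat _)
    have h1 : birk T f n (T x) - birk T f n x = f (T^[n] x) - f x := by
      have h2 := birk_succ' (T := T) (g := f) n x
      have h3 : birk T f (n + 1) x = birk T f n x + f (T^[n] x) := Finset.sum_range_succ _ _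
      linarith
    rw [← sub_div, h1, Real.norm_eq_abs, abs_div, Nat.abs_cast]
    gcongr
    have := abs_le.1 (hB x)
    have := abs_le.1 (hB (T^[n] x))
    exact abs_le.2 ⟨by linarith, by linarith⟩
  refine le_antisymm ?_ ?_
  · exact limsup_le_limsup_of_sub_tendsto (isCoboundedUnder_birk hB _) (isBoundedUnder_birk hB _) h
  · refine limsup_le_limsup_of_sub_tendsto (isCoboundedUnder_birk hB _)
      (isBoundedUnder_birk hB _) ?_
    simpa using h.neg

variable [MeasurableSpace Ω] {μ : Measure Ω} [IsProbabilityMeasure μ]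

lemma measurable_birk (hT : Measurable T) (hg : Measurable g) (n : ℕ) :
    Measurable (birk T g n) :=
  Finset.measurable_sum _ fun l _ => hg.comp (hT.iterate l)

lemma measurable_maxBirk (hT : Measurable T) (hg : Measurable g) (n : ℕ) :
    Measurable (maxBirk T g n) := by
  induction n with
  | zero => exact measurable_const
  | succ n ih => exact measurable_const.max (hg.add (ih.comp hT))

lemma measurable_upperAvg (hT : Measurable T) (hf : Measurable f) :
    Measurable (upperAvg T f) :=
  Measurable.limsup fun n => (measurable_birk hT hf n).div_const _

lemma integral_comp_of_map_eq (hT : Measurable T) (hμ : μ.map T = μ) (hg : Measurable g) :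
    ∫ x, g (T x) ∂μ = ∫ x, g x ∂μ := by
  conv_rhs => rw [← hμ]
  rw [integral_map hT.aemeasurable hg.aestronglyMeasurable]

lemma setIntegral_maxBirk_nonneg (hT : Measurable T) (hμ : μ.map T = μ) (hg : Measurable g)
    (hB : ∀ x, |g x| ≤ B) (n : ℕ) :
    0 ≤ ∫ x in {x | 0 < maxBirk T g (n + 1) x}, g x ∂μ := by
  have hM := measurable_maxBirk hT hg (n + 1)
  have hMint : Integrable (maxBirk T g (n + 1)) μ := by
    refine integrable_of_abs_le hM (B := (n + 1 : ℕ) * B) fun x => ?_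
    rw [abs_of_nonneg (maxBirk_nonneg _ _)]
    exact maxBirk_le hB _ _
  have hMint' : Integrable (fun x => maxBirk T g (n + 1) (T x)) μ := by
    refine integrable_of_abs_le (hM.comp hT) (B := (n + 1 : ℕ) * B) fun x => ?_
    rw [abs_of_nonneg (maxBirk_nonneg _ _)]
    exact maxBirk_le hB _ _
  have hE : MeasurableSet {x | 0 < maxBirk T g (n + 1) x} := measurableSet_lt measurable_const hM
  rw [← integral_indicator hE]
  calc (0 : ℝ) = ∫ x, (maxBirk T g (n + 1) x - maxBirk T g (n + 1) (T x)) ∂μ := by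
        rw [integral_sub hMint hMint', integral_comp_of_map_eq hT hμ hM, sub_self]
    _ ≤ _ := by
      refine integral_mono (hMint.sub hMint')
        ((integrable_of_abs_le hg hB).indicator hE) fun x => ?_
      by_cases hx : 0 < maxBirk T g (n + 1) x
      · simp only [indicator, mem_ofPred_eq, hx, if_true]
        have h1 : maxBirk T g (n + 1) x = g x + maxBirk T g n (T x) := by
          refine max_eq_right (le_of_not_gt fun h => ?_)
          have : maxBirk T g (n + 1) x = 0 := max_eq_left h.le
          linarith
        have := maxBirk_le_succ (T := T) (g := g) n (T x)
        linarith
      · simp only [indicator, mem_ofPred_eq, hx, if_false]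
        have := maxBirk_nonneg (T := T) (g := g) (n + 1) (T x)
        linarith

/-- A form of the maximal ergodic theorem. -/
lemma integral_nonneg_of_exists_birk_pos (hT : Measurable T) (hμ : μ.map T = μ)
    (hg : Measurable g) (hB : ∀ x, |g x| ≤ B) (h : ∀ x, ∃ j, 0 < birk T g j x) :
    0 ≤ ∫ x, g x ∂μ := by
  have hU : ⋃ n, {x | 0 < maxBirk T g (n + 1) x} = univ := by
    refine eq_univ_of_forall fun x => ?_
    obtain ⟨j, hj⟩ := h x
    exact mem_iUnion.2 ⟨j, (hj.trans_le (birk_le_maxBirk j x)).trans_le (maxBirk_le_succ j x)⟩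
  have := tendsto_setIntegral_of_monotone (μ := μ) (f := g)
    (s := fun n => {x | 0 < maxBirk T g (n + 1) x})
    (fun n => measurableSet_lt measurable_const (measurable_maxBirk hT hg (n + 1)))
    (monotone_nat_of_le_succ fun n x hx => lt_of_lt_of_le hx (maxBirk_le_succ (n + 1) x))
    (integrable_of_abs_le hg hB).integrableOn
  rw [hU, setIntegral_univ] at this
  exact ge_of_tendsto' this fun n => setIntegral_maxBirk_nonneg hT hμ hg hB n

lemma integral_upperAvg_le (hT : Measurable T) (hμ : μ.map T = μ) (hf : Measurable f)
    (hB : ∀ x, |f x| ≤ B) : ∫ x, upperAvg T f x ∂μ ≤ ∫ x, f x ∂μ := by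
  refine le_of_forall_pos_le_add fun ε hε => ?_
  have hu := measurable_upperAvg hT hf
  have hg : Measurable fun x => f x - upperAvg T f x + ε := (hf.sub hu).add_const ε
  have hb : ∀ x, |f x - upperAvg T f x + ε| ≤ 2 * B + ε := fun x => by
    have := abs_le.1 (hB x)
    have := abs_le.1 (abs_upperAvg_le (T := T) hB x)
    exact abs_le.2 ⟨by linarith, by linarith⟩
  have hinv : ∀ l x, upperAvg T f (T^[l] x) = upperAvg T f x := by
    intro l
    induction l with
    | zero => intro x; rfl
    | succ l ih => intro x; rw [Function.iterate_succ_apply, ih, upperAvg_comp hB]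
  have := integral_nonneg_of_exists_birk_pos hT hμ hg hb fun x => by
    have h1 : ∃ᶠ n : ℕ in atTop, upperAvg T f x - ε < birk T f n x / n :=
      frequently_lt_of_lt_limsup (isCoboundedUnder_birk hB x)
        (show upperAvg T f x - ε < upperAvg T f x by linarith)
    obtain ⟨n, hn, hn0⟩ := (h1.and_eventually (eventually_gt_atTop 0)).exists
    refine ⟨n, ?_⟩
    have hn0' : (0 : ℝ) < n := by exact_mod_cast hn0
    rw [lt_div_iff₀ hn0'] at hn
    have : birk T (fun x => f x - upperAvg T f x + ε) n x
        = birk T f n x - n * upperAvg T f x + n * ε := by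
      simp only [birk, hinv, Finset.sum_add_distrib, Finset.sum_sub_distrib, Finset.sum_const,
        Finset.card_range, nsmul_eq_mul]
    rw [this]
    linarith
  have hfi := integrable_of_abs_le (μ := μ) hf hB
  have hui := integrable_of_abs_le (μ := μ) hu (abs_upperAvg_le hB)
  have h1 : ∫ x, (f x - upperAvg T f x + ε) ∂μ = ∫ x, (f x - upperAvg T f x) ∂μ + ∫ _, ε ∂μ :=
    integral_add (hfi.sub hui) (integrable_const _)
  have h2 : ∫ x, (f x - upperAvg T f x) ∂μ = ∫ x, f x ∂μ - ∫ x, upperAvg T f x ∂μ :=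
    integral_sub hfi hui
  rw [h1, h2] at this
  simp at this
  linarith

/-- Birkhoff's pointwise ergodic theorem for bounded functions. -/
theorem exists_birkhoff_limit (hT : Measurable T) (hμ : μ.map T = μ) (hf : Measurable f)
    (hB : ∀ x, |f x| ≤ B) :
    ∃ F : Ω → ℝ, Measurable F ∧ (∀ x, |F x| ≤ B) ∧ ∫ x, F x ∂μ = ∫ x, f x ∂μ ∧
      ∀ᵐ x ∂μ, Tendsto (fun n : ℕ => birk T f n x / n) atTop (𝓝 (F x)) := by
  have hB' : ∀ x, |(-f) x| ≤ B := fun x => by simpa using hB x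
  have hneg : ∀ n x, birk T (-f) n x / n = -(birk T f n x / n) := fun n x => by
    simp [birk, neg_div]
  have hu := measurable_upperAvg hT hf
  have hu' := measurable_upperAvg hT hf.neg
  have hui := integrable_of_abs_le (μ := μ) hu (abs_upperAvg_le hB)
  have hui' := integrable_of_abs_le (μ := μ) hu' (abs_upperAvg_le hB')
  have hpos : ∀ x, 0 ≤ upperAvg T f x + upperAvg T (-f) x := by
    intro x
    refine le_of_forall_pos_le_add fun ε hε => ?_
    obtain ⟨n, h1, h2⟩ := ((eventually_birk_lt hB
      (show upperAvg T f x < upperAvg T f x + ε / 2 by linarith)).and (eventually_birk_lt hB'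
      (show upperAvg T (-f) x < upperAvg T (-f) x + ε / 2 by linarith))).exists
    rw [hneg] at h2
    linarith
  have h1 := integral_upperAvg_le hT hμ hf hB
  have h2 := integral_upperAvg_le hT hμ hf.neg hB'
  have h3 : ∫ x, (-f) x ∂μ = - ∫ x, f x ∂μ := integral_neg f
  have h4 := integral_add hui hui'
  have h5 : 0 ≤ ∫ x, (upperAvg T f x + upperAvg T (-f) x) ∂μ := integral_nonneg hpos
  refine ⟨upperAvg T f, hu, abs_upperAvg_le hB, by linarith, ?_⟩
  have h6 : (fun x => upperAvg T f x + upperAvg T (-f) x) =ᵐ[μ] 0 :=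
    (integral_eq_zero_iff_of_nonneg hpos (hui.add hui')).1 (by linarith)
  filter_upwards [h6] with x hx
  simp only [Pi.zero_apply] at hx
  rw [tendsto_order]
  constructor
  · intro b hb
    filter_upwards [eventually_birk_lt hB' (show upperAvg T (-f) x < -b by linarith)] with n hn
    rw [hneg] at hn
    linarith
  · intro b hb
    exact eventually_birk_lt hB hb

end PointwiseErgodic

section CondProb

variable {Ω : Type*} {m : MeasurableSpace Ω} [mΩ : MeasurableSpace Ω]
  {μ : Measure Ω} [IsProbabilityMeasure μ]

lemma integrable_indicator_one {A : Set Ω} (hA : MeasurableSet A) :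
    Integrable (A.indicator (1 : Ω → ℝ)) μ := (integrable_const (1 : ℝ)).indicator hA

/-- A version of the conditional probability of `A` with values in `[0, 1]`. -/
lemma exists_condProb (hm : m ≤ mΩ) {A : Set Ω} (hA : MeasurableSet A) :
    ∃ P : Ω → ℝ, Measurable[m] P ∧ (∀ x, 0 ≤ P x) ∧ (∀ x, P x ≤ 1) ∧
      P =ᵐ[μ] μ[A.indicator (1 : Ω → ℝ) | m] ∧
      ∀ (h : Ω → ℝ) (C : ℝ), Measurable[m] h → (∀ x, |h x| ≤ C) →
        ∫ x, A.indicator (1 : Ω → ℝ) x * h x ∂μ = ∫ x, P x * h x ∂μ := by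
  have hint := integrable_indicator_one (μ := μ) hA
  have h0 : 0 ≤ᵐ[μ] μ[A.indicator (1 : Ω → ℝ) | m] :=
    condExp_nonneg (.of_forall fun x => indicator_nonneg (fun _ _ => zero_le_one) x)
  have h1 : μ[A.indicator (1 : Ω → ℝ) | m] ≤ᵐ[μ] fun _ => 1 := by
    have := condExp_mono (m := m) hint (integrable_const (1 : ℝ))
      (.of_forall fun x => indicator_le_self' (f := (1 : Ω → ℝ)) (fun _ _ => zero_le_one) x)
    rwa [condExp_const hm] at this
  have hP : (fun x => max 0 (min 1 (μ[A.indicator (1 : Ω → ℝ) | m] x)))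
      =ᵐ[μ] μ[A.indicator (1 : Ω → ℝ) | m] := by
    filter_upwards [h0, h1] with x hx0 hx1
    rw [min_eq_right hx1]
    exact max_eq_right hx0
  refine ⟨fun x => max 0 (min 1 (μ[A.indicator (1 : Ω → ℝ) | m] x)), ?_, fun x => le_max_left _ _,
    fun x => max_le zero_le_one (min_le_left _ _), hP, fun h C hh hC => ?_⟩
  · exact measurable_const.max (measurable_const.min stronglyMeasurable_condExp.measurable)
  · have hhm : Measurable h := hh.mono hm le_rfl
    have hprod : Integrable (h * A.indicator (1 : Ω → ℝ)) μ := by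
      refine integrable_of_abs_le (hhm.mul (measurable_one.indicator hA)) (B := C) fun x => ?_
      by_cases hx : x ∈ A
      · simpa [hx] using hC x
      · simpa [hx] using (abs_nonneg _).trans (hC x)
    have := condExp_mul_of_stronglyMeasurable_left hh.stronglyMeasurable hprod hint
    calc ∫ x, A.indicator (1 : Ω → ℝ) x * h x ∂μ = ∫ x, (h * A.indicator (1 : Ω → ℝ)) x ∂μ := by
          simp [mul_comm]
      _ = ∫ x, (μ[h * A.indicator (1 : Ω → ℝ) | m]) x ∂μ := (integral_condExp hm).symm
      _ = _ := by
        refine integral_congr_ae ?_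
        filter_upwards [this, hP] with x hx hPx
        rw [hx, Pi.mul_apply, hPx, mul_comm]

/-- The entropy of `Y` given a finite-valued `Z`, through conditional expectations. -/
lemma sum_integral_negMulLog_condExp_comap {ι ζ : Type*} [Fintype ι] [Fintype ζ]
    [MeasurableSpace ι] [DiscreteMeasurableSpace ι] [MeasurableSpace ζ]
    [DiscreteMeasurableSpace ζ] {Y : Ω → ι} {Z : Ω → ζ} (hY : Measurable Y) (hZ : Measurable Z) :
    ∑ c, ∫ x, Real.negMulLog
      ((μ[(Y ⁻¹' {c}).indicator (1 : Ω → ℝ) | MeasurableSpace.comap Z inferInstance]) x) ∂μ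
      = ent μ (fun x => (Y x, Z x)) - ent μ Z := by
  classical
  set j : ι → ζ → ℝ := fun c z => μ.real ((fun x => (Y x, Z x)) ⁻¹' {(c, z)}) with hj
  set b : ζ → ℝ := fun z => μ.real (Z ⁻¹' {z}) with hb
  have hjb : ∀ c z, b z = 0 → j c z = 0 := fun c z h => by
    refine le_antisymm ?_ measureReal_nonneg
    rw [← h]
    exact measureReal_mono fun x hx => by simp at hx; simp [hx.2]
  have hsum : ∀ z, ∑ c, j c z = b z := by
    intro z
    have := sum_measureReal_preimage_filter μ (hY.prodMk hZ)
      (Finset.univ.map (Function.Embedding.sectL ι z))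
    rw [Finset.sum_map] at this
    refine this.trans ?_
    congr 1
    ext x
    simp [Prod.ext_iff, eq_comm]
  have hint : ∀ q : ζ → ℝ, Integrable (fun x => q (Z x)) μ := fun q =>
    integrable_of_abs_le ((measurable_of_countable q).comp hZ) (B := ∑ z, |q z|) fun x =>
      Finset.single_le_sum (f := fun z => |q z|) (fun _ _ => abs_nonneg _) (Finset.mem_univ _)
  have hintegral : ∀ (q : ζ → ℝ) (S : Set ζ),
      ∫ x in Z ⁻¹' S, q (Z x) ∂μ = ∑ z, if z ∈ S then b z * q z else 0 := by
    intro q S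
    have h1 : ∀ x, (Z ⁻¹' S).indicator (fun x => q (Z x)) x
        = ∑ z, (Z ⁻¹' {z}).indicator (fun _ => if z ∈ S then q z else 0) x := by
      intro x
      simp [indicator_apply]
    rw [← integral_indicator (hZ (.of_discrete)), integral_congr_ae (.of_forall h1),
      integral_finsetSum _ fun z _ => (integrable_const _).indicator (hZ (.of_discrete))]
    refine Finset.sum_congr rfl fun z _ => ?_
    rw [integral_indicator_const _ (hZ (.of_discrete))]
    split_ifs <;> simp [hb]
  have hcond : ∀ c, (fun x => j c (Z x) / b (Z x)) =ᵐ[μ]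
      μ[(Y ⁻¹' {c}).indicator (1 : Ω → ℝ) | MeasurableSpace.comap Z inferInstance] := by
    intro c
    refine ae_eq_condExp_of_forall_setIntegral_eq hZ.comap_le
      (integrable_indicator_one (hY (.of_discrete)))
      (fun s _ _ => (hint fun z => j c z / b z).integrableOn) ?_ ?_
    · rintro _ ⟨S, -, rfl⟩ -
      rw [hintegral (fun z => j c z / b z) S, integral_indicator_one (hY (.of_discrete)),
        measureReal_restrict_apply (hY (.of_discrete))]
      have := sum_measureReal_preimage_filter μ (hY.prodMk hZ)
        ((Finset.univ.filter (· ∈ S)).map (Function.Embedding.sectR c ζ))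
      rw [Finset.sum_map, Finset.sum_filter] at this
      rw [show Y ⁻¹' {c} ∩ Z ⁻¹' S = (fun x => (Y x, Z x)) ⁻¹' ((Finset.univ.filter (· ∈ S)).map
        (Function.Embedding.sectR c ζ) : Finset (ι × ζ)) from ?_, ← this]
      · refine Finset.sum_congr rfl fun z _ => ?_
        split_ifs
        · by_cases hz : b z = 0
          · simp only [hz, zero_mul]
            exact (hjb c z hz).symm
          · exact mul_div_cancel₀ _ hz
        · rfl
      · ext x
        simp [Prod.ext_iff, eq_comm, and_comm]
    · have : Measurable[MeasurableSpace.comap Z inferInstance] fun x => j c (Z x) / b (Z x) :=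
        (measurable_of_countable fun z => j c z / b z).comp (comap_measurable Z)
      exact this.stronglyMeasurable.aestronglyMeasurable
  have h2 : ∀ c, ∫ x, Real.negMulLog
      ((μ[(Y ⁻¹' {c}).indicator (1 : Ω → ℝ) | MeasurableSpace.comap Z inferInstance]) x) ∂μ
      = ∑ z, b z * Real.negMulLog (j c z / b z) := by
    intro c
    refine (integral_congr_ae ((hcond c).fun_comp Real.negMulLog)).symm.trans ?_
    have := hintegral (fun z => Real.negMulLog (j c z / b z)) univ
    simpa using this
  have h3 : ∀ c z, b z * Real.negMulLog (j c z / b z)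
      = Real.negMulLog (j c z) + j c z * Real.log (b z) := by
    intro c z
    by_cases hz : b z = 0
    · simp [hz, hjb c z hz]
    by_cases hjz : j c z = 0
    · simp [hjz]
    rw [Real.negMulLog, Real.log_div hjz hz, Real.negMulLog]
    field_simp
    ring
  simp only [h2, h3]
  rw [Finset.sum_comm]
  simp only [Finset.sum_add_distrib, ← Finset.sum_mul, hsum]
  rw [Finset.sum_comm, ← Fintype.sum_prod_type' (fun c z => Real.negMulLog (j c z))]
  unfold ent
  rw [sub_eq_add_neg, ← Finset.sum_neg_distrib]
  congr 1
  refine Finset.sum_congr rfl fun z _ => ?_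
  simp [Real.negMulLog, hb]

end CondProb

section Future

variable {Ω κ : Type*} [mΩ : MeasurableSpace Ω] {μ : Measure Ω} [IsProbabilityMeasure μ]
  [Fintype κ] [MeasurableSpace κ] [DiscreteMeasurableSpace κ] {T : Ω → Ω} {c : Ω → κ}

/-- The σ-algebra generated by the future `c ∘ T, c ∘ T², …` of the code `c`. -/
abbrev future (T : Ω → Ω) (c : Ω → κ) : MeasurableSpace Ω :=
  ⨆ n : ℕ, MeasurableSpace.comap (fun x => blockCode T c n (T x)) inferInstance

lemma measurable_blockCode_comp (hT : Measurable T) (hc : Measurable c) (n : ℕ) :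
    Measurable fun x => blockCode T c n (T x) := (measurable_blockCode hT hc n).comp hT

lemma future_le (hT : Measurable T) (hc : Measurable c) : future T c ≤ mΩ :=
  iSup_le fun n => (measurable_blockCode_comp hT hc n).comap_le

lemma measurable_future (m : ℕ) : Measurable[future T c] fun x => c (T^[m + 1] x) := by
  have h1 : Measurable[future T c] fun x => blockCode T c (m + 1) (T x) :=
    measurable_iff_comap_le.2 (le_iSup (fun n : ℕ => MeasurableSpace.comap
      (fun x => blockCode T c n (T x)) inferInstance) (m + 1))
  exact (measurable_pi_apply (Fin.last m)).comp h1

lemma measurable_to_future {m : MeasurableSpace Ω} {S : Ω → Ω}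
    (h : ∀ l, Measurable[m] fun x => c (T^[l + 1] (S x))) : Measurable[m, future T c] S := by
  rw [measurable_iff_comap_le, future, MeasurableSpace.comap_iSup]
  refine iSup_le fun n => ?_
  rw [MeasurableSpace.comap_comp, ← measurable_iff_comap_le]
  exact @measurable_pi_lambda _ _ _ m _ _ fun l => h l

/-- The filtration generated by `c ∘ T, c ∘ T², …`. -/
def futureFiltration (hT : Measurable T) (hc : Measurable c) : Filtration ℕ mΩ where
  seq n := MeasurableSpace.comap (fun x => blockCode T c n (T x)) inferInstance
  mono' := by
    intro n n' h
    have h1 : (fun x => blockCode T c n (T x))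
        = (fun d (l : Fin n) => d (Fin.castLE h l)) ∘ fun x => blockCode T c n' (T x) := by
      funext x l
      rfl
    beta_reduce
    rw [h1, ← MeasurableSpace.comap_comp]
    exact MeasurableSpace.comap_mono (measurable_of_countable
      (fun (d : Fin n' → κ) (l : Fin n) => d (Fin.castLE h l))).comap_le
  le' n := (measurable_blockCode_comp hT hc n).comap_le

lemma negMulLog_le_one {p : ℝ} (h0 : 0 ≤ p) : Real.negMulLog p ≤ 1 := by
  have := neg_mul_log_le h0 zero_le_one (by simp)
  simp at this
  linarith

lemma ent_blockCode_succ_le (hT : Measurable T) (hc : Measurable c) (n : ℕ) :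
    ent μ (blockCode T c (n + 1)) ≤ ent μ fun x => (c x, blockCode T c n (T x)) := by
  classical
  have := ent_comp_le μ (hc.prodMk (measurable_blockCode_comp hT hc n))
    (fun d => (Fin.cons d.1 d.2 : Fin (n + 1) → κ))
  refine le_of_eq_of_le ?_ this
  congr 1
  funext x l
  refine Fin.cases ?_ (fun l => ?_) l
  · simp [blockCode]
  · simp [blockCode]

theorem entRate_le_integral_condExp (hT : Measurable T) (hμ : μ.map T = μ) (hc : Measurable c) :
    entRate μ T c ≤ ∑ d, ∫ x, Real.negMulLog
      ((μ[(c ⁻¹' {d}).indicator (1 : Ω → ℝ) | future T c]) x) ∂μ := by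
  set ℱ := futureFiltration hT hc
  set u : ℕ → ℝ := fun n => ∑ d, ∫ x, Real.negMulLog
      ((μ[(c ⁻¹' {d}).indicator (1 : Ω → ℝ) | ℱ n]) x) ∂μ with hu
  have hlim : Tendsto u atTop (𝓝 (∑ d, ∫ x, Real.negMulLog
      ((μ[(c ⁻¹' {d}).indicator (1 : Ω → ℝ) | future T c]) x) ∂μ)) := by
    refine tendsto_finsetSum _ fun d _ => ?_
    have hA : MeasurableSet (c ⁻¹' {d}) := hc (.of_discrete)
    refine tendsto_integral_of_dominated_convergence (fun _ => 1) (fun n => ?_)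
      (integrable_const _) (fun n => ?_) ?_
    · exact Real.continuous_negMulLog.comp_aestronglyMeasurable
        integrable_condExp.aestronglyMeasurable
    · obtain ⟨P, -, h0, h1, hP, -⟩ := exists_condProb (μ := μ) (ℱ.le n) hA
      filter_upwards [hP] with x hx
      rw [← hx, Real.norm_eq_abs, abs_of_nonneg (Real.negMulLog_nonneg (h0 x) (h1 x))]
      exact negMulLog_le_one (h0 x)
    · filter_upwards [tendsto_ae_condExp (μ := μ) (ℱ := ℱ) ((c ⁻¹' {d}).indicator (1 : Ω → ℝ))]
        with x hx
      exact (Real.continuous_negMulLog.tendsto _).comp hx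
  have hstep : ∀ n, ent μ (blockCode T c (n + 1)) - ent μ (blockCode T c n) ≤ u n := by
    intro n
    have h1 := sum_integral_negMulLog_condExp_comap (μ := μ) hc (measurable_blockCode_comp hT hc n)
    have h2 : ent μ (fun x => blockCode T c n (T x)) = ent μ (blockCode T c n) := by
      conv_rhs => rw [← hμ]
      rw [ent_map μ hT fun y => measurable_blockCode hT hc n (.of_discrete)]
      rfl
    have h3 := ent_blockCode_succ_le (μ := μ) hT hc n
    rw [h2] at h1
    have h4 : u n = _ := h1
    rw [h4]
    linarith
  have hsum : ∀ n : ℕ, ent μ (blockCode T c n) - ent μ (blockCode T c 0)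
      ≤ ∑ i ∈ Finset.range n, u i := by
    intro n
    rw [← Finset.sum_range_sub (fun n => ent μ (blockCode T c n))]
    exact Finset.sum_le_sum fun i _ => hstep i
  have h1 : Tendsto (fun n : ℕ => ent μ (blockCode T c n) / n - ent μ (blockCode T c 0) / n)
      atTop (𝓝 (entRate μ T c - 0)) :=
    (tendsto_entRate hT hμ hc).sub (tendsto_const_div_atTop_nhds_zero_nat _)
  rw [sub_zero] at h1
  refine le_of_tendsto_of_tendsto' h1 hlim.cesaro fun n => ?_
  rw [← sub_div, inv_mul_eq_div]
  exact div_le_div_of_nonneg_right (hsum n) (Nat.cast_nonneg n)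

/-- Versions of the conditional probabilities of the values of a code given its future. -/
lemma exists_condProb_future (hT : Measurable T) (hμ : μ.map T = μ) (hc : Measurable c) :
    ∃ P : κ → Ω → ℝ, (∀ d, Measurable[future T c] (P d)) ∧ (∀ d x, 0 ≤ P d x) ∧
      (∀ d x, P d x ≤ 1) ∧ entRate μ T c ≤ ∑ d, ∫ x, Real.negMulLog (P d x) ∂μ ∧
      ∀ (d : κ) (h : Ω → ℝ) (C : ℝ), Measurable[future T c] h → (∀ x, |h x| ≤ C) →
        ∫ x, (c ⁻¹' {d}).indicator (1 : Ω → ℝ) x * h x ∂μ = ∫ x, P d x * h x ∂μ := by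
  choose P h1 h2 h3 h4 h5 using fun d =>
    exists_condProb (μ := μ) (future_le hT hc) (A := c ⁻¹' {d}) (hc (.of_discrete))
  refine ⟨P, h1, h2, h3, ?_, h5⟩
  refine (entRate_le_integral_condExp hT hμ hc).trans_eq ?_
  exact Finset.sum_congr rfl fun d _ => integral_congr_ae ((h4 d).symm.fun_comp Real.negMulLog)

/-- Truncation of the conditional probabilities does not lose much entropy. -/
lemma exists_truncation {P : κ → Ω → ℝ} (hP : ∀ d, Measurable (P d)) (h0 : ∀ d x, 0 ≤ P d x)
    (h1 : ∀ d x, P d x ≤ 1) {δ : ℝ} (hδ : 0 < δ) :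
    ∃ η₀ > 0, ∀ η, 0 < η → η ≤ η₀ → ∑ d, ∫ x, Real.negMulLog (P d x) ∂μ - δ ≤
      ∑ d, ∫ x, P d x * -Real.log (max (P d x) η) ∂μ := by
  have hpt : ∀ p η : ℝ, 0 ≤ p → p ≤ 1 → 0 < η → η ≤ 1 →
      Real.negMulLog p - η ≤ p * -Real.log (max p η) := by
    intro p η hp hp1 hη hη1
    rcases le_total η p with h | h
    · rw [max_eq_left h, Real.negMulLog]
      linarith
    · rw [max_eq_right h]
      have := neg_mul_log_le hp hη.le fun h => absurd h hη.ne'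
      linarith
  have hN : (0 : ℝ) < Fintype.card κ + 1 := by positivity
  refine ⟨min 1 (δ / (Fintype.card κ + 1)), lt_min one_pos (by positivity), fun η hη hη' => ?_⟩
  have hη1 : η ≤ 1 := hη'.trans (min_le_left _ _)
  have hη2 : η * (Fintype.card κ + 1) ≤ δ := (le_div_iff₀ hN).1 (hη'.trans (min_le_right _ _))
  have hint : ∀ d, ∫ x, Real.negMulLog (P d x) ∂μ - η
      ≤ ∫ x, P d x * -Real.log (max (P d x) η) ∂μ := by
    intro d
    have hi : Integrable (fun x => Real.negMulLog (P d x)) μ := by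
      refine integrable_of_abs_le (Real.continuous_negMulLog.measurable.comp (hP d)) (B := 1)
        fun x => ?_
      rw [abs_of_nonneg (Real.negMulLog_nonneg (h0 d x) (h1 d x))]
      exact negMulLog_le_one (h0 d x)
    have hi' : Integrable (fun x => P d x * -Real.log (max (P d x) η)) μ := by
      refine integrable_of_abs_le ((hP d).mul
        (Real.measurable_log.comp ((hP d).max measurable_const)).neg) (B := -Real.log η) fun x => ?_
      have hm : η ≤ max (P d x) η := le_max_right _ _
      have hl1 : Real.log η ≤ Real.log (max (P d x) η) := Real.log_le_log hη hm
      have hl2 : Real.log (max (P d x) η) ≤ 0 :=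
        Real.log_nonpos (hη.le.trans hm) (max_le (h1 d x) hη1)
      rw [abs_of_nonneg (mul_nonneg (h0 d x) (by linarith))]
      calc P d x * -Real.log (max (P d x) η) ≤ 1 * -Real.log (max (P d x) η) := by
            gcongr
            · linarith
            · exact h1 d x
        _ ≤ _ := by linarith
    have : ∫ x, Real.negMulLog (P d x) ∂μ - η = ∫ x, (Real.negMulLog (P d x) - η) ∂μ := by
      rw [integral_sub hi (integrable_const _)]; simp
    rw [this]
    exact integral_mono (hi.sub (integrable_const _)) hi' fun x =>
      hpt _ _ (h0 d x) (h1 d x) hη hη1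
  have := Finset.sum_le_sum fun d (_ : d ∈ Finset.univ) => hint d
  rw [Finset.sum_sub_distrib, Finset.sum_const, Finset.card_univ, nsmul_eq_mul] at this
  nlinarith

end Future

section Information

variable {Ω κ ι : Type*} [mΩ : MeasurableSpace Ω] {μ : Measure Ω} [IsProbabilityMeasure μ]
  [Fintype κ] [MeasurableSpace κ] [DiscreteMeasurableSpace κ] [Preorder ι] {T : Ω → Ω}
  {α : ι → Ω → κ} {P : ι → κ → Ω → ℝ} {η : ℝ}

lemma measurable_code_iterate_future (hα : ∀ i j, i ≤ j → ∃ φ : κ → κ, α j = φ ∘ α i) {i j : ι}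
    (hij : i ≤ j) (m : ℕ) : Measurable[future T (α i)] fun x => α j (T^[m + 1] x) := by
  obtain ⟨φ, hφ⟩ := hα i j hij
  rw [hφ]
  exact (measurable_of_countable φ).comp (measurable_future m)

lemma measurable_iterate_future (hα : ∀ i j, i ≤ j → ∃ φ : κ → κ, α j = φ ∘ α i) {i j : ι}
    (hij : i ≤ j) (m : ℕ) : Measurable[future T (α i), future T (α j)] T^[m] :=
  measurable_to_future fun l => by
    have := measurable_code_iterate_future (T := T) hα hij (l + m)
    convert this using 3 with x
    rw [← Function.iterate_add_apply]
    congr 1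
    omega

/-- The indicator of `α i = c` divided by `max (P i c) η`. -/
noncomputable def infoWeight (α : ι → Ω → κ) (P : ι → κ → Ω → ℝ) (η : ℝ) (i : ι) (c : κ)
    (x : Ω) : ℝ :=
  (α i ⁻¹' {c}).indicator 1 x * (max (P i c x) η)⁻¹

lemma infoWeight_nonneg (hη : 0 < η) (i : ι) (c : κ) (x : Ω) : 0 ≤ infoWeight α P η i c x :=
  mul_nonneg (indicator_nonneg (fun _ _ => zero_le_one) x)
    (inv_nonneg.2 (hη.le.trans (le_max_right _ _)))

lemma inv_max_le (hη : 0 < η) (p : ℝ) : (max p η)⁻¹ ≤ η⁻¹ :=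
  inv_anti₀ hη (le_max_right _ _)

lemma infoWeight_le (hη : 0 < η) (i : ι) (c : κ) (x : Ω) : infoWeight α P η i c x ≤ η⁻¹ := by
  have h1 : (α i ⁻¹' {c}).indicator (1 : Ω → ℝ) x ≤ 1 :=
    indicator_le_self' (f := (1 : Ω → ℝ)) (fun _ _ => zero_le_one) x
  calc infoWeight α P η i c x ≤ 1 * η⁻¹ :=
        mul_le_mul h1 (inv_max_le hη _) (inv_nonneg.2 (hη.le.trans (le_max_right _ _))) zero_le_one
    _ = η⁻¹ := one_mul _

lemma measurable_infoWeight_iterate (hα : ∀ i j, i ≤ j → ∃ φ : κ → κ, α j = φ ∘ α i)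
    (hP : ∀ i c, Measurable[future T (α i)] (P i c)) {i j : ι} (hij : i ≤ j) (c : κ) (m : ℕ) :
    Measurable[future T (α i)] fun x => infoWeight α P η j c (T^[m + 1] x) := by
  have h1 : Measurable[future T (α i)] fun x => P j c (T^[m + 1] x) :=
    (hP j c).comp (measurable_iterate_future hα hij (m + 1))
  have h2 : Measurable[future T (α i)] fun x =>
      (α j ⁻¹' {c}).indicator (1 : Ω → ℝ) (T^[m + 1] x) :=
    (measurable_of_countable (fun d : κ => ({c} : Set κ).indicator (1 : κ → ℝ) d)).comp
      (measurable_code_iterate_future (T := T) hα hij m)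
  exact h2.mul (h1.max measurable_const).inv

lemma integral_prod_infoWeight_le (hT : Measurable T) (hμ : μ.map T = μ)
    (hαm : ∀ i, Measurable (α i)) (hα : ∀ i j, i ≤ j → ∃ φ : κ → κ, α j = φ ∘ α i)
    (hP : ∀ i c, Measurable[future T (α i)] (P i c)) (hP0 : ∀ i c x, 0 ≤ P i c x) (hη : 0 < η)
    (hPint : ∀ (i : ι) (c : κ) (h : Ω → ℝ) (C : ℝ), Measurable[future T (α i)] h →
      (∀ x, |h x| ≤ C) → ∫ x, (α i ⁻¹' {c}).indicator (1 : Ω → ℝ) x * h x ∂μ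
        = ∫ x, P i c x * h x ∂μ)
    (t : ℕ) {lev : ℕ → ι} (hlev : Monotone lev) (d : ℕ → κ) :
    ∫ x, ∏ m ∈ Finset.range t, infoWeight α P η (lev m) (d m) (T^[m] x) ∂μ ≤ 1 := by
  induction t generalizing lev d with
  | zero => simp
  | succ t ih =>
    set Ψ : Ω → ℝ := fun x =>
      ∏ m ∈ Finset.range t, infoWeight α P η (lev (m + 1)) (d (m + 1)) (T^[m] x) with hΨ
    have hΨ0 : ∀ x, 0 ≤ Ψ x := fun x => Finset.prod_nonneg fun m _ => infoWeight_nonneg hη _ _ _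
    have hΨ1 : ∀ x, Ψ x ≤ η⁻¹ ^ t := fun x => by
      refine (Finset.prod_le_prod (fun m _ => infoWeight_nonneg hη _ _ _)
        fun m _ => infoWeight_le hη _ _ _).trans_eq ?_
      simp
    have hle := future_le hT (hαm (lev 0))
    have hΨT : Measurable[future T (α (lev 0))] fun x => Ψ (T x) := by
      have : ∀ m ∈ Finset.range t, Measurable[future T (α (lev 0))] fun x =>
          infoWeight α P η (lev (m + 1)) (d (m + 1)) (T^[m] (T x)) := fun m _ =>
        measurable_infoWeight_iterate hα hP (hlev (Nat.zero_le _)) _ m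
      exact Finset.measurable_fun_prod _ this
    have hq : Measurable[future T (α (lev 0))] fun x => (max (P (lev 0) (d 0) x) η)⁻¹ :=
      ((hP _ _).max measurable_const).inv
    have hq0 : ∀ x, 0 ≤ (max (P (lev 0) (d 0) x) η)⁻¹ := fun x =>
      inv_nonneg.2 (hη.le.trans (le_max_right _ _))
    have hb0 : ∀ x, 0 ≤ (max (P (lev 0) (d 0) x) η)⁻¹ * Ψ (T x) := fun x =>
      mul_nonneg (hq0 x) (hΨ0 _)
    have hb : ∀ x, |(max (P (lev 0) (d 0) x) η)⁻¹ * Ψ (T x)| ≤ η⁻¹ * η⁻¹ ^ t := fun x => by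
      rw [abs_of_nonneg (hb0 x)]
      exact mul_le_mul (inv_max_le hη _) (hΨ1 _) (hΨ0 _) (by positivity)
    have hΨm : Measurable Ψ := by
      refine Finset.measurable_fun_prod _ fun m _ => ?_
      have h1 : Measurable (infoWeight α P η (lev (m + 1)) (d (m + 1))) :=
        (measurable_one.indicator (hαm _ (.of_discrete))).mul
          ((((hP _ _).mono (future_le hT (hαm _)) le_rfl).max measurable_const).inv)
      exact h1.comp (hT.iterate m)
    have hPm : Measurable (P (lev 0) (d 0)) := (hP _ _).mono hle le_rfl
    calc ∫ x, ∏ m ∈ Finset.range (t + 1), infoWeight α P η (lev m) (d m) (T^[m] x) ∂μ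
        = ∫ x, (α (lev 0) ⁻¹' {d 0}).indicator (1 : Ω → ℝ) x
            * ((max (P (lev 0) (d 0) x) η)⁻¹ * Ψ (T x)) ∂μ := by
          congr 1
          funext x
          rw [Finset.prod_range_succ', mul_comm]
          simp only [infoWeight, hΨ, Function.iterate_succ_apply, Function.iterate_zero, id]
          ring
      _ = ∫ x, P (lev 0) (d 0) x * ((max (P (lev 0) (d 0) x) η)⁻¹ * Ψ (T x)) ∂μ :=
          hPint _ _ _ _ (hq.mul hΨT) hb
      _ ≤ ∫ x, Ψ (T x) ∂μ := by
          refine integral_mono_of_nonneg (.of_forall fun x => mul_nonneg (hP0 _ _ _) (hb0 x))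
            (integrable_of_abs_le (hΨm.comp hT) (B := η⁻¹ ^ t) fun x => ?_) (.of_forall fun x => ?_)
          · rw [abs_of_nonneg (hΨ0 _)]
            exact hΨ1 _
          · have h1 : P (lev 0) (d 0) x * (max (P (lev 0) (d 0) x) η)⁻¹ ≤ 1 := by
              have hm : 0 < max (P (lev 0) (d 0) x) η := hη.trans_le (le_max_right _ _)
              rw [← div_eq_mul_inv, div_le_one hm]
              exact le_max_left _ _
            beta_reduce
            rw [← mul_assoc]
            exact mul_le_of_le_one_left (hΨ0 _) h1
      _ = ∫ x, Ψ x ∂μ := integral_comp_of_map_eq hT hμ hΨm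
      _ ≤ 1 := ih (lev := fun m => lev (m + 1)) (fun m n h => hlev (by omega)) fun m => d (m + 1)

/-- The name of the orbit segment of `x` of length `t`, read with the codes `α (lev m)`. -/
def levelName (T : Ω → Ω) (α : ι → Ω → κ) (lev : ℕ → ι) (t : ℕ) (x : Ω) : Fin t → κ :=
  fun m => α (lev m) (T^[m] x)

lemma measurable_levelName (hT : Measurable T) (hαm : ∀ i, Measurable (α i)) (lev : ℕ → ι)
    (t : ℕ) : Measurable (levelName T α lev t) :=
  measurable_pi_lambda _ fun m => (hαm _).comp (hT.iterate m)

/-- The truncated information function. -/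
noncomputable def info (α : ι → Ω → κ) (P : ι → κ → Ω → ℝ) (η : ℝ) (i : ι) (x : Ω) : ℝ :=
  -Real.log (max (P i (α i x) x) η)

lemma info_eq_sum (i : ι) (x : Ω) : info α P η i x
    = ∑ c, (α i ⁻¹' {c}).indicator (1 : Ω → ℝ) x * -Real.log (max (P i c x) η) := by
  classical
  simp [info, indicator_apply]

lemma exp_info (hη : 0 < η) (i : ι) (x : Ω) :
    Real.exp (info α P η i x) = infoWeight α P η i (α i x) x := by
  have hm : 0 < max (P i (α i x) x) η := hη.trans_le (le_max_right _ _)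
  rw [info, Real.exp_neg, Real.exp_log hm, infoWeight]
  simp

theorem integral_name_mul_exp_le (hT : Measurable T) (hμ : μ.map T = μ)
    (hαm : ∀ i, Measurable (α i)) (hα : ∀ i j, i ≤ j → ∃ φ : κ → κ, α j = φ ∘ α i)
    (hP : ∀ i c, Measurable[future T (α i)] (P i c)) (hP0 : ∀ i c x, 0 ≤ P i c x) (hη : 0 < η)
    (hPint : ∀ (i : ι) (c : κ) (h : Ω → ℝ) (C : ℝ), Measurable[future T (α i)] h →
      (∀ x, |h x| ≤ C) → ∫ x, (α i ⁻¹' {c}).indicator (1 : Ω → ℝ) x * h x ∂μ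
        = ∫ x, P i c x * h x ∂μ)
    (t : ℕ) {lev : ℕ → ι} (hlev : Monotone lev) :
    ∫ x, μ.real (levelName T α lev t ⁻¹' {levelName T α lev t x})
      * Real.exp (∑ m ∈ Finset.range t, info α P η (lev m) (T^[m] x)) ∂μ ≤ 1 := by
  classical
  have hN := measurable_levelName hT hαm lev t
  rcases isEmpty_or_nonempty κ with hκ | hκ
  · have : IsEmpty Ω := ⟨fun x => by
      rcases t with _ | t
      · exact hκ.false (α (lev 0) x)
      · exact hκ.false (α (lev 0) x)⟩
    simp [integral_of_isEmpty]
  let ext : (Fin t → κ) → ℕ → κ := fun d m => if h : m < t then d ⟨m, h⟩ else Classical.arbitrary κ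
  have hext : ∀ d m, (h : m < t) → ext d m = d ⟨m, h⟩ := fun d m h => dif_pos h
  set Φ : (Fin t → κ) → Ω → ℝ := fun d x =>
    ∏ m ∈ Finset.range t, infoWeight α P η (lev m) (ext d m) (T^[m] x) with hΦ
  have hΦm : ∀ d, Measurable (Φ d) := fun d => by
    refine Finset.measurable_fun_prod _ fun m _ => ?_
    have h1 : Measurable (infoWeight α P η (lev m) (ext d m)) :=
      (measurable_one.indicator (hαm _ (.of_discrete))).mul
        ((((hP _ _).mono (future_le hT (hαm _)) le_rfl).max measurable_const).inv)
    exact h1.comp (hT.iterate m)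
  have hΦ0 : ∀ d x, 0 ≤ Φ d x := fun d x =>
    Finset.prod_nonneg fun m _ => infoWeight_nonneg hη _ _ _
  have hΦ1 : ∀ d x, |Φ d x| ≤ η⁻¹ ^ t := fun d x => by
    rw [abs_of_nonneg (hΦ0 d x)]
    refine (Finset.prod_le_prod (fun m _ => infoWeight_nonneg hη _ _ _)
      fun m _ => infoWeight_le hη _ _ _).trans_eq ?_
    simp
  have hpt : ∀ x, μ.real (levelName T α lev t ⁻¹' {levelName T α lev t x})
      * Real.exp (∑ m ∈ Finset.range t, info α P η (lev m) (T^[m] x))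
      = ∑ d, μ.real (levelName T α lev t ⁻¹' {d}) * Φ d x := by
    intro x
    rw [Finset.sum_eq_single (levelName T α lev t x)]
    · congr 1
      rw [Real.exp_sum]
      refine Finset.prod_congr rfl fun m hm => ?_
      rw [exp_info hη, hext _ m (Finset.mem_range.1 hm)]
      rfl
    · intro d _ hd
      obtain ⟨m, hm⟩ := Function.ne_iff.1 hd
      have : Φ d x = 0 := by
        refine Finset.prod_eq_zero (Finset.mem_range.2 m.2) ?_
        rw [hext d m m.2, infoWeight, indicator_of_notMem, zero_mul]
        exact fun h => hm h.symm
      rw [this, mul_zero]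
    · simp
  calc _ = ∫ x, ∑ d, μ.real (levelName T α lev t ⁻¹' {d}) * Φ d x ∂μ :=
        integral_congr_ae (.of_forall hpt)
    _ = ∑ d, μ.real (levelName T α lev t ⁻¹' {d}) * ∫ x, Φ d x ∂μ := by
        rw [integral_finsetSum _ fun d _ => (integrable_of_abs_le (hΦm d) (hΦ1 d)).const_mul _]
        simp only [integral_const_mul]
    _ ≤ ∑ d, μ.real (levelName T α lev t ⁻¹' {d}) * 1 := by
        refine Finset.sum_le_sum fun d _ => mul_le_mul_of_nonneg_left ?_ measureReal_nonneg
        exact integral_prod_infoWeight_le hT hμ hαm hα hP hP0 hη hPint t hlev _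
    _ = 1 := by
        simp only [mul_one]
        exact sum_measureReal_preimage μ hN

/-- Bounded information functions adapted to a decreasing family of codes. -/
theorem exists_info [Finite ι] (hT : Measurable T) (hμ : μ.map T = μ)
    (hαm : ∀ i, Measurable (α i)) (hα : ∀ i j, i ≤ j → ∃ φ : κ → κ, α j = φ ∘ α i)
    {δ : ℝ} (hδ : 0 < δ) :
    ∃ (g : ι → Ω → ℝ) (B : ℝ), (∀ i, Measurable (g i)) ∧ (∀ i x, |g i x| ≤ B) ∧
      (∀ i, entRate μ T (α i) - δ ≤ ∫ x, g i x ∂μ) ∧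
      ∀ (t : ℕ) (lev : ℕ → ι), Monotone lev →
        ∫ x, μ.real (levelName T α lev t ⁻¹' {levelName T α lev t x})
          * Real.exp (∑ m ∈ Finset.range t, g (lev m) (T^[m] x)) ∂μ ≤ 1 := by
  choose P hP hP0 hP1 hent hPint using fun i => exists_condProb_future hT hμ (hαm i)
  have hPm : ∀ i c, Measurable (P i c) := fun i c => (hP i c).mono (future_le hT (hαm i)) le_rfl
  choose η₀ hη₀ htr using fun i => exists_truncation (μ := μ) (hPm i) (hP0 i) (hP1 i) hδ
  obtain ⟨η, hη, hη1, hηle⟩ : ∃ η : ℝ, 0 < η ∧ η ≤ 1 ∧ ∀ i, η ≤ η₀ i := by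
    have := Fintype.ofFinite ι
    rcases isEmpty_or_nonempty ι with h | h
    · exact ⟨1, one_pos, le_rfl, fun i => h.elim i⟩
    · refine ⟨min 1 (Finset.univ.inf' Finset.univ_nonempty η₀),
        lt_min one_pos ((Finset.lt_inf'_iff _).2 fun i _ => hη₀ i), min_le_left _ _,
        fun i => (min_le_right _ _).trans (Finset.inf'_le _ (Finset.mem_univ i))⟩
  have hbd : ∀ i c x, |-Real.log (max (P i c x) η)| ≤ -Real.log η := fun i c x => by
    have hm : η ≤ max (P i c x) η := le_max_right _ _
    have hl1 : Real.log η ≤ Real.log (max (P i c x) η) := Real.log_le_log hη hm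
    have hl2 : Real.log (max (P i c x) η) ≤ 0 :=
      Real.log_nonpos (hη.le.trans hm) (max_le (hP1 i c x) hη1)
    rw [abs_of_nonneg (by linarith)]
    linarith
  have hlogm : ∀ i c, Measurable[future T (α i)] fun x => -Real.log (max (P i c x) η) :=
    fun i c => (Real.measurable_log.comp ((hP i c).max measurable_const)).neg
  have hterm : ∀ i c, Measurable fun x =>
      (α i ⁻¹' {c}).indicator (1 : Ω → ℝ) x * -Real.log (max (P i c x) η) := fun i c =>
    (measurable_one.indicator (hαm i (.of_discrete))).mul
      ((hlogm i c).mono (future_le hT (hαm i)) le_rfl)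
  have hterm_bd : ∀ i c x,
      |(α i ⁻¹' {c}).indicator (1 : Ω → ℝ) x * -Real.log (max (P i c x) η)| ≤ -Real.log η := by
    intro i c x
    by_cases hx : x ∈ α i ⁻¹' {c}
    · rw [indicator_of_mem hx, Pi.one_apply, one_mul]
      exact hbd i c x
    · rw [indicator_of_notMem hx, zero_mul, abs_zero]
      exact (abs_nonneg _).trans (hbd i c x)
  refine ⟨info α P η, -Real.log η, fun i => ?_, fun i x => hbd i _ x, fun i => ?_,
    fun t lev hlev => integral_name_mul_exp_le hT hμ hαm hα hP hP0 hη hPint t hlev⟩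
  · rw [funext (info_eq_sum i)]
    exact Finset.measurable_sum _ fun c _ => hterm i c
  · calc entRate μ T (α i) - δ ≤ ∑ c, ∫ x, Real.negMulLog (P i c x) ∂μ - δ := by
          linarith [hent i]
      _ ≤ ∑ c, ∫ x, P i c x * -Real.log (max (P i c x) η) ∂μ := htr i η hη (hηle i)
      _ = ∑ c, ∫ x, (α i ⁻¹' {c}).indicator (1 : Ω → ℝ) x * -Real.log (max (P i c x) η) ∂μ :=
          Finset.sum_congr rfl fun c _ => (hPint i c _ _ (hlogm i c) (hbd i c)).symm
      _ = ∫ x, info α P η i x ∂μ := by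
          rw [funext (info_eq_sum i), integral_finsetSum _ fun c _ =>
            integrable_of_abs_le (hterm i c) (hterm_bd i c)]

end Information

section Counting

lemma exists_pos_forall_le {ι : Type*} [Finite ι] {r : ι → ℝ} (hr : ∀ i, 0 < r i) :
    ∃ η : ℝ, 0 < η ∧ ∀ i, η ≤ r i := by
  have := Fintype.ofFinite ι
  rcases isEmpty_or_nonempty ι with h | h
  · exact ⟨1, one_pos, fun i => h.elim i⟩
  · exact ⟨Finset.univ.inf' Finset.univ_nonempty r, (Finset.lt_inf'_iff _).2 fun i _ => hr i,
      fun i => Finset.inf'_le _ (Finset.mem_univ i)⟩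

lemma sum_pow_hammingDist_le {κ : Type*} [Fintype κ] [DecidableEq κ] {lam : ℝ} (h0 : 0 ≤ lam)
    (t : ℕ) (s : Fin t → κ) :
    ∑ w : Fin t → κ, lam ^ hammingDist w s ≤ (1 + Fintype.card κ * lam) ^ t := by
  have h1 : ∀ w : Fin t → κ, lam ^ hammingDist w s = ∏ m, if w m = s m then 1 else lam := by
    intro w
    rw [Finset.prod_ite, Finset.prod_const_one, one_mul, Finset.prod_const]
    rfl
  simp_rw [h1]
  rw [← Fintype.piFinset_univ, Finset.sum_prod_piFinset Finset.univ
    (fun m c => if c = s m then (1 : ℝ) else lam)]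
  calc ∏ m, ∑ c, (if c = s m then (1 : ℝ) else lam)
      ≤ ∏ _m : Fin t, (1 + Fintype.card κ * lam) := by
        refine Finset.prod_le_prod (fun m _ => Finset.sum_nonneg fun c _ =>
          by split_ifs <;> simp [h0])
          fun m _ => ?_
        calc ∑ c, (if c = s m then (1 : ℝ) else lam)
            ≤ ∑ c, ((if c = s m then (1 : ℝ) else 0) + lam) := by
              refine Finset.sum_le_sum fun c _ => ?_
              split_ifs <;> linarith
          _ = 1 + Fintype.card κ * lam := by
              rw [Finset.sum_add_distrib]
              simp
    _ = _ := by simp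

lemma measure_le_of_agree {Ω κ : Type*} [MeasurableSpace Ω] {μ : Measure Ω} [IsFiniteMeasure μ]
    [Fintype κ] {t : ℕ} {Y : Ω → Fin t → κ} {B : Set Ω} {bad : Ω → Finset (Fin t)} {C lam : ℝ}
    (hC : 0 ≤ C) (h0 : 0 ≤ lam) (h1 : lam ≤ 1)
    (hY : ∀ x ∈ B, ∀ y ∈ B, ∀ m, m ∉ bad x → m ∉ bad y → Y x m = Y y m)
    (hB : ∀ x ∈ B, μ.real (Y ⁻¹' {Y x}) ≤ C * lam ^ (bad x).card) :
    μ B ≤ ENNReal.ofReal (C * (1 + Fintype.card κ * lam) ^ t) := by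
  classical
  rcases B.eq_empty_or_nonempty with rfl | ⟨x₀, hx₀⟩
  · simp
  have hs : ∀ m, ∃ c : κ, ∀ x ∈ B, m ∉ bad x → Y x m = c := by
    intro m
    by_cases h : ∃ y ∈ B, m ∉ bad y
    · obtain ⟨y, hy, hym⟩ := h
      exact ⟨Y y m, fun x hx hxm => hY x hx y hy m hxm hym⟩
    · push Not at h
      exact ⟨Y x₀ m, fun x hx hxm => absurd (h x hx) hxm⟩
  choose s hs using hs
  have hdist : ∀ x ∈ B, hammingDist (Y x) s ≤ (bad x).card := by
    intro x hx
    refine Finset.card_le_card fun m hm => ?_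
    by_contra hbad
    exact (Finset.mem_filter.1 hm).2 (hs m x hx hbad)
  have hfib : ∀ w ∈ Y '' B, μ (Y ⁻¹' {w}) ≤ ENNReal.ofReal (C * lam ^ hammingDist w s) := by
    rintro _ ⟨x, hx, rfl⟩
    rw [← ENNReal.ofReal_toReal (measure_ne_top μ (Y ⁻¹' {Y x}))]
    refine ENNReal.ofReal_le_ofReal ((hB x hx).trans ?_)
    exact mul_le_mul_of_nonneg_left (pow_le_pow_of_le_one h0 h1 (hdist x hx)) hC
  set W : Finset (Fin t → κ) := Finset.univ.filter (· ∈ Y '' B) with hW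
  have hcov : B ⊆ ⋃ w ∈ W, Y ⁻¹' {w} := fun x hx => by
    simp only [mem_iUnion]
    exact ⟨Y x, by simpa [hW] using ⟨x, hx, rfl⟩, rfl⟩
  calc μ B ≤ μ (⋃ w ∈ W, Y ⁻¹' {w}) := measure_mono hcov
    _ ≤ ∑ w ∈ W, μ (Y ⁻¹' {w}) := measure_biUnion_finset_le _ _
    _ ≤ ∑ w ∈ W, ENNReal.ofReal (C * lam ^ hammingDist w s) :=
        Finset.sum_le_sum fun w hw => hfib w (by simpa [hW] using hw)
    _ ≤ ∑ w, ENNReal.ofReal (C * lam ^ hammingDist w s) :=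
        Finset.sum_le_sum_of_subset (Finset.subset_univ _)
    _ = ENNReal.ofReal (∑ w, C * lam ^ hammingDist w s) :=
        (ENNReal.ofReal_sum_of_nonneg fun w _ => mul_nonneg hC (pow_nonneg h0 _)).symm
    _ ≤ _ := by
        rw [← Finset.mul_sum]
        exact ENNReal.ofReal_le_ofReal
          (mul_le_mul_of_nonneg_left (sum_pow_hammingDist_le h0 t s) hC)

lemma exists_small_bad_set {Y κ : Type*} [MetricSpace Y] [CompactSpace Y] [MeasurableSpace Y]
    [BorelSpace Y] (ν : Measure Y) [IsFiniteMeasure ν] [Fintype κ] [MeasurableSpace κ]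
    [DiscreteMeasurableSpace κ] {c : Y → κ} (hc : Measurable c) {η : ℝ≥0∞} (hη : η ≠ 0) :
    ∃ V : Set Y, MeasurableSet V ∧ ν V ≤ η ∧
      ∃ ε : ℝ, 0 < ε ∧ ∀ x ∉ V, ∀ y ∉ V, dist x y < ε → c x = c y := by
  classical
  obtain ⟨η', hη', hsum⟩ := ENNReal.exists_pos_sum_of_countable' hη κ
  have hK : ∀ d, ∃ K ⊆ c ⁻¹' {d}, IsClosed K ∧ ν (c ⁻¹' {d} \ K) < η' d := fun d =>
    (hc (MeasurableSet.of_discrete (s := {d}))).exists_isClosed_sdiff_lt (measure_ne_top _ _)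
      (hη' d).ne'
  choose K hKc hKcl hKν using hK
  refine ⟨⋃ d, c ⁻¹' {d} \ K d, MeasurableSet.iUnion fun d =>
    (hc (MeasurableSet.of_discrete (s := {d}))).diff (hKcl d).measurableSet, ?_, ?_⟩
  · calc ν (⋃ d, c ⁻¹' {d} \ K d) ≤ ∑' d, ν (c ⁻¹' {d} \ K d) := measure_iUnion_le _
      _ ≤ ∑' d, η' d := ENNReal.tsum_le_tsum fun d => (hKν d).le
      _ ≤ η := hsum.le
  · have hsep : ∀ p : κ × κ, ∃ ε : ℝ, 0 < ε ∧
        (p.1 ≠ p.2 → ∀ x ∈ K p.1, ∀ y ∈ K p.2, ε ≤ dist x y) := by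
      rintro ⟨d, e⟩
      by_cases hde : d = e
      · exact ⟨1, one_pos, fun h => absurd hde h⟩
      · have hdisj : Disjoint (K d) (K e) := by
          refine Disjoint.mono (hKc d) (hKc e) ?_
          exact Disjoint.preimage _ (by simpa using hde)
        obtain ⟨ε, hε, hd⟩ := hdisj.exists_thickenings (hKcl d).isCompact (hKcl e)
        refine ⟨ε, hε, fun _ x hx y hy => ?_⟩
        by_contra hlt
        push Not at hlt
        refine Set.disjoint_left.1 hd (?_ : y ∈ _) (Metric.self_subset_thickening hε _ hy)
        exact Metric.mem_thickening_iff.2 ⟨x, hx, by rwa [dist_comm]⟩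
    choose ε hε hsep using hsep
    have hmem : ∀ x, x ∉ ⋃ d, c ⁻¹' {d} \ K d → x ∈ K (c x) := fun x hx => by
      by_contra h
      exact hx (mem_iUnion.2 ⟨c x, rfl, h⟩)
    obtain ⟨ε₀, hε₀, hle⟩ := exists_pos_forall_le hε
    refine ⟨ε₀, hε₀, fun x hx y hy hxy => ?_⟩
    by_contra hne
    exact absurd (hxy.trans_le (hle (c x, c y)))
      (not_lt.2 (hsep (c x, c y) hne x (hmem x hx) y (hmem y hy)))

end Counting

section Levels

variable [NeZero k] {a : Fin k → ℝ}

lemma cw_mono (ha : ∀ i, 0 ≤ a i) : Monotone (cw a) := fun _ _ hij =>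
  Finset.sum_le_sum_of_subset_of_nonneg (Finset.Iic_subset_Iic.2 hij) fun l _ _ => ha l

lemma ceil_cw_mono (ha : ∀ i, 0 ≤ a i) (n : ℕ) : Monotone fun i => ⌈cw a i * (n : ℝ)⌉₊ :=
  fun _ _ hij => Nat.ceil_le_ceil (mul_le_mul_of_nonneg_right (cw_mono ha hij) n.cast_nonneg)

/-- The least level at which the time `m` is constrained in the weighted Bowen ball. -/
noncomputable def levelOf (a : Fin k → ℝ) (n m : ℕ) : Fin k :=
  if h : (Finset.univ.filter fun j : Fin k => m < ⌈cw a j * (n : ℝ)⌉₊).Nonempty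
    then Finset.min' _ h else ⊤

lemma levelOf_le {n m : ℕ} {j : Fin k} (hm : m < ⌈cw a j * (n : ℝ)⌉₊) : levelOf a n m ≤ j := by
  have hj : j ∈ Finset.univ.filter fun j : Fin k => m < ⌈cw a j * (n : ℝ)⌉₊ := by simpa using hm
  rw [levelOf, dif_pos ⟨j, hj⟩]
  exact Finset.min'_le _ _ hj

lemma lt_of_levelOf {n m : ℕ} (hm : m < ⌈cw a (⊤ : Fin k) * (n : ℝ)⌉₊) :
    m < ⌈cw a (levelOf a n m) * (n : ℝ)⌉₊ := by
  have hne : (Finset.univ.filter fun j : Fin k => m < ⌈cw a j * (n : ℝ)⌉₊).Nonempty :=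
    ⟨⊤, by simpa using hm⟩
  rw [levelOf, dif_pos hne]
  simpa using Finset.min'_mem _ hne

lemma monotone_levelOf (n : ℕ) : Monotone (levelOf a n) := by
  intro m m' hmm'
  by_cases h : (Finset.univ.filter fun j : Fin k => m' < ⌈cw a j * (n : ℝ)⌉₊).Nonempty
  · refine levelOf_le (hmm'.trans_lt ?_)
    rw [levelOf, dif_pos h]
    simpa using Finset.min'_mem _ h
  · nth_rewrite 2 [levelOf]
    rw [dif_neg h]
    exact le_top

lemma levelOf_of_mem (ha : ∀ i, 0 ≤ a i) {n m : ℕ} {i : Fin k} (hm : m ∈ levelTimes a n i) :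
    levelOf a n m = i := by
  rw [levelTimes, Finset.mem_Ico] at hm
  refine le_antisymm (levelOf_le hm.2) ?_
  by_contra! hlt
  have h1 : m < ⌈cw a (⊤ : Fin k) * (n : ℝ)⌉₊ := hm.2.trans_le (ceil_cw_mono ha n le_top)
  have h2 := lt_of_levelOf h1
  have h3 : cw a (levelOf a n m) ≤ cw a i - a i := by
    have : cw a i = a i + ∑ j ∈ Finset.Iio i, a j := by
      rw [cw, ← Finset.Iio_insert, Finset.sum_insert (by simp)]
    rw [this, add_sub_cancel_left]
    exact Finset.sum_le_sum_of_subset_of_nonneg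
      (fun j hj => Finset.mem_Iio.2 ((Finset.mem_Iic.1 hj).trans_lt hlt)) fun l _ _ => ha l
  have h4 : ⌈cw a (levelOf a n m) * (n : ℝ)⌉₊ ≤ ⌈(cw a i - a i) * (n : ℝ)⌉₊ :=
    Nat.ceil_le_ceil (mul_le_mul_of_nonneg_right h3 n.cast_nonneg)
  omega

lemma sum_levelOf (ha : ∀ i, 0 ≤ a i) (n : ℕ) (b : Fin k → ℕ → ℝ) :
    ∑ m ∈ Finset.range ⌈cw a (⊤ : Fin k) * (n : ℝ)⌉₊, b (levelOf a n m) m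
      = ∑ i, ∑ m ∈ levelTimes a n i, b i m := by
  rw [← Finset.sum_fiberwise (s := Finset.range _) (g := levelOf a n)]
  refine Finset.sum_congr rfl fun i _ => ?_
  have : (Finset.range ⌈cw a (⊤ : Fin k) * (n : ℝ)⌉₊).filter (fun m => levelOf a n m = i)
      = levelTimes a n i := by
    ext m
    rw [Finset.mem_filter, Finset.mem_range]
    constructor
    · rintro ⟨hm, rfl⟩
      obtain ⟨j, -, hj⟩ := exists_level n _ (lt_of_levelOf hm)
      rwa [← levelOf_of_mem ha hj] at hj
    · intro hm
      exact ⟨((Finset.mem_Ico.1 hm).2).trans_le (ceil_cw_mono ha n le_top), levelOf_of_mem ha hm⟩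
  rw [← this]
  refine Finset.sum_congr rfl fun m hm => ?_
  rw [(Finset.mem_filter.1 hm).2]

lemma tendsto_birk_ceil {Ω : Type*} {T : Ω → Ω} {f : Ω → ℝ} {x : Ω} {l c : ℝ} (hc : 0 ≤ c)
    (h : Tendsto (fun n : ℕ => birk T f n x / n) atTop (𝓝 l)) :
    Tendsto (fun n : ℕ => birk T f ⌈c * (n : ℝ)⌉₊ x / n) atTop (𝓝 (c * l)) := by
  rcases hc.eq_or_lt with rfl | hc
  · simp [birk]
  have h1 : Tendsto (fun n : ℕ => ⌈c * (n : ℝ)⌉₊) atTop atTop :=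
    tendsto_nat_ceil_atTop.comp (tendsto_natCast_atTop_atTop.const_mul_atTop hc)
  have h2 : Tendsto (fun n : ℕ => (⌈c * (n : ℝ)⌉₊ : ℝ) / n) atTop (𝓝 c) :=
    (tendsto_nat_ceil_mul_div_atTop hc.le).comp tendsto_natCast_atTop_atTop
  refine (h2.mul (h.comp h1)).congr' ?_
  filter_upwards [h1.eventually_gt_atTop 0] with n hn
  have : (⌈c * (n : ℝ)⌉₊ : ℝ) ≠ 0 := by exact_mod_cast hn.ne'
  simp only [Function.comp]
  field_simp

end Levels

section LocalEntropy

variable {Ω κ : Type*} [MeasurableSpace Ω] {μ : Measure Ω} [IsProbabilityMeasure μ]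
  {T : Ω → Ω} {f : Ω → ℝ} {B : ℝ}

lemma ae_eventually_lt_exp {u : ℕ → Ω → ℝ} (hu : ∀ n, Measurable (u n)) (h0 : ∀ n x, 0 ≤ u n x)
    {C : ℝ} (hb : ∀ n x, u n x ≤ C ^ (n + 1)) (hint : ∀ n, ∫ x, u n x ∂μ ≤ 1) {δ : ℝ}
    (hδ : 0 < δ) : ∀ᵐ x ∂μ, ∀ᶠ n : ℕ in atTop, u n x < Real.exp (δ * n) := by
  have hmk : ∀ n : ℕ, μ {x | Real.exp (δ * n) ≤ u n x} ≤ ENNReal.ofReal (Real.exp (-δ) ^ n) := by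
    intro n
    have h := mul_meas_ge_le_integral_of_nonneg (μ := μ) (f := u n)
      (Eventually.of_forall (h0 n)) (integrable_of_abs_le (hu n) (B := C ^ (n + 1))
        fun x => by rw [abs_of_nonneg (h0 n x)]; exact hb n x) (Real.exp (δ * n))
    rw [← ENNReal.ofReal_toReal (measure_ne_top μ _)]
    refine ENNReal.ofReal_le_ofReal ?_
    have h2 := h.trans (hint n)
    rw [← Real.exp_nat_mul, show (n : ℝ) * -δ = -(δ * n) by ring, Real.exp_neg, ← one_div,
      le_div_iff₀' (Real.exp_pos _)]
    exact h2
  have hsum : ∑' n : ℕ, μ {x | Real.exp (δ * n) ≤ u n x} ≠ ∞ := by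
    refine ne_top_of_le_ne_top ?_ (ENNReal.tsum_le_tsum hmk)
    have hs : Summable fun n : ℕ => Real.exp (-δ) ^ n :=
      summable_geometric_of_lt_one (Real.exp_pos _).le (by simpa using hδ)
    rw [← ENNReal.ofReal_tsum_of_nonneg (fun n => by positivity) hs]
    exact ENNReal.ofReal_ne_top
  filter_upwards [ae_eventually_notMem hsum] with x hx
  filter_upwards [hx] with n hn
  simpa using hn

lemma exists_large_set [NeZero k] [Fintype κ] [MeasurableSpace κ] [DiscreteMeasurableSpace κ]
    {a : Fin k → ℝ} (ha1 : 0 < a 0) (ha : ∀ i, 0 ≤ a i) {α : Fin k → Ω → κ}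
    (hT : Measurable T) (hμ : μ.map T = μ) (hαm : ∀ i, Measurable (α i))
    (hα : ∀ i j, i ≤ j → ∃ φ : κ → κ, α j = φ ∘ α i) (hf : Measurable f) (hB : ∀ x, |f x| ≤ B)
    {U : Set Ω} (hU : MeasurableSet U) (Λ : ℝ) {δ : ℝ} (hδ : 0 < δ) :
    ∃ G : Set Ω, μ G ≠ 0 ∧ ∃ N : ℕ, ∀ n ≥ N, ∀ x ∈ G,
      μ.real (levelName T α (levelOf a n) ⌈cw a (⊤ : Fin k) * (n : ℝ)⌉₊ ⁻¹'
          {levelName T α (levelOf a n) ⌈cw a (⊤ : Fin k) * (n : ℝ)⌉₊ x})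
        ≤ Real.exp (-((∑ i, a i * entRate μ T (α i) + ∫ y, f y ∂μ
              - Λ * (cw a ⊤ * μ.real U) - δ) * n)
            + 1 / a 0 * birk T f ⌈a 0 * (n : ℝ)⌉₊ x
            - Λ * birk T (U.indicator 1) ⌈cw a (⊤ : Fin k) * (n : ℝ)⌉₊ x) := by
  have hL : 0 ≤ cw a ⊤ := cw_nonneg ha ⊤
  have hLsum : cw a ⊤ = ∑ i, a i := by
    rw [cw]; congr 1; ext; simp
  set δ' : ℝ := δ / (cw a ⊤ + 2) with hδ'
  have hδ'0 : 0 < δ' := by positivity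
  have hδeq : (cw a ⊤ + 2) * δ' = δ := by rw [hδ']; field_simp
  obtain ⟨g, Bg, hg, hgB, hgint, hinfo⟩ := exists_info hT hμ hαm hα hδ'0
  set t : ℕ → ℕ := fun n => ⌈cw a (⊤ : Fin k) * (n : ℝ)⌉₊ with ht
  set S : ℕ → Ω → ℝ := fun n x => ∑ m ∈ Finset.range (t n), g (levelOf a n m) (T^[m] x) with hS
  have hSm : ∀ n, Measurable (S n) := fun n =>
    Finset.measurable_sum _ fun m _ => (hg _).comp (hT.iterate m)
  set J : ℕ → Ω → ℝ := fun n x => μ.real (levelName T α (levelOf a n) (t n) ⁻¹'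
    {levelName T α (levelOf a n) (t n) x}) with hJ
  have hJm : ∀ n, Measurable (J n) := fun n =>
    (measurable_of_countable fun w : Fin (t n) → κ =>
      μ.real (levelName T α (levelOf a n) (t n) ⁻¹' {w})).comp
      (measurable_levelName hT hαm (levelOf a n) (t n))
  have hSB : ∀ n x, S n x ≤ t n * Bg := fun n x => by
    calc S n x ≤ ∑ m ∈ Finset.range (t n), Bg :=
          Finset.sum_le_sum fun m _ => (le_abs_self _).trans (hgB _ _)
      _ = _ := by simp
  have hev : ∀ᵐ x ∂μ, ∀ᶠ n : ℕ in atTop, J n x * Real.exp (S n x) < Real.exp (δ' * n) := by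
    have hBg : 0 ≤ Bg := by
      obtain ⟨x⟩ : Nonempty Ω := nonempty_of_isProbabilityMeasure μ
      exact (abs_nonneg _).trans (hgB 0 x)
    refine ae_eventually_lt_exp (C := Real.exp ((cw a ⊤ + 1) * Bg))
      (fun n => (hJm n).mul (hSm n).exp)
      (fun n x => mul_nonneg measureReal_nonneg (Real.exp_pos _).le) (fun n x => ?_)
      (fun n => hinfo (t n) _ (monotone_levelOf n)) hδ'0
    rw [← Real.exp_nat_mul]
    have h1 : J n x ≤ 1 := measureReal_le_one
    have h2 : (t n : ℝ) ≤ cw a ⊤ * n + 1 := (Nat.ceil_lt_add_one (by positivity)).le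
    calc J n x * Real.exp (S n x) ≤ 1 * Real.exp (t n * Bg) := by
          gcongr
          exact hSB n x
      _ ≤ _ := by
          rw [one_mul]
          refine Real.exp_le_exp.2 ?_
          rw [← mul_assoc]
          refine mul_le_mul_of_nonneg_right (h2.trans ?_) hBg
          push_cast
          nlinarith [(n.cast_nonneg : (0 : ℝ) ≤ n)]
  choose F hFm hFB hFint hF using fun i => exists_birkhoff_limit hT hμ (hg i) (hgB i)
  obtain ⟨F', hF'm, hF'B, hF'int, hF'⟩ := exists_birkhoff_limit hT hμ hf hB
  have hUm : Measurable (U.indicator (1 : Ω → ℝ)) := measurable_one.indicator hU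
  have hUB : ∀ x, |U.indicator (1 : Ω → ℝ) x| ≤ 1 := fun x => by
    by_cases hx : x ∈ U <;> simp [hx]
  obtain ⟨V, hVm, hVB, hVint, hV⟩ := exists_birkhoff_limit hT hμ hUm hUB
  rw [integral_indicator_one hU] at hVint
  set H : ℕ → Ω → ℝ := fun n x => S n x + 1 / a 0 * birk T f ⌈a 0 * (n : ℝ)⌉₊ x
    - Λ * birk T (U.indicator 1) (t n) x with hH
  set H' : Ω → ℝ := fun x => ∑ i, a i * F i x + F' x - Λ * (cw a ⊤ * V x) with hH'
  have hSeq : ∀ n x, S n x = ∑ i, (birk T (g i) ⌈cw a i * (n : ℝ)⌉₊ x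
      - birk T (g i) ⌈(cw a i - a i) * (n : ℝ)⌉₊ x) := fun n x => by
    rw [hS]
    simp only
    rw [sum_levelOf ha n fun i m => g i (T^[m] x)]
    exact Finset.sum_congr rfl fun i _ => sum_levelTimes ha n i _
  have hlim : ∀ᵐ x ∂μ, Tendsto (fun n : ℕ => H n x / n) atTop (𝓝 (H' x)) := by
    filter_upwards [ae_all_iff.2 hF, hF', hV] with x h1 h2 h3
    have e1 : Tendsto (fun n : ℕ => ∑ i, (birk T (g i) ⌈cw a i * (n : ℝ)⌉₊ x / n
        - birk T (g i) ⌈(cw a i - a i) * (n : ℝ)⌉₊ x / n)) atTop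
        (𝓝 (∑ i, (cw a i * F i x - (cw a i - a i) * F i x))) :=
      tendsto_finsetSum _ fun i _ => (tendsto_birk_ceil (cw_nonneg ha i) (h1 i)).sub
        (tendsto_birk_ceil (sub_nonneg.2 (self_le_cw ha i)) (h1 i))
    have e2 := (tendsto_birk_ceil ha1.le h2).const_mul (1 / a 0)
    have e3 := (tendsto_birk_ceil hL h3).const_mul Λ
    have e := (e1.add e2).sub e3
    refine (e.congr fun n => ?_).trans_eq ?_
    · rw [hH]
      simp only
      rw [hSeq, sub_div, add_div, Finset.sum_div]
      simp only [sub_div, mul_div_assoc]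
      rfl
    · congr 1
      rw [hH']
      simp only
      congr 2
      · exact Finset.sum_congr rfl fun i _ => by ring
      · field_simp
  have hFi : ∀ i, Integrable (fun x => a i * F i x) μ := fun i =>
    (integrable_of_abs_le (hFm i) (hFB i)).const_mul _
  have hF'i : Integrable F' μ := integrable_of_abs_le hF'm hF'B
  have hVi : Integrable (fun x => Λ * (cw a ⊤ * V x)) μ :=
    ((integrable_of_abs_le hVm hVB).const_mul _).const_mul _
  have hsumi : Integrable (fun x => ∑ i, a i * F i x) μ := integrable_finsetSum _ fun i _ => hFi i
  have haddi : Integrable (fun x => ∑ i, a i * F i x + F' x) μ := hsumi.add hF'i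
  have hH'i : Integrable H' μ := haddi.sub hVi
  have hH'int : ∫ x, H' x ∂μ = ∑ i, a i * ∫ x, g i x ∂μ + ∫ x, f x ∂μ
      - Λ * (cw a ⊤ * μ.real U) := by
    simp only [hH']
    rw [integral_sub haddi hVi, integral_add hsumi hF'i,
      integral_finsetSum _ fun i _ => hFi i]
    simp only [integral_const_mul, hFint, hF'int, hVint]
  have hpos : 0 < μ {x | ∫ y, H' y ∂μ ≤ H' x} := measure_integral_le_pos hH'i
  set s₀ : ℝ := ∑ i, a i * entRate μ T (α i) + ∫ y, f y ∂μ - Λ * (cw a ⊤ * μ.real U) - δ with hs₀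
  have hs₀le : s₀ ≤ ∫ y, H' y ∂μ - 2 * δ' := by
    rw [hH'int, hs₀]
    have : ∑ i, a i * entRate μ T (α i) - cw a ⊤ * δ' ≤ ∑ i, a i * ∫ x, g i x ∂μ := by
      rw [hLsum, Finset.sum_mul, ← Finset.sum_sub_distrib]
      refine Finset.sum_le_sum fun i _ => ?_
      rw [← mul_sub]
      exact mul_le_mul_of_nonneg_left (hgint i) (ha i)
    nlinarith
  set good : ℕ → Set Ω := fun N => {x | ∀ n ≥ N, J n x ≤ Real.exp (-(s₀ * n)
    + 1 / a 0 * birk T f ⌈a 0 * (n : ℝ)⌉₊ x - Λ * birk T (U.indicator 1) (t n) x)} with hgood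
  have hae : ∀ᵐ x ∂μ, x ∈ {x | ∫ y, H' y ∂μ ≤ H' x} → x ∈ ⋃ N, good N := by
    filter_upwards [hev, hlim] with x hx1 hx2 hx
    have hx3 : ∀ᶠ n : ℕ in atTop, H' x - δ' < H n x / n :=
      hx2.eventually_const_lt (sub_lt_self _ hδ'0)
    obtain ⟨N, hN⟩ := eventually_atTop.1 (hx1.and (hx3.and (eventually_gt_atTop 0)))
    refine mem_iUnion.2 ⟨N, fun n hn => ?_⟩
    obtain ⟨h1, h2, h3⟩ := hN n hn
    have hn0 : (0 : ℝ) < n := by exact_mod_cast h3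
    rw [lt_div_iff₀ hn0] at h2
    have h4 : (s₀ + δ') * n ≤ H n x := by
      refine le_trans ?_ h2.le
      refine mul_le_mul_of_nonneg_right ?_ hn0.le
      have : ∫ y, H' y ∂μ ≤ H' x := hx
      linarith
    have h5 : J n x ≤ Real.exp (δ' * n) / Real.exp (S n x) :=
      (le_div_iff₀ (Real.exp_pos _)).2 h1.le
    refine h5.trans ?_
    rw [← Real.exp_sub]
    refine Real.exp_le_exp.2 ?_
    simp only [hH] at h4
    linarith
  by_contra! hcon
  have hnull : ∀ N, μ (good N) = 0 := by
    intro N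
    by_contra hne
    obtain ⟨n, hn, x, hx, hlt⟩ := hcon (good N) hne N
    exact absurd (hx n hn) (not_le.2 hlt)
  have : μ {x | ∫ y, H' y ∂μ ≤ H' x} ≤ μ (⋃ N, good N) := measure_mono_ae hae
  rw [measure_iUnion_null hnull] at this
  exact absurd this (not_le.2 hpos)

end LocalEntropy

section LowerBound

/-- The joint code of the levels `j ≥ i`, completed by a constant at the other levels. -/
def tailCode {Ω : Type*} {X κ : Fin k → Type*} (τ : ∀ i, Ω → X i) (c : ∀ i, X i → κ i)
    (d : ∀ i, κ i) (i : Fin k) (x : Ω) (j : Fin k) : κ j :=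
  if i ≤ j then c j (τ j x) else d j

section TailCode

variable {Ω : Type*} [MeasurableSpace Ω] {X κ : Fin k → Type*} [∀ i, MeasurableSpace (X i)]
  {τ : ∀ i, Ω → X i} {c : ∀ i, X i → κ i} {d : ∀ i, κ i}

lemma tailCode_factor {i j : Fin k} (hij : i ≤ j) :
    ∃ φ : (∀ l, κ l) → ∀ l, κ l, tailCode τ c d j = φ ∘ tailCode τ c d i := by
  refine ⟨fun w l => if j ≤ l then w l else d l, ?_⟩
  funext x l
  simp only [tailCode, Function.comp]
  split_ifs with h1 h2
  · rfl
  · exact absurd (hij.trans h1) h2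
  · rfl

variable [∀ i, Fintype (κ i)] [∀ i, MeasurableSpace (κ i)] [∀ i, DiscreteMeasurableSpace (κ i)]

lemma measurable_tailCode (hτ : ∀ i, Measurable (τ i)) (hc : ∀ i, Measurable (c i)) (i : Fin k) :
    Measurable (tailCode τ c d i) := by
  refine measurable_pi_lambda _ fun j => ?_
  by_cases h : i ≤ j
  · simp only [tailCode, h, if_true]
    exact (hc j).comp (hτ j)
  · simp [tailCode, h]

lemma entRate_le_entRate_tailCode {μ : Measure Ω} [IsProbabilityMeasure μ] {T1 : Ω → Ω}
    {T : ∀ i, X i → X i} (hT1 : Measurable T1) (hμ : μ.map T1 = μ) (hT : ∀ i, Measurable (T i))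
    (hτ : ∀ i, Measurable (τ i)) (hτe : ∀ i x, τ i (T1 x) = T i (τ i x))
    (hc : ∀ i, Measurable (c i)) (i : Fin k) :
    entRate (μ.map (τ i)) (T i) (c i) ≤ entRate μ T1 (tailCode τ c d i) := by
  classical
  rw [entRate_map (hτ i) (hT i) (hτe i) (hc i)]
  refine le_of_tendsto_of_tendsto' (tendsto_entRate hT1 hμ ((hc i).comp (hτ i)))
    (tendsto_entRate hT1 hμ (measurable_tailCode hτ hc i)) fun q => ?_
  refine div_le_div_of_nonneg_right ?_ q.cast_nonneg
  refine le_of_eq_of_le ?_ (ent_comp_le μ (measurable_blockCode hT1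
    (measurable_tailCode (d := d) hτ hc i) q) (fun (w : Fin q → ∀ l, κ l) l => w l i))
  congr 1
  funext x l
  simp [blockCode, tailCode]

end TailCode

variable [NeZero k] {X κ : Fin k → Type*} [∀ i, MetricSpace (X i)] [∀ i, Fintype (κ i)]
  {Ω : Type*} [MeasurableSpace Ω] {μ : Measure Ω} [IsProbabilityMeasure μ] {T1 : Ω → Ω}
  {T : ∀ i, X i → X i} {τ : ∀ i, Ω → X i} {a : Fin k → ℝ} {f : Ω → ℝ} {B : ℝ}

lemma measure_inter_le_pterm {c : ∀ i, X i → κ i} {d : ∀ i, κ i}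
    (hτe : ∀ i x, τ i (T1 x) = T i (τ i x)) (ha1 : 0 < a 0) (ha : ∀ i, 0 ≤ a i)
    (hB : ∀ x, |f x| ≤ B) {U G : Set Ω} {ε : ℝ}
    (hsep : ∀ j, ∀ x ∉ U, ∀ y ∉ U, dist (τ j x) (τ j y) < ε → c j (τ j x) = c j (τ j y))
    {lam δ s : ℝ} (hlam : 0 < lam) (hlam1 : lam ≤ 1)
    (hδ : Fintype.card (∀ i, κ i) * lam * (cw a ⊤ + 1) ≤ δ) {n : ℕ} (hn : 0 < n)
    (hG : ∀ x ∈ G,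
      μ.real (levelName T1 (tailCode τ c d) (levelOf a n) ⌈cw a (⊤ : Fin k) * (n : ℝ)⌉₊ ⁻¹'
          {levelName T1 (tailCode τ c d) (levelOf a n) ⌈cw a (⊤ : Fin k) * (n : ℝ)⌉₊ x})
        ≤ Real.exp (-(s * n) + 1 / a 0 * birk T1 f ⌈a 0 * (n : ℝ)⌉₊ x
            - -Real.log lam * birk T1 (U.indicator 1) ⌈cw a (⊤ : Fin k) * (n : ℝ)⌉₊ x))
    {A : Set Ω} {z : Ω} (hA : A ⊆ wBowen T τ a n z (ε / 2)) :
    μ (A ∩ G) ≤ pterm T1 f (a 0) (s - δ) n A := by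
  classical
  set t := ⌈cw a (⊤ : Fin k) * (n : ℝ)⌉₊ with ht
  set C : ℝ := Real.exp (-(s * n) + 1 / a 0 * sSup (birk T1 f ⌈a 0 * (n : ℝ)⌉₊ '' A)) with hC
  set bad : Ω → Finset (Fin t) := fun x => Finset.univ.filter fun m => T1^[m] x ∈ U with hbad
  have hcard : ∀ x, lam ^ (bad x).card
      = Real.exp (Real.log lam * birk T1 (U.indicator 1) t x) := by
    intro x
    have h1 : birk T1 (U.indicator 1) t x = (bad x).card := by
      rw [hbad, birk, Finset.sum_range, Finset.card_filter]
      push_cast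
      exact Finset.sum_congr rfl fun m _ => by simp [indicator]
    rw [h1, mul_comm, Real.exp_nat_mul, Real.exp_log hlam]
  have hagree : ∀ x ∈ A ∩ G, ∀ y ∈ A ∩ G, ∀ m, m ∉ bad x → m ∉ bad y →
      levelName T1 (tailCode τ c d) (levelOf a n) t x m
        = levelName T1 (tailCode τ c d) (levelOf a n) t y m := by
    intro x hx y hy m hmx hmy
    have hmx' : T1^[m] x ∉ U := fun h => hmx (by simpa [hbad] using h)
    have hmy' : T1^[m] y ∉ U := fun h => hmy (by simpa [hbad] using h)
    funext j
    simp only [levelName, tailCode]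
    split_ifs with hj
    · refine hsep j _ hmx' _ hmy' ?_
      have hm : (m : ℕ) < ⌈cw a j * (n : ℝ)⌉₊ :=
        (lt_of_levelOf m.2).trans_le (ceil_cw_mono ha n hj)
      rw [semiconj_iterate hτe, semiconj_iterate hτe]
      have h1 := hA hx.1 j m hm
      have h2 := hA hy.1 j m hm
      calc dist ((T j)^[m] (τ j x)) ((T j)^[m] (τ j y))
          ≤ dist ((T j)^[m] (τ j z)) ((T j)^[m] (τ j x))
            + dist ((T j)^[m] (τ j z)) ((T j)^[m] (τ j y)) := dist_triangle_left _ _ _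
        _ < ε := by linarith
    · rfl
  have hfib : ∀ x ∈ A ∩ G, μ.real (levelName T1 (tailCode τ c d) (levelOf a n) t ⁻¹'
      {levelName T1 (tailCode τ c d) (levelOf a n) t x}) ≤ C * lam ^ (bad x).card := by
    intro x hx
    refine (hG x hx.2).trans ?_
    rw [hcard, hC, ← Real.exp_add]
    refine Real.exp_le_exp.2 ?_
    have h1 : birk T1 f ⌈a 0 * (n : ℝ)⌉₊ x ≤ sSup (birk T1 f ⌈a 0 * (n : ℝ)⌉₊ '' A) :=
      le_csSup (bddAbove_birk hB _ A) (mem_image_of_mem _ hx.1)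
    have h2 := mul_le_mul_of_nonneg_left h1 (one_div_pos.2 ha1).le
    linarith
  refine (measure_le_of_agree (Real.exp_pos _).le hlam.le hlam1 hagree hfib).trans ?_
  rw [pterm]
  refine ENNReal.ofReal_le_ofReal ?_
  have hL : 0 ≤ cw a ⊤ := cw_nonneg ha ⊤
  have hn1 : (1 : ℝ) ≤ n := by exact_mod_cast hn
  have htn : (t : ℝ) ≤ (cw a ⊤ + 1) * n := by
    have : (t : ℝ) ≤ cw a ⊤ * n + 1 := (Nat.ceil_lt_add_one (by positivity)).le
    linarith
  set q : ℝ := Fintype.card (∀ i, κ i) * lam with hq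
  have hq0 : 0 ≤ q := by positivity
  have h1 : (1 + q) ^ t ≤ Real.exp (δ * n) := by
    calc (1 + q) ^ t ≤ Real.exp q ^ t := by
          refine pow_le_pow_left₀ (by positivity) ?_ _
          rw [add_comm]
          exact Real.add_one_le_exp q
      _ = Real.exp (t * q) := (Real.exp_nat_mul _ _).symm
      _ ≤ Real.exp (δ * n) := by
          refine Real.exp_le_exp.2 ?_
          calc (t : ℝ) * q ≤ (cw a ⊤ + 1) * n * q := mul_le_mul_of_nonneg_right htn hq0
            _ = q * (cw a ⊤ + 1) * n := by ring
            _ ≤ δ * n := mul_le_mul_of_nonneg_right hδ n.cast_nonneg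
  calc C * (1 + q) ^ t ≤ C * Real.exp (δ * n) :=
        mul_le_mul_of_nonneg_left h1 (Real.exp_pos _).le
    _ = _ := by
        rw [hC, ← Real.exp_add]
        congr 1
        ring

lemma lamBowenN_ne_zero_of_le_pterm {G : Set Ω} (hG : μ G ≠ 0) {s ε : ℝ} {N : ℕ}
    (h : ∀ n ≥ N, ∀ (A : Set Ω) (z : Ω), A ⊆ wBowen T τ a n z ε →
      μ (A ∩ G) ≤ pterm T1 f (a 0) s n A) :
    lamBowenN T1 T τ a f s ε N univ ≠ 0 := by
  refine (lt_of_lt_of_le (pos_iff_ne_zero.2 hG) ?_).ne'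
  refine le_iInf fun D => le_iInf fun hD => le_iInf fun hD' => le_iInf fun hcov => ?_
  have := hD.to_subtype
  calc μ G ≤ μ (⋃ p : D, p.1.2 ∩ G) := by
        refine measure_mono fun x hx => ?_
        obtain ⟨p, hp, hxp⟩ := mem_iUnion₂.1 (hcov (mem_univ x))
        exact mem_iUnion.2 ⟨⟨p, hp⟩, hxp, hx⟩
    _ ≤ ∑' p : D, μ (p.1.2 ∩ G) := measure_iUnion_le _
    _ ≤ ∑' p : D, pterm T1 f (a 0) s p.1.1 p.1.2 := ENNReal.tsum_le_tsum fun p => by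
        obtain ⟨hN, -, x, hx⟩ := hD' p.1 p.2
        exact h p.1.1 hN p.1.2 x hx

theorem exists_lamBowenN_ne_zero [∀ i, CompactSpace (X i)] [∀ i, MeasurableSpace (X i)]
    [∀ i, BorelSpace (X i)] [∀ i, MeasurableSpace (κ i)] [∀ i, DiscreteMeasurableSpace (κ i)]
    (hT1 : Measurable T1) (hμ : μ.map T1 = μ) (hT : ∀ i, Measurable (T i))
    (hτ : ∀ i, Measurable (τ i)) (hτe : ∀ i x, τ i (T1 x) = T i (τ i x)) (ha1 : 0 < a 0)
    (ha : ∀ i, 0 ≤ a i) (hf : Measurable f) (hB : ∀ x, |f x| ≤ B) {c : ∀ i, X i → κ i}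
    (hc : ∀ i, Measurable (c i)) {δ : ℝ} (hδ : 0 < δ) :
    ∃ ε : ℝ, 0 < ε ∧ ∃ N, lamBowenN T1 T τ a f
      (∑ i, a i * entRate (μ.map (τ i)) (T i) (c i) + ∫ x, f x ∂μ - 3 * δ) ε N univ ≠ 0 := by
  obtain ⟨x₀⟩ : Nonempty Ω := nonempty_of_isProbabilityMeasure μ
  set d : ∀ i, κ i := fun i => c i (τ i x₀) with hd
  have hL : 0 ≤ cw a ⊤ := cw_nonneg ha ⊤
  set lam : ℝ := min 1 (δ / ((Fintype.card (∀ i, κ i) + 1) * (cw a ⊤ + 1))) with hlam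
  have hlam0 : 0 < lam := lt_min one_pos (by positivity)
  have hlam1 : lam ≤ 1 := min_le_left _ _
  have hlamδ : Fintype.card (∀ i, κ i) * lam * (cw a ⊤ + 1) ≤ δ := by
    have h1 : lam * ((Fintype.card (∀ i, κ i) + 1) * (cw a ⊤ + 1)) ≤ δ :=
      (le_div_iff₀ (by positivity)).1 (min_le_right _ _)
    nlinarith [mul_nonneg hlam0.le (add_nonneg hL zero_le_one)]
  have hlog : 0 ≤ -Real.log lam := neg_nonneg.2 (Real.log_nonpos hlam0.le hlam1)
  set η : ℝ := δ / (-Real.log lam * cw a ⊤ * k + 1) with hη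
  have hη0 : 0 < η := by positivity
  have hprob : ∀ i, IsProbabilityMeasure (μ.map (τ i)) := fun i =>
    Measure.isProbabilityMeasure_map (hτ i).aemeasurable
  choose V hVm hVμ ε hε hVsep using fun i =>
    exists_small_bad_set (μ.map (τ i)) (hc i) (η := ENNReal.ofReal η) (by simpa using hη0)
  obtain ⟨ε₀, hε₀, hεle⟩ := exists_pos_forall_le hε
  set U : Set Ω := ⋃ i, τ i ⁻¹' V i with hU
  have hUm : MeasurableSet U := MeasurableSet.iUnion fun i => hτ i (hVm i)
  have hUμ : μ.real U ≤ k * η := by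
    have h1 : μ U ≤ ENNReal.ofReal (k * η) := by
      calc μ U ≤ ∑ i, μ (τ i ⁻¹' V i) := measure_iUnion_fintype_le _ _
        _ ≤ ∑ _i : Fin k, ENNReal.ofReal η := Finset.sum_le_sum fun i _ => by
            rw [← Measure.map_apply (hτ i) (hVm i)]
            exact hVμ i
        _ = ENNReal.ofReal (k * η) := by
            rw [Finset.sum_const, ← ENNReal.ofReal_nsmul]
            simp
    exact ENNReal.toReal_le_of_le_ofReal (by positivity) h1
  have hUδ : -Real.log lam * (cw a ⊤ * μ.real U) ≤ δ := by
    have h1 : η * (-Real.log lam * cw a ⊤ * k + 1) = δ := div_mul_cancel₀ _ (by positivity)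
    have h2 : -Real.log lam * cw a ⊤ * μ.real U ≤ -Real.log lam * cw a ⊤ * (k * η) :=
      mul_le_mul_of_nonneg_left hUμ (by positivity)
    nlinarith
  obtain ⟨G, hG, N, hN⟩ := exists_large_set (α := tailCode τ c d) ha1 ha hT1 hμ
    (measurable_tailCode hτ hc) (fun i j hij => tailCode_factor hij) hf hB hUm (-Real.log lam) hδ
  set s : ℝ := ∑ i, a i * entRate (μ.map (τ i)) (T i) (c i) + ∫ x, f x ∂μ - 2 * δ with hs
  refine ⟨ε₀ / 2, by positivity, max N 1, ?_⟩
  have hs' : ∑ i, a i * entRate (μ.map (τ i)) (T i) (c i) + ∫ x, f x ∂μ - 3 * δ = s - δ := by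
    rw [hs]; ring
  rw [hs']
  refine lamBowenN_ne_zero_of_le_pterm hG fun n hn A z hA => ?_
  refine measure_inter_le_pterm (c := c) (d := d) (U := U) hτe ha1 ha hB ?_ hlam0 hlam1 hlamδ
    ((le_max_right N 1).trans hn) (fun x hx => ?_) hA
  · intro j x hx y hy hxy
    exact hVsep j _ (fun h => hx (mem_iUnion.2 ⟨j, h⟩)) _ (fun h => hy (mem_iUnion.2 ⟨j, h⟩))
      (hxy.trans_le (hεle j))
  · refine (hN n ((le_max_left N 1).trans hn) x hx).trans (Real.exp_le_exp.2 ?_)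
    have h1 : ∑ i, a i * entRate (μ.map (τ i)) (T i) (c i)
        ≤ ∑ i, a i * entRate μ T1 (tailCode τ c d i) := Finset.sum_le_sum fun i _ =>
      mul_le_mul_of_nonneg_left (entRate_le_entRate_tailCode hT1 hμ hT hτ hτe hc i) (ha i)
    have h2 : s * n ≤ (∑ i, a i * entRate μ T1 (tailCode τ c d i) + ∫ y, f y ∂μ
        - -Real.log lam * (cw a ⊤ * μ.real U) - δ) * n :=
      mul_le_mul_of_nonneg_right (by linarith) n.cast_nonneg
    linarith

end LowerBound

section ExtendedReals

lemma EReal_coe_sum {ι : Type*} (s : Finset ι) (g : ι → ℝ) :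
    ((∑ i ∈ s, g i : ℝ) : EReal) = ∑ i ∈ s, (g i : EReal) :=
  map_sum (⟨⟨Real.toEReal, EReal.coe_zero⟩, EReal.coe_add⟩ : ℝ →+ EReal) g s

lemma tendsto_sum_EReal {ι : Type*} (s : Finset ι) {u : ℕ → ι → EReal} {v : ι → EReal}
    (hv : ∀ i, 0 ≤ v i) (h : ∀ i, Tendsto (fun n => u n i) atTop (𝓝 (v i))) :
    Tendsto (fun n => ∑ i ∈ s, u n i) atTop (𝓝 (∑ i ∈ s, v i)) := by
  classical
  induction s using Finset.induction_on with
  | empty => simp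
  | insert i s hi ih =>
    simp only [Finset.sum_insert hi]
    have hne : ∀ {e : EReal}, 0 ≤ e → e ≠ ⊥ := fun he =>
      ((EReal.bot_lt_coe 0).trans_le he).ne'
    exact (EReal.continuousAt_add (p := (v i, ∑ j ∈ s, v j))
      (Or.inr (hne (Finset.sum_nonneg fun j _ => hv j)))
      (Or.inl (hne (hv i)))).tendsto.comp ((h i).prodMk_nhds ih)

/-- Weighted sums of suprema of nonnegative reals are bounded by the values at the members. -/
lemma sum_mul_add_le_of_forall_mem {a : Fin k → ℝ} (ha : ∀ i, 0 ≤ a i) {S : Fin k → Set ℝ}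
    (hS : ∀ i, (S i).Nonempty) (h0 : ∀ i, ∀ e ∈ S i, 0 ≤ e) {b : ℝ} {P : EReal}
    (h : ∀ e : Fin k → ℝ, (∀ i, e i ∈ S i) → ((∑ i, a i * e i + b : ℝ) : EReal) ≤ P) :
    ∑ i, (a i : EReal) * sSup (Real.toEReal '' S i) + (b : EReal) ≤ P := by
  have hu : ∀ i, ∃ u : ℕ → ℝ, (∀ n, u n ∈ S i) ∧
      Tendsto (fun n => (u n : EReal)) atTop (𝓝 (sSup (Real.toEReal '' S i))) := by
    intro i
    obtain ⟨u, -, hu, hmem⟩ := exists_seq_tendsto_sSup ((hS i).image Real.toEReal)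
      (OrderTop.bddAbove _)
    choose v hv hvu using hmem
    exact ⟨v, hv, by simpa only [hvu] using hu⟩
  choose u huS hu using hu
  have hsup0 : ∀ i, 0 ≤ sSup (Real.toEReal '' S i) := fun i => by
    obtain ⟨e, he⟩ := hS i
    exact (EReal.coe_nonneg.2 (h0 i e he)).trans (le_sSup (mem_image_of_mem _ he))
  have hmul : ∀ i, Tendsto (fun n => (a i : EReal) * u i n) atTop
      (𝓝 ((a i : EReal) * sSup (Real.toEReal '' S i))) := by
    intro i
    exact EReal.Tendsto.const_mul (hu i) (Or.inl (EReal.coe_ne_bot _))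
      (Or.inl (EReal.coe_ne_top _))
  have hsum := tendsto_sum_EReal Finset.univ (u := fun n i => (a i : EReal) * u i n)
    (fun i => mul_nonneg (EReal.coe_nonneg.2 (ha i)) (hsup0 i)) hmul
  have hfin : Tendsto (fun n => ∑ i, (a i : EReal) * u i n + (b : EReal)) atTop
      (𝓝 (∑ i, (a i : EReal) * sSup (Real.toEReal '' S i) + (b : EReal))) :=
    (EReal.continuousAt_add (p := (_, (b : EReal))) (Or.inr (EReal.coe_ne_bot b))
      (Or.inr (EReal.coe_ne_top b))).tendsto.comp (hsum.prodMk_nhds tendsto_const_nhds)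
  refine le_of_tendsto' hfin fun n => ?_
  have h1 := h (fun i => u i n) fun i => huS i n
  rw [EReal.coe_add, EReal_coe_sum] at h1
  simpa only [EReal.coe_mul] using h1

end ExtendedReals

section VariationalPrinciple

lemma IsPart.exists_code {Y ι : Type*} [MeasurableSpace Y] [MeasurableSpace ι] [Finite ι]
    [MeasurableSingletonClass ι] {β : ι → Set Y} (hβ : IsPart β) :
    ∃ c : Y → ι, Measurable c ∧ β = fun j => c ⁻¹' {j} := by
  have hex : ∀ y, ∃ j, y ∈ β j := fun y => mem_iUnion.1 (hβ.2.2 ▸ mem_univ y)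
  choose c hc using hex
  have heq : β = fun j => c ⁻¹' {j} := by
    funext j
    ext y
    refine ⟨fun hy => ?_, fun hy => ?_⟩
    · by_contra hne
      exact Set.disjoint_left.1 (hβ.2.1 _ _ hne) (hc y) hy
    · have : c y = j := hy
      exact this ▸ hc y
  refine ⟨c, measurable_to_countable' fun j => ?_, heq⟩
  have := hβ.1 j
  rwa [heq] at this

/-- The entropy rates of the finite codes of a system. -/
def entRates {Y : Type*} [MeasurableSpace Y] (ν : Measure Y) (S : Y → Y) : Set ℝ :=
  {e | ∃ (m : ℕ) (c : Y → Fin m), Measurable c ∧ e = entRate ν S c}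

lemma entRates_nonempty {Y : Type*} [MeasurableSpace Y] (ν : Measure Y) (S : Y → Y) :
    (entRates ν S).Nonempty :=
  ⟨_, 1, fun _ => 0, measurable_const, rfl⟩

lemma hKS_eq_sSup_entRates {Y : Type*} [MeasurableSpace Y] {ν : Measure Y}
    [IsProbabilityMeasure ν] {S : Y → Y} (hS : Measurable S) (hν : ν.map S = ν) :
    hKS ν S = sSup (Real.toEReal '' entRates ν S) := by
  refine le_antisymm (iSup_le ?_) (sSup_le ?_)
  · rintro ⟨m, β, hβ⟩
    obtain ⟨c, hc, rfl⟩ := hβ.exists_code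
    exact le_sSup ⟨_, ⟨m, c, hc, rfl⟩, (hPart_eq_entRate hS hν hc).symm⟩
  · rintro _ ⟨_, ⟨m, c, hc, rfl⟩, rfl⟩
    exact entRate_le_hKS hS hν hc

variable [NeZero k] {X : Fin k → Type*} [∀ i, MetricSpace (X i)] {Ω : Type*} [MeasurableSpace Ω]
  {T1 : Ω → Ω} {T : ∀ i, X i → X i} {τ : ∀ i, Ω → X i} {a : Fin k → ℝ} {f : Ω → ℝ}

lemma lamBowenN_anti {s s' ε : ℝ} (h : s ≤ s') (N : ℕ) (Z : Set Ω) :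
    lamBowenN T1 T τ a f s' ε N Z ≤ lamBowenN T1 T τ a f s ε N Z := by
  refine iInf_mono fun D => iInf_mono fun _ => iInf_mono fun _ => iInf_mono fun _ =>
    ENNReal.tsum_le_tsum fun p => ENNReal.ofReal_le_ofReal (Real.exp_le_exp.2 ?_)
  have := mul_le_mul_of_nonneg_right h (p.1.1.cast_nonneg : (0 : ℝ) ≤ p.1.1)
  linarith

lemma le_PBowen_of_lamBowenN_ne_zero {s ε : ℝ} (hε : 0 < ε) {N : ℕ} {Z : Set Ω}
    (h : lamBowenN T1 T τ a f s ε N Z ≠ 0) : (s : EReal) ≤ PBowen T1 T τ a Z f := by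
  refine le_trans ?_ (le_iSup (fun e : {e : ℝ // 0 < e} => PBowenEps T1 T τ a Z f e.1) ⟨ε, hε⟩)
  refine le_sInf ?_
  rintro _ ⟨s', hs', rfl⟩
  refine EReal.coe_le_coe_iff.2 (le_of_not_gt fun hlt => h ?_)
  have h1 : lamBowenN T1 T τ a f s' ε N Z = 0 := ENNReal.iSup_eq_zero.1 hs' N
  exact le_antisymm ((lamBowenN_anti hlt.le N Z).trans h1.le) bot_le

theorem sum_hKS_add_integral_le_PBowen [∀ i, CompactSpace (X i)] [∀ i, MeasurableSpace (X i)]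
    [∀ i, BorelSpace (X i)] {μ : Measure Ω} [IsProbabilityMeasure μ] {B : ℝ}
    (hT1 : Measurable T1) (hμ : μ.map T1 = μ) (hT : ∀ i, Measurable (T i))
    (hτ : ∀ i, Measurable (τ i)) (hτe : ∀ i x, τ i (T1 x) = T i (τ i x)) (ha1 : 0 < a 0)
    (ha : ∀ i, 0 ≤ a i) (hf : Measurable f) (hB : ∀ x, |f x| ≤ B) :
    ∑ i, (a i : EReal) * hKS (μ.map (τ i)) (T i) + ((∫ x, f x ∂μ : ℝ) : EReal)
      ≤ PBowen T1 T τ a univ f := by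
  have hprob : ∀ i, IsProbabilityMeasure (μ.map (τ i)) := fun i =>
    Measure.isProbabilityMeasure_map (hτ i).aemeasurable
  have hinv : ∀ i, (μ.map (τ i)).map (T i) = μ.map (τ i) := fun i => by
    rw [Measure.map_map (hT i) (hτ i), show T i ∘ τ i = τ i ∘ T1 from funext fun x =>
        (hτe i x).symm, ← Measure.map_map (hτ i) hT1, hμ]
  simp only [hKS_eq_sSup_entRates (hT _) (hinv _)]
  refine sum_mul_add_le_of_forall_mem ha (fun i => entRates_nonempty _ _) ?_ fun e he => ?_
  · rintro i _ ⟨m, c, hc, rfl⟩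
    exact entRate_nonneg (hT i) (hinv i) hc
  choose m c hc hec using he
  refine EReal.ge_of_forall_gt_iff_ge.1 fun r hr => ?_
  have hδ : 0 < ((∑ i, a i * e i + ∫ x, f x ∂μ) - r) / 3 := by
    have := EReal.coe_lt_coe_iff.1 hr
    linarith
  obtain ⟨ε, hε, N, hN⟩ := exists_lamBowenN_ne_zero hT1 hμ hT hτ hτe ha1 ha hf hB hc hδ
  refine le_PBowen_of_lamBowenN_ne_zero hε (N := N) ?_
  convert hN using 2
  simp only [← hec]
  ring

theorem PBowen_le_of_forall_measure {R : EReal}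
    (h : ∀ s δ ε : ℝ, 0 < δ → 0 < ε → ∀ N, lamBowenN T1 T τ a f s ε N univ ≠ 0 →
      ((s - δ : ℝ) : EReal) ≤ R) : PBowen T1 T τ a univ f ≤ R := by
  refine iSup_le fun ε => ?_
  by_contra! hlt
  obtain ⟨r, hRr, hr⟩ := EReal.lt_iff_exists_real_btwn.1 hlt
  obtain ⟨s, hrs, hs⟩ := EReal.lt_iff_exists_real_btwn.1 hr
  have hne : lamBowen T1 T τ a f s ε univ ≠ 0 := fun h0 =>
    not_le.2 hs (show PBowenEps T1 T τ a univ f ε ≤ s from sInf_le ⟨s, h0, rfl⟩)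
  obtain ⟨N, hN⟩ : ∃ N, lamBowenN T1 T τ a f s ε N univ ≠ 0 := by
    by_contra! h0
    exact hne (ENNReal.iSup_eq_zero.2 h0)
  have h1 := h s (s - r) ε (sub_pos.2 (EReal.coe_lt_coe_iff.1 hrs)) ε.2 N hN
  rw [sub_sub_cancel] at h1
  exact absurd h1 (not_le.2 hRr)

end VariationalPrinciple

/-- (variational principle for weighted topological pressure)
`P^𝐚(T₁, f) = sup_{μ ∈ M(X₁,T₁)} (∑_i a_i h_{τ_{i-1}μ}(T_i) + ∫ f dμ)`. -/
theorem weighted_variational_principle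
    {k : ℕ} [NeZero k]
    (X : Fin k → Type) [∀ i, MetricSpace (X i)] [∀ i, CompactSpace (X i)]
    [∀ i, MeasurableSpace (X i)] [∀ i, BorelSpace (X i)]
    (T : ∀ i, X i → X i) (hT : ∀ i, Continuous (T i))
    (τ : ∀ i, X 0 → X i) (hτ0 : τ 0 = id)
    (hτc : ∀ i, Continuous (τ i)) (hτs : ∀ i, Function.Surjective (τ i))
    (hτe : ∀ i, τ i ∘ T 0 = T i ∘ τ i)
    (hchain : ∀ i j : Fin k, i ≤ j → ∃ p : X i → X j,
        Continuous p ∧ p ∘ T i = T j ∘ p ∧ p ∘ τ i = τ j)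
    (a : Fin k → ℝ) (ha1 : 0 < a 0) (ha : ∀ i, 0 ≤ a i)
    (f : X 0 → ℝ) (hf : Continuous f) :
    PBowen (T 0) T τ a Set.univ f
      = ⨆ μ : {μ : Measure (X 0) // IsProbabilityMeasure μ ∧ μ.map (T 0) = μ},
          (∑ i : Fin k, ((a i : ℝ) : EReal) * hKS (μ.1.map (τ i)) (T i))
            + ((∫ x, f x ∂μ.1 : ℝ) : EReal) := by
  have hτe' : ∀ i x, τ i (T 0 x) = T i (τ i x) := fun i x => congrFun (hτe i) x
  refine le_antisymm (PBowen_le_of_forall_measure fun s δ ε hδ hε N hN => ?_) (iSup_le ?_)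
  · have : Nonempty (X 0) := by
      by_contra hne
      rw [not_nonempty_iff] at hne
      refine hN (le_antisymm ?_ bot_le)
      exact (iInf_le _ ∅).trans <| (iInf_le _ countable_empty).trans <|
        (iInf_le _ (by simp)).trans <| (iInf_le _ fun x => isEmptyElim x).trans (by simp)
    obtain ⟨μ, hμp, hμ, h, hh, hle⟩ := exists_measure_of_lamBowenN_ne_zero hT hτ0 hτc hτe'
      (fun i j hij => (hchain i j hij).imp fun p hp => ⟨hp.1, hp.2.2⟩) ha1 ha hf (half_pos hδ) hε hN
    refine le_trans ?_ (le_iSup (fun μ : {μ : Measure (X 0) //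
      IsProbabilityMeasure μ ∧ μ.map (T 0) = μ} =>
        (∑ i : Fin k, ((a i : ℝ) : EReal) * hKS (μ.1.map (τ i)) (T i))
          + ((∫ x, f x ∂μ.1 : ℝ) : EReal)) ⟨μ, hμp, hμ⟩)
    rw [mul_div_cancel₀ _ two_ne_zero] at hle
    refine (EReal.coe_le_coe_iff.2 hle).trans ?_
    rw [EReal.coe_add, EReal_coe_sum]
    refine add_le_add (Finset.sum_le_sum fun i _ => ?_) le_rfl
    rw [EReal.coe_mul]
    exact mul_le_mul_of_nonneg_left (hh i) (EReal.coe_nonneg.2 (ha i))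
  · rintro ⟨μ, hμp, hμ⟩
    obtain ⟨B, -, hB⟩ := exists_abs_le_of_continuous hf
    exact sum_hKS_add_integral_le_PBowen (hT 0).measurable hμ (fun i => (hT i).measurable)
      (fun i => (hτc i).measurable) hτe' ha1 ha hf.measurable hB

end WTP
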